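/- If the Generalized Riemann Hypothesis holds for all Dedekind zeta functions (for every number field K, every zero ρ = β + iγ of ζ_K with 0 < β < 1 satisfies β = 1/2), then for every constant C > 4 there is a constant c > 0 such that for every irreducible polynomial f ∈ ℤ[x] of degree d ≥ 2 all of whose coefficients have absolute value at most 2^σ (σ a positive integer), and for every real x ≥ exp(c·(log(d²σ + d³))^{2+C²}), one has π_f(x) ≥ x·(1/(d·log x) − exp(−(log x)^{1/C} / (log(d²σ + d³))^C)). -/

import Mathlib

open scoped Classical

noncomputable section

/-- `zeta` is the (unique) analytic continuation of the Dedekind zeta function of the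
number field `K`: it is analytic away from `s = 1` and agrees with the Dirichlet series
`∑_𝔞 (N𝔞)^{-s}` (sum over nonzero integral ideals) for `Re s > 1`. -/
def IsDedekindZeta (K : Type) [Field K] [NumberField K] (zeta : ℂ → ℂ) : Prop :=
  DifferentiableOn ℂ zeta {s : ℂ | s ≠ 1} ∧
    ∀ s : ℂ, 1 < s.re →
      zeta s = ∑' I : {I : Ideal (NumberField.RingOfIntegers K) // I ≠ ⊥},
        (Ideal.absNorm (I : Ideal (NumberField.RingOfIntegers K)) : ℂ) ^ (-s)

/-- GRH for all Dedekind zeta functions: every non-trivial zero has real part `1/2`. -/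
def DedekindGRH : Prop :=
  ∀ (K : Type) [Field K] [NumberField K], ∀ zeta : ℂ → ℂ, IsDedekindZeta K zeta →
    ∀ ρ : ℂ, zeta ρ = 0 → 0 < ρ.re → ρ.re < 1 → ρ.re = 1 / 2

/-- `piPoly f x` is the number of primes `p ≤ x` such that the reduction of `f` mod `p`
has a root in `𝔽_p`. -/
def piPoly (f : Polynomial ℤ) (x : ℝ) : ℕ :=
  ((Finset.range (⌊x⌋₊ + 1)).filter
    (fun p => p.Prime ∧ ∃ a : ZMod p, Polynomial.aeval a f = 0)).card

namespace MRH
open MeasureTheory Matrix Real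

lemma summable_pi_prod {ι : Type*} [Fintype ι] (f : ℤ → ℝ) (h0 : ∀ n, 0 ≤ f n) (hf : Summable f) :
    Summable (fun n : ι → ℤ => ∏ i, f (n i)) := by
  refine summable_of_sum_le (c := (∑' n, f n) ^ Fintype.card ι)
    (fun n => Finset.prod_nonneg fun i _ => h0 _) fun s => ?_
  calc ∑ n ∈ s, ∏ i, f (n i) ≤ ∑ n ∈ Fintype.piFinset (fun i => s.image (fun n => n i)),
        ∏ i, f (n i) := by
        refine Finset.sum_le_sum_of_subset_of_nonneg (fun n hn => ?_)
          (fun n _ _ => Finset.prod_nonneg fun i _ => h0 _)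
        rw [Fintype.mem_piFinset]
        exact fun i => Finset.mem_image_of_mem _ hn
    _ = ∏ i : ι, ∑ k ∈ s.image (fun n => n i), f k := by
        rw [Finset.prod_univ_sum]
    _ ≤ ∏ i : ι, ∑' n, f n := by
        refine Finset.prod_le_prod (fun i _ => Finset.sum_nonneg fun k _ => h0 _) fun i _ => ?_
        exact hf.sum_le_tsum _ (fun k _ => h0 _)
    _ = _ := by simp

lemma summable_exp_sq (c : ℝ) (hc : 0 < c) : Summable (fun n : ℤ => rexp (-c * (n : ℝ) ^ 2)) := by
  have := (summable_jacobiTheta₂_term_iff 0 (Complex.I * (c / π : ℝ))).mpr (by simp; positivity)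
  refine (this.norm).congr fun n => ?_
  rw [norm_jacobiTheta₂_term]
  congr 1
  simp
  field_simp

variable {ι : Type*} [Fintype ι]

def qf (B : Matrix ι ι ℝ) (x : ι → ℝ) : ℝ := ∑ i, (B *ᵥ x) i ^ 2

lemma qf_lower (B : Matrix ι ι ℝ) (hB : B.det ≠ 0) :
    ∃ c > 0, ∀ x, c * ∑ i, x i ^ 2 ≤ qf B x := by
  set S := ∑ i, ∑ j, B⁻¹ i j ^ 2
  have hS : 0 ≤ S := Finset.sum_nonneg fun i _ => Finset.sum_nonneg fun j _ => sq_nonneg _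
  refine ⟨(S + 1)⁻¹, by positivity, fun x => ?_⟩
  have h1 : ∑ i, x i ^ 2 ≤ S * qf B x := by
    rw [Finset.sum_mul]
    refine Finset.sum_le_sum fun i _ => ?_
    have hx : x i = ∑ j, B⁻¹ i j * (B *ᵥ x) j := by
      have : B⁻¹ *ᵥ (B *ᵥ x) = x := by
        rw [mulVec_mulVec, nonsing_inv_mul _ (isUnit_iff_ne_zero.mpr hB), one_mulVec]
      conv_lhs => rw [← this]
      rfl
    rw [hx]
    exact Finset.sum_mul_sq_le_sq_mul_sq _ _ _
  have h2 : 0 ≤ qf B x := Finset.sum_nonneg fun i _ => sq_nonneg _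
  rw [inv_mul_le_iff₀ (by positivity)]
  linarith

lemma qf_bound (B : Matrix ι ι ℝ) (hB : B.det ≠ 0) :
    ∃ u : (ι → ℤ) → ℝ, Summable u ∧ (∀ n, 0 ≤ u n) ∧ ∀ R : ℝ, ∃ C : ℝ, ∀ x : ι → ℝ, (∀ i, |x i| ≤ R) →
      ∀ n : ι → ℤ, rexp (-π * qf B (fun i => x i + n i)) ≤ C * u n := by
  obtain ⟨c, hc, h⟩ := qf_lower B hB
  have hs := summable_pi_prod (ι := ι) (fun k : ℤ => rexp (-(π * c / 2) * (k : ℝ) ^ 2))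
    (fun n => (exp_pos _).le) (summable_exp_sq _ (by positivity))
  refine ⟨_, hs, fun n => Finset.prod_nonneg fun i _ => (exp_pos _).le, fun R => ?_⟩
  refine ⟨rexp (π * c * ∑ _i : ι, R ^ 2), fun x hx n => ?_⟩
  rw [← exp_sum, ← exp_add, exp_le_exp]
  have h1 := h (fun i => x i + n i)
  have h2 : ∑ i, ((n i : ℝ) ^ 2 / 2 - R ^ 2) ≤ ∑ i, (x i + n i) ^ 2 := by
    refine Finset.sum_le_sum fun i _ => ?_
    have h3 : x i ^ 2 ≤ R ^ 2 := sq_le_sq' (abs_le.mp (hx i)).1 (abs_le.mp (hx i)).2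
    nlinarith [sq_nonneg (2 * x i + n i)]
  have h4 : π * (c * ∑ i, ((n i : ℝ) ^ 2 / 2 - R ^ 2)) ≤ π * qf B (fun i => x i + n i) :=
    mul_le_mul_of_nonneg_left ((mul_le_mul_of_nonneg_left h2 hc.le).trans h1) pi_pos.le
  rw [Finset.sum_sub_distrib, ← Finset.sum_div] at h4
  rw [← Finset.mul_sum]
  linarith

lemma qf_continuous (B : Matrix ι ι ℝ) : Continuous (qf B) := by
  unfold qf mulVec dotProduct
  fun_prop

def gg (B : Matrix ι ι ℝ) (x : ι → ℝ) : ℂ := Complex.exp (-π * qf B x)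

lemma gg_continuous (B : Matrix ι ι ℝ) : Continuous (gg B) := by
  have := qf_continuous B
  unfold gg
  fun_prop

lemma gg_norm (B : Matrix ι ι ℝ) (x) : ‖gg B x‖ = rexp (-π * qf B x) := by
  rw [gg, ← Complex.ofReal_neg, ← Complex.ofReal_mul, Complex.norm_exp_ofReal]

lemma gg_integrable_gauss : Integrable (fun v : ι → ℝ => Complex.exp (-π * ∑ i, (v i : ℂ) ^ 2)) := by
  have := GaussianFourier.integrable_cexp_neg_mul_sum_add (b := π) (ι := ι) (by simpa using pi_pos) 0
  simpa using this

lemma integral_mulVec (B : Matrix ι ι ℝ) (hB : B.det ≠ 0) (h : (ι → ℝ) → ℂ) (hh : Continuous h) :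
    ∫ x, h (B *ᵥ x) = |B.det|⁻¹ * ∫ x, h x := by
  have h1 := Real.map_matrix_volume_pi_eq_smul_volume_pi hB
  have h2 : ∫ x, h x ∂(Measure.map (⇑(Matrix.toLin' B)) volume) = ∫ x, h (B *ᵥ x) := by
    rw [integral_map]
    · rfl
    · exact (LinearMap.continuous_of_finiteDimensional _).aemeasurable
    · exact hh.aestronglyMeasurable
  rw [← h2, h1, integral_smul_measure, ENNReal.toReal_ofReal (abs_nonneg _), abs_inv]
  simp

lemma gg_fourier (B : Matrix ι ι ℝ) (hB : B.det ≠ 0) (n : ι → ℤ) :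
    ∫ x, Complex.exp (-2 * π * Complex.I * ∑ i, (n i : ℂ) * x i) * gg B x =
      |B.det|⁻¹ * Complex.exp (-π * qf (B⁻¹)ᵀ (fun i => n i)) := by
  have hx : ∀ x : ι → ℝ, ∑ i, (n i : ℝ) * x i = ∑ i, ((B⁻¹)ᵀ *ᵥ (fun i => (n i : ℝ))) i * (B *ᵥ x) i := by
    intro x
    change (fun i => (n i : ℝ)) ⬝ᵥ x = ((B⁻¹)ᵀ *ᵥ (fun i => (n i : ℝ))) ⬝ᵥ (B *ᵥ x)
    rw [dotProduct_mulVec, vecMul_mulVec, Matrix.transpose_transpose,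
      nonsing_inv_mul _ (isUnit_iff_ne_zero.mpr hB)]
    simp
  set m := (B⁻¹)ᵀ *ᵥ (fun i => (n i : ℝ)) with hm
  have key := GaussianFourier.integral_cexp_neg_mul_sum_add (b := π) (ι := ι) (by simpa using pi_pos)
    (fun i => -2 * π * Complex.I * m i)
  have h2 := integral_mulVec B hB (fun v => Complex.exp (-π * ∑ i, (v i : ℂ) ^ 2 +
    ∑ i, (-2 * π * Complex.I * m i) * (v i : ℂ))) (by fun_prop)
  beta_reduce at h2
  rw [key] at h2
  have hpi : (π : ℂ) ≠ 0 := by exact_mod_cast pi_ne_zero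
  rw [div_self hpi, Complex.one_cpow, one_mul] at h2
  convert h2 using 1
  · congr 1; ext x
    rw [gg, ← Complex.exp_add]
    congr 1
    have := hx x
    rw [add_comm, qf]
    push_cast
    congr 1
    have h3 : (∑ i, (n i : ℂ) * x i) = ∑ i, (m i : ℂ) * ((B *ᵥ x) i : ℂ) := by exact_mod_cast this
    rw [h3, Finset.mul_sum]
    exact Finset.sum_congr rfl fun i _ => by ring
  · congr 2
    rw [qf]
    push_cast
    rw [Finset.mul_sum, Finset.sum_div]
    refine Finset.sum_congr rfl fun i _ => ?_
    have : (-2 * π * Complex.I * m i : ℂ) ^ 2 = - (4 * π ^ 2 * (m i : ℂ) ^ 2) := by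
      rw [mul_pow, mul_pow, Complex.I_sq]; ring
    rw [this]
    field_simp
    rfl

end MRH

namespace MRH
open MeasureTheory Matrix Real
variable {ι : Type*} [Fintype ι]

def Fper (B : Matrix ι ι ℝ) (x : ι → ℝ) : ℂ := ∑' n : ι → ℤ, gg B (fun i => x i + n i)

lemma gg_summable (B : Matrix ι ι ℝ) (hB : B.det ≠ 0) :
    Summable (fun n : ι → ℤ => rexp (-π * qf B (fun i => (n i : ℝ)))) := by
  obtain ⟨u, hu, -, h⟩ := qf_bound B hB
  obtain ⟨C, hC⟩ := h 0
  refine Summable.of_nonneg_of_le (fun n => (exp_pos _).le) (fun n => ?_) (hu.mul_left C)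
  simpa using hC 0 (by simp) n

lemma Fper_continuous (B : Matrix ι ι ℝ) (hB : B.det ≠ 0) : Continuous (Fper B) := by
  obtain ⟨u, hu, -, h⟩ := qf_bound B hB
  rw [continuous_iff_continuousAt]
  intro x
  obtain ⟨C, hC⟩ := h (‖x‖ + 1)
  have : ContinuousOn (Fper B) (Metric.ball x 1) := by
    refine continuousOn_tsum (u := fun n => C * u n) (fun n => ?_) (hu.mul_left C) fun n y hy => ?_
    · exact ((gg_continuous B).comp (by fun_prop)).continuousOn
    · rw [gg_norm]
      refine hC y (fun i => ?_) n
      have h1 : ‖y‖ ≤ ‖x‖ + 1 := by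
        have := norm_le_norm_add_norm_sub' y x
        rw [Metric.mem_ball, dist_eq_norm] at hy
        linarith
      exact (norm_le_pi_norm y i).trans h1
  exact this.continuousAt (Metric.ball_mem_nhds x one_pos)

lemma Fper_add (B : Matrix ι ι ℝ) (x : ι → ℝ) (k : ι → ℤ) :
    Fper B (fun i => x i + k i) = Fper B x := by
  unfold Fper
  rw [← (Equiv.addLeft k).tsum_eq (fun n : ι → ℤ => gg B (fun i => x i + n i))]
  refine tsum_congr fun n => ?_
  congr 1
  ext i
  simp [add_assoc]

def Ftor (B : Matrix ι ι ℝ) (θ : UnitAddTorus ι) : ℂ :=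
  Fper B (fun i => (AddCircle.equivIoc 1 0 (θ i)).1)

lemma Ftor_coe (B : Matrix ι ι ℝ) (x : ι → ℝ) : Ftor B (fun i => (x i : UnitAddCircle)) = Fper B x := by
  unfold Ftor
  have : ∀ i, ∃ k : ℤ, (AddCircle.equivIoc 1 0 (x i : UnitAddCircle)).1 = x i + k := by
    intro i
    have h := AddCircle.coe_equivIoc (p := (1:ℝ)) (a := 0) (y := (x i : UnitAddCircle))
    rw [← sub_eq_zero, ← AddCircle.coe_sub, AddCircle.coe_eq_zero_iff] at h
    obtain ⟨k, hk⟩ := h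
    exact ⟨k, by simp at hk; linarith⟩
  choose k hk using this
  simp_rw [hk]
  exact Fper_add B x k

lemma Ftor_continuous (B : Matrix ι ι ℝ) (hB : B.det ≠ 0) : Continuous (Ftor B) := by
  have hq : IsOpenQuotientMap (Pi.map (fun (_ : ι) (x : ℝ) => (x : UnitAddCircle))) :=
    IsOpenQuotientMap.piMap fun i => QuotientAddGroup.isOpenQuotientMap_mk
  rw [← hq.isQuotientMap.continuous_iff.symm]
  have : Ftor B ∘ (Pi.map (fun (_ : ι) (x : ℝ) => (x : UnitAddCircle))) = Fper B := by
    ext x; exact Ftor_coe B x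
  rw [this]
  exact Fper_continuous B hB

def ubox (m : ι → ℤ) : Set (ι → ℝ) := {x | ∀ i, x i ∈ Set.Ioc (m i : ℝ) (m i + 1)}

lemma ubox_meas (m : ι → ℤ) : MeasurableSet (ubox m) :=
  MeasurableSet.univ_pi' (fun i => measurableSet_Ioc)

lemma integral_unfold (h : (ι → ℝ) → ℂ) (hh : Integrable h) :
    HasSum (fun m : ι → ℤ => ∫ x in ubox (0 : ι → ℤ), h (fun i => x i + m i)) (∫ x, h x) := by
  have hU : ⋃ m : ι → ℤ, ubox m = Set.univ := by
    refine Set.eq_univ_of_forall fun x => Set.mem_iUnion.mpr ⟨fun i => ⌈x i⌉ - 1, fun i => ?_⟩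
    have := Int.ceil_lt_add_one (x i)
    have := Int.le_ceil (x i)
    constructor <;> push_cast <;> linarith
  have hD : Pairwise (Function.onFun Disjoint (ubox : (ι → ℤ) → _)) := by
    intro m n hmn
    rw [Function.onFun, Set.disjoint_left]
    intro x hx hx'
    apply hmn
    ext i
    have e : ∀ k : ℤ, x i ∈ Set.Ioc (k : ℝ) (k + 1) → k + 1 = ⌈x i⌉ := by
      intro k hk
      symm
      rw [Int.ceil_eq_iff]
      push_cast
      exact ⟨by linarith [hk.1], hk.2⟩
    have := e _ (hx i)
    have := e _ (hx' i)
    omega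
  have key := hasSum_integral_iUnion (μ := volume) (f := h) ubox_meas hD hh.integrableOn
  rw [hU, Measure.restrict_univ] at key
  refine key.congr_fun fun m => ?_
  have mp := measurePreserving_add_right (volume : Measure (ι → ℝ)) (fun i => (m i : ℝ))
  have := mp.setIntegral_preimage_emb (measurableEmbedding_addRight _) h (ubox m)
  rw [← this]
  congr 2
  ext x
  simp only [ubox, Set.mem_setOf_eq, Set.mem_preimage, Set.mem_Ioc, Pi.add_apply, Pi.zero_apply, Int.cast_zero]
  refine forall_congr' fun i => ?_
  constructor <;> rintro ⟨h1, h2⟩ <;> constructor <;> linarith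

lemma gg_integrable (B : Matrix ι ι ℝ) (hB : B.det ≠ 0) : Integrable (gg B) := by
  have h1 := Real.map_matrix_volume_pi_eq_smul_volume_pi hB
  have h2 := gg_integrable_gauss (ι := ι)
  have h3 : Integrable (fun v : ι → ℝ => Complex.exp (-π * ∑ i, (v i : ℂ) ^ 2))
      (Measure.map (⇑(Matrix.toLin' B)) volume) := by
    rw [h1]; exact h2.smul_measure (by simp)
  have h4 := h3.comp_aemeasurable (LinearMap.continuous_of_finiteDimensional _).aemeasurable
  refine h4.congr (Filter.Eventually.of_forall fun x => ?_)
  simp [gg, qf]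

lemma mF_eq (n : ι → ℤ) (x : ι → ℝ) : UnitAddTorus.mFourier (-n) (fun i => (x i : UnitAddCircle)) =
    Complex.exp (-2 * π * Complex.I * ∑ i, (n i : ℂ) * x i) := by
  simp only [UnitAddTorus.mFourier, ContinuousMap.coe_mk, fourier_coe_apply]
  rw [← Complex.exp_sum, Finset.mul_sum]
  congr 1
  refine Finset.sum_congr rfl fun i _ => ?_
  simp
  ring

lemma Ftor_coeff (B : Matrix ι ι ℝ) (hB : B.det ≠ 0) (n : ι → ℤ) :
    UnitAddTorus.mFourierCoeff (Ftor B) n =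
      |B.det|⁻¹ * Complex.exp (-π * qf (B⁻¹)ᵀ (fun i => n i)) := by
  rw [UnitAddTorus.mFourierCoeff_eq_integral _ _ (fun i => ((0 : ι → ℤ) i : ℝ)), ← gg_fourier B hB n]
  change ∫ x in ubox (0 : ι → ℤ), _ = _
  simp_rw [Ftor_coe, mF_eq]
  set h : (ι → ℝ) → ℂ := fun x => Complex.exp (-2 * π * Complex.I * ∑ i, (n i : ℂ) * x i) * gg B x
    with hh
  have hn : ∀ x, ‖h x‖ = ‖gg B x‖ := by
    intro x
    rw [hh]
    simp only [norm_mul]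
    have : (-2 * π * Complex.I * ∑ i, (n i : ℂ) * x i : ℂ) = ((-2 * π * ∑ i, (n i : ℝ) * x i : ℝ) : ℂ) * Complex.I := by
      push_cast; ring
    rw [this, Complex.norm_exp_ofReal_mul_I, one_mul]
  have hc : Continuous h := by
    have := gg_continuous B
    fun_prop
  have hi : Integrable h := by
    refine (gg_integrable B hB).mono hc.aestronglyMeasurable (Filter.Eventually.of_forall fun x => (hn x).le)
  rw [← (integral_unfold h hi).tsum_eq]
  obtain ⟨u, hu, hu0, hb⟩ := qf_bound B hB
  obtain ⟨C, hC⟩ := hb 1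
  have hvol : volume (ubox (0 : ι → ℤ)) ≠ ⊤ := by
    have : ubox (0 : ι → ℤ) = Set.univ.pi (fun _ => Set.Ioc (0:ℝ) 1) := by
      ext x; simp [ubox]
    rw [this, volume_pi_pi]
    simp
  have hbd : ∀ m : ι → ℤ, ∀ x ∈ ubox (0 : ι → ℤ), ‖h (fun i => x i + m i)‖ ≤ C * u m := by
    intro m x hx
    rw [hn, gg_norm]
    refine hC x (fun i => ?_) m
    have := hx i
    simp at this
    rw [abs_le]; constructor <;> linarith
  have h_int : ∀ m : ι → ℤ, IntegrableOn (fun x : ι → ℝ => h (fun i => x i + m i)) (ubox (0 : ι → ℤ)) := by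
    intro m
    refine Measure.integrableOn_of_bounded (M := C * u m) hvol
      ((hc.comp (by fun_prop)).aestronglyMeasurable) ?_
    exact (ae_restrict_iff' (ubox_meas _)).mpr (Filter.Eventually.of_forall fun x hx => hbd m x hx)
  rw [integral_tsum_of_summable_integral_norm h_int]
  · refine setIntegral_congr_fun (ubox_meas _) fun x hx => ?_
    simp only [Fper, smul_eq_mul]
    rw [← tsum_mul_left]
    refine tsum_congr fun m => ?_
    rw [hh]
    simp only
    congr 1
    rw [Complex.exp_eq_exp_iff_exists_int]
    refine ⟨∑ i, n i * m i, ?_⟩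
    push_cast
    simp_rw [mul_add, Finset.sum_add_distrib]
    ring
  · refine Summable.of_nonneg_of_le (fun m => integral_nonneg fun x => norm_nonneg _) (fun m => ?_)
      ((hu.mul_left C).mul_left (volume.real (ubox (0 : ι → ℤ))))
    have := setIntegral_mono_on (h_int m).norm (integrableOn_const hvol) (ubox_meas _) (hbd m)
    simpa using this

lemma poisson_B (B : Matrix ι ι ℝ) (hB : B.det ≠ 0) :
    ∑' n : ι → ℤ, rexp (-π * qf B (fun i => (n i : ℝ))) =
      |B.det|⁻¹ * ∑' n : ι → ℤ, rexp (-π * qf (B⁻¹)ᵀ (fun i => (n i : ℝ))) := by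
  have hB' : ((B⁻¹)ᵀ).det ≠ 0 := by
    rw [det_transpose]
    simpa using hB
  have hs := gg_summable _ hB'
  have hco : UnitAddTorus.mFourierCoeff (Ftor B) = fun n : ι → ℤ =>
      ((|B.det|⁻¹ * rexp (-π * qf (B⁻¹)ᵀ (fun i => (n i : ℝ))) : ℝ) : ℂ) := by
    ext n
    rw [Ftor_coeff B hB]
    push_cast
    rfl
  have := UnitAddTorus.hasSum_mFourier_series_apply_of_summable (f := ⟨Ftor B, Ftor_continuous B hB⟩)
    (by rw [ContinuousMap.coe_mk, hco]; exact Complex.ofRealCLM.summable (hs.mul_left _)) (fun i => ((0 : ι → ℝ) i : UnitAddCircle))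
  simp only [ContinuousMap.coe_mk, hco, Ftor_coe] at this
  have h1 : ∀ n : ι → ℤ, UnitAddTorus.mFourier n (fun i => ((0 : ι → ℝ) i : UnitAddCircle)) = 1 := by
    intro n
    simp [UnitAddTorus.mFourier]
  simp_rw [h1] at this
  have h2 := this.tsum_eq
  simp only [smul_eq_mul, mul_one] at h2
  rw [← Complex.ofReal_tsum, tsum_mul_left] at h2
  apply Complex.ofReal_injective
  rw [h2, Fper, Complex.ofReal_tsum]
  refine tsum_congr fun n => ?_
  simp [gg]

end MRH

namespace MRH
open MeasureTheory Matrix Real NumberField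
open scoped ComplexConjugate

lemma poisson_A {ι : Type*} [Fintype ι] (A : Matrix ι ι ℝ) (hA : A.PosDef) :
    Summable (fun n : ι → ℤ => rexp (-π * ((fun i => (n i : ℝ)) ⬝ᵥ (A *ᵥ (fun i => (n i : ℝ)))))) ∧
    ∑' n : ι → ℤ, rexp (-π * ((fun i => (n i : ℝ)) ⬝ᵥ (A *ᵥ (fun i => (n i : ℝ))))) =
      (√A.det)⁻¹ * ∑' n : ι → ℤ, rexp (-π * ((fun i => (n i : ℝ)) ⬝ᵥ (A⁻¹ *ᵥ (fun i => (n i : ℝ))))) := by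
  obtain ⟨B, hBu, hB⟩ : ∃ B : Matrix ι ι ℝ, IsUnit B ∧ A = Bᵀ * B := by
    open scoped MatrixOrder Matrix.Norms.L2Operator in
    obtain ⟨B, hBu, hB⟩ := CStarAlgebra.isStrictlyPositive_iff_eq_star_mul_self.mp hA.isStrictlyPositive
    exact ⟨B, hBu, by rw [hB, star_eq_conjTranspose, conjTranspose_eq_transpose_of_trivial]⟩
  have hd : B.det ≠ 0 := ((isUnit_iff_isUnit_det _).mp hBu).ne_zero
  have h1 : ∀ x : ι → ℝ, x ⬝ᵥ (A *ᵥ x) = qf B x := by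
    intro x
    rw [hB, ← mulVec_mulVec, dotProduct_mulVec, vecMul_transpose]
    simp [qf, dotProduct, sq]
  have h2 : ∀ x : ι → ℝ, x ⬝ᵥ (A⁻¹ *ᵥ x) = qf (B⁻¹)ᵀ x := by
    intro x
    rw [hB, Matrix.mul_inv_rev, ← mulVec_mulVec, dotProduct_mulVec, ← transpose_nonsing_inv,
      ← mulVec_transpose]
    simp [qf, dotProduct, sq]
  simp_rw [h1, h2]
  refine ⟨gg_summable B hd, ?_⟩
  rw [poisson_B B hd, hB, det_mul, det_transpose, ← sq, sqrt_sq_eq_abs]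

section gram
variable {K : Type*} [Field K] [NumberField K] {ι : Type*} [Fintype ι]

def pl (φ : K →ₐ[ℚ] ℂ) : InfinitePlace K := InfinitePlace.mk φ.toRingHom

lemma pl_apply (φ : K →ₐ[ℚ] ℂ) (a : K) : pl φ a = ‖φ a‖ := rfl

def cj (φ : K →ₐ[ℚ] ℂ) : K →ₐ[ℚ] ℂ := (Complex.conjAe.restrictScalars ℚ).toAlgHom.comp φ

lemma cj_apply (φ : K →ₐ[ℚ] ℂ) (a : K) : cj φ a = conj (φ a) := rfl

lemma pl_cj (φ : K →ₐ[ℚ] ℂ) : pl (cj φ) = pl φ := by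
  ext a
  simp [pl_apply, cj_apply]

lemma cj_invol : Function.Involutive (cj (K := K)) := fun φ => by ext a; simp [cj_apply]

def gram (b : ι → K) (y : InfinitePlace K → ℝ) : Matrix ι ι ℝ :=
  fun i j => (∑ φ : K →ₐ[ℚ] ℂ, (y (pl φ) : ℂ) * φ (b i) * conj (φ (b j))).re

lemma gram_coe (b : ι → K) (y : InfinitePlace K → ℝ) (i j : ι) :
    (gram b y i j : ℂ) = ∑ φ : K →ₐ[ℚ] ℂ, (y (pl φ) : ℂ) * φ (b i) * conj (φ (b j)) := by
  rw [gram, ← Complex.conj_eq_iff_re, map_sum]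
  rw [← Equiv.sum_comp (cj_invol (K := K)).toPerm]
  refine Finset.sum_congr rfl fun φ _ => ?_
  simp [pl_cj, cj_apply]

lemma gram_symm (b : ι → K) (y : InfinitePlace K → ℝ) : (gram b y)ᵀ = gram b y := by
  ext i j
  apply Complex.ofReal_injective
  rw [transpose_apply, gram_coe, gram_coe, ← Equiv.sum_comp (cj_invol (K := K)).toPerm]
  refine Finset.sum_congr rfl fun φ _ => ?_
  simp [pl_cj, cj_apply]
  ring

lemma gram_map (b : ι → K) (y : InfinitePlace K → ℝ) (e : ι ≃ (K →ₐ[ℚ] ℂ)) :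
    (gram b y).map (fun x : ℝ => (x : ℂ)) = (Algebra.embeddingsMatrixReindex ℚ ℂ b e) *
      diagonal (fun i => (y (pl (e i)) : ℂ)) * (Algebra.embeddingsMatrixReindex ℚ ℂ b e)ᴴ := by
  ext i j
  rw [map_apply, gram_coe, mul_apply, ← e.sum_comp]
  refine Finset.sum_congr rfl fun k _ => ?_
  simp only [mul_diagonal, Algebra.embeddingsMatrixReindex, reindex_apply, submatrix_apply,
    conjTranspose_apply, Algebra.embeddingsMatrix_apply, Equiv.refl_symm, Equiv.refl_apply, Equiv.symm_symm,
    Complex.star_def]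
  ring

lemma sum_pl (f : InfinitePlace K → ℝ) : ∑ φ : K →ₐ[ℚ] ℂ, f (pl φ) = ∑ w, w.mult * f w := by
  have h := (RingHom.equivRatAlgHom K ℂ).sum_comp (fun φ => f (pl φ))
  rw [← h]
  change ∑ φ : K →+* ℂ, f (InfinitePlace.mk φ) = _
  rw [← Finset.sum_fiberwise Finset.univ InfinitePlace.mk]
  refine Finset.sum_congr rfl fun w _ => ?_
  rw [Finset.sum_congr rfl (g := fun _ => f w) (by intro φ hφ; simp at hφ; rw [hφ]), Finset.sum_const,
    InfinitePlace.card_filter_mk_eq, nsmul_eq_mul]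

lemma prod_pl (f : InfinitePlace K → ℝ) : ∏ φ : K →ₐ[ℚ] ℂ, f (pl φ) = ∏ w, f w ^ w.mult := by
  have h := (RingHom.equivRatAlgHom K ℂ).prod_comp (fun φ => f (pl φ))
  rw [← h]
  change ∏ φ : K →+* ℂ, f (InfinitePlace.mk φ) = _
  rw [← Finset.prod_fiberwise Finset.univ InfinitePlace.mk]
  refine Finset.prod_congr rfl fun w _ => ?_
  rw [Finset.prod_congr rfl (g := fun _ => f w) (by intro φ hφ; simp at hφ; rw [hφ]), Finset.prod_const,
    InfinitePlace.card_filter_mk_eq]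

lemma gram_det (b : ι → K) (y : InfinitePlace K → ℝ) (e : ι ≃ (K →ₐ[ℚ] ℂ)) :
    (gram b y).det = |Algebra.discr ℚ b| * ∏ w, y w ^ w.mult := by
  apply Complex.ofReal_injective
  have h1 : ((gram b y).det : ℂ) = ((gram b y).map (fun x : ℝ => (x : ℂ))).det :=
    (Complex.ofRealHom.map_det (gram b y))
  rw [h1, gram_map b y e, det_mul, det_mul, det_diagonal, det_conjTranspose]
  set m := (Algebra.embeddingsMatrixReindex ℚ ℂ b e).det with hm
  have h2 := Algebra.discr_eq_det_embeddingsMatrixReindex_pow_two ℚ ℂ b e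
  rw [← hm] at h2
  have h3 : |(Algebra.discr ℚ b : ℝ)| = ‖m‖ ^ 2 := by
    rw [← norm_pow, ← h2]; simp
  rw [e.prod_comp (fun φ => (y (pl φ) : ℂ)), ← Complex.ofReal_prod, prod_pl, mul_right_comm]
  rw [Complex.star_def, Complex.mul_conj, Complex.normSq_eq_norm_sq]
  push_cast
  rw [← Complex.ofReal_pow, ← h3]

lemma gram_quad (b : ι → K) (y : InfinitePlace K → ℝ) (x : ι → ℝ) :
    x ⬝ᵥ (gram b y *ᵥ x) = ∑ φ : K →ₐ[ℚ] ℂ, y (pl φ) * ‖∑ i, x i * φ (b i)‖ ^ 2 := by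
  apply Complex.ofReal_injective
  simp only [dotProduct, mulVec]
  push_cast
  simp_rw [gram_coe, ← Complex.mul_conj', map_sum, Finset.sum_mul_sum, Finset.mul_sum, Finset.sum_mul,
    Finset.mul_sum]
  rw [Finset.sum_comm' (t' := Finset.univ) (s' := fun _ => Finset.univ) (by simp)]
  simp_rw [Finset.sum_comm (s := (Finset.univ : Finset ι)) (t := (Finset.univ : Finset (K →ₐ[ℚ] ℂ)))]
  refine Finset.sum_congr rfl fun φ _ => ?_
  rw [Finset.sum_comm]
  refine Finset.sum_congr rfl fun i _ => Finset.sum_congr rfl fun j _ => ?_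
  simp
  ring

lemma gram_posDef (b : ι → K) (y : InfinitePlace K → ℝ) (hy : ∀ w, 0 < y w) (e : ι ≃ (K →ₐ[ℚ] ℂ))
    (hb : Algebra.discr ℚ b ≠ 0) : (gram b y).PosDef := by
  have : (gram b y).PosSemidef := by
    refine PosSemidef.of_dotProduct_mulVec_nonneg ?_ fun x => ?_
    · rw [IsHermitian, conjTranspose_eq_transpose_of_trivial, gram_symm]
    · rw [star_trivial, gram_quad]
      exact Finset.sum_nonneg fun φ _ => mul_nonneg (hy _).le (sq_nonneg _)
  rw [this.posDef_iff_det_ne_zero, gram_det b y e]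
  refine mul_ne_zero (by simpa using hb) (Finset.prod_ne_zero_iff.mpr fun w _ => pow_ne_zero _ (hy w).ne')

lemma gram_inv (b : Module.Basis ι ℚ K) (y : InfinitePlace K → ℝ) (hy : ∀ w, 0 < y w)
    (e : ι ≃ (K →ₐ[ℚ] ℂ)) :
    (gram b y)⁻¹ = gram (b.traceDual) (fun w => (y w)⁻¹) := by
  apply Matrix.inv_eq_right_inv
  have hinj : Function.Injective (fun x : ℝ => (x : ℂ)) := Complex.ofReal_injective
  apply Matrix.map_injective hinj
  beta_reduce
  have hm : ∀ (A B : Matrix ι ι ℝ), (A * B).map (fun x : ℝ => (x : ℂ)) =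
      A.map (fun x : ℝ => (x : ℂ)) * B.map (fun x : ℝ => (x : ℂ)) := fun A B =>
    Matrix.map_mul (f := Complex.ofRealHom)
  have hc : ∀ A : Matrix ι ι ℝ, (A.map (fun x : ℝ => (x : ℂ))) = (A.map (fun x : ℝ => (x : ℂ))).map conj := by
    intro A; ext i j; simp
  rw [hm, hc (gram b.traceDual _), gram_map _ _ e, gram_map _ _ e]
  set M := Algebra.embeddingsMatrixReindex ℚ ℂ b e
  set N := Algebra.embeddingsMatrixReindex ℚ ℂ b.traceDual e
  have h1 : M * Nᵀ = 1 := by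
    ext i j
    have h := Module.Basis.trace_mul_traceDual b i j
    have h' := congrArg (algebraMap ℚ ℂ) h
    rw [trace_eq_sum_embeddings ℂ] at h'
    rw [mul_apply, one_apply]
    simp only [map_mul] at h'
    rw [← e.sum_comp] at h'
    rw [show (∑ k, M i k * Nᵀ k j) = ∑ k, (e k) (b i) * (e k) (b.traceDual j) from
      Finset.sum_congr rfl fun k _ => by simp [M, N, Algebra.embeddingsMatrixReindex], h']
    split_ifs <;> simp
  have h2 : Mᵀ * N = 1 := by
    have := mul_eq_one_comm.mp h1
    rw [← transpose_transpose N, ← transpose_mul, this, transpose_one]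
  have h3 : Mᴴ * N.map conj = 1 := by
    have := congrArg (fun X : Matrix ι ι ℂ => X.map (starRingEnd ℂ)) h2
    simp only [Matrix.map_mul] at this
    rw [Matrix.map_one _ (map_zero _) (map_one _)] at this
    exact this
  simp only [Matrix.map_mul]
  have h4 : (Nᴴ).map conj = Nᵀ := by ext i j; simp
  have h5 : (diagonal (fun i => (((y (pl (e i)))⁻¹ : ℝ) : ℂ))).map (starRingEnd ℂ) =
    diagonal (fun i => (((y (pl (e i)))⁻¹ : ℝ) : ℂ)) := by
    rw [diagonal_map (map_zero _)]
    congr 1; ext i; simp only [Complex.conj_ofReal]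
  rw [h4, h5]
  have h6 : diagonal (fun i => (y (pl (e i)) : ℂ)) * diagonal (fun i => (((y (pl (e i)))⁻¹ : ℝ) : ℂ)) = 1 := by
    rw [diagonal_mul_diagonal, ← diagonal_one]
    congr 1; ext i
    rw [← Complex.ofReal_mul, mul_inv_cancel₀ (hy _).ne']; simp
  calc _ = M * (diagonal (fun i => (y (pl (e i)) : ℂ)) * (Mᴴ * N.map conj) *
      diagonal (fun i => (((y (pl (e i)))⁻¹ : ℝ) : ℂ))) * Nᵀ := by simp only [Matrix.mul_assoc]
    _ = _ := by rw [h3, Matrix.mul_one, h6, Matrix.mul_one, h1, Matrix.map_one _ (by simp) (by simp)]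

end gram
end MRH

namespace MRH
open MeasureTheory Matrix Real NumberField Module
open scoped nonZeroDivisors
variable {K : Type*} [Field K] [NumberField K]

def nq (y : InfinitePlace K → ℝ) (a : K) : ℝ := ∑ w : InfinitePlace K, w.mult * (y w * w a ^ 2)

def Th (I : FractionalIdeal (𝓞 K)⁰ K) (y : InfinitePlace K → ℝ) : ENNReal :=
  ∑' a : I, ENNReal.ofReal (rexp (-π * nq y a))

lemma tsum_basis {ι : Type*} [Fintype ι] (b : Basis ι ℚ K) (S : Set K)
    (hS : ∀ x, x ∈ Submodule.span ℤ (Set.range b) ↔ x ∈ S) (g : K → ENNReal) :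
    ∑' a : S, g a = ∑' n : ι → ℤ, g (∑ i, (n i : ℚ) • b i) := by
  let b' := b.restrictScalars ℤ
  let E : (ι → ℤ) ≃ S := b'.equivFun.symm.toEquiv.trans (Equiv.subtypeEquivRight hS)
  rw [← E.tsum_eq]
  refine tsum_congr fun n => ?_
  congr 1
  change ((b'.equivFun.symm n : Submodule.span ℤ (Set.range b)) : K) = _
  rw [Basis.equivFun_symm_apply]
  simp [b', Basis.restrictScalars_apply, Algebra.smul_def]

lemma nq_gram {ι : Type*} [Fintype ι] (b : Basis ι ℚ K) (y : InfinitePlace K → ℝ) (n : ι → ℤ) :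
    nq y (∑ i, (n i : ℚ) • b i) = (fun i => (n i : ℝ)) ⬝ᵥ (gram b y *ᵥ (fun i => (n i : ℝ))) := by
  rw [gram_quad, nq, ← sum_pl]
  refine Finset.sum_congr rfl fun φ _ => ?_
  rw [pl_apply, map_sum]
  congr 4
  ext i
  simp [Algebra.smul_def]

lemma tsum_gram {ι : Type*} [Fintype ι] (b : Basis ι ℚ K) (y : InfinitePlace K → ℝ) (hy : ∀ w, 0 < y w) (S : Set K)
    (e : ι ≃ (K →ₐ[ℚ] ℂ))
    (hS : ∀ x, x ∈ Submodule.span ℤ (Set.range b) ↔ x ∈ S) :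
    ∑' a : S, ENNReal.ofReal (rexp (-π * nq y a)) = ENNReal.ofReal
      (∑' n : ι → ℤ, rexp (-π * ((fun i => (n i : ℝ)) ⬝ᵥ (gram b y *ᵥ (fun i => (n i : ℝ)))))) := by
  rw [tsum_basis b S hS (fun a => ENNReal.ofReal (rexp (-π * nq y a)))]
  have hd : Algebra.discr ℚ b ≠ 0 := Algebra.discr_not_zero_of_basis ℚ b
  rw [ENNReal.ofReal_tsum_of_nonneg (fun n => (exp_pos _).le) (poisson_A _ (gram_posDef b y hy e hd)).1]
  exact tsum_congr fun n => by rw [nq_gram]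

lemma discr_frac (I : (FractionalIdeal (𝓞 K)⁰ K)ˣ) :
    |Algebra.discr ℚ (basisOfFractionalIdeal K I)| = |(discr K : ℚ)| * FractionalIdeal.absNorm I.1 ^ 2 := by
  have e : (Free.ChooseBasisIndex ℤ (𝓞 K)) ≃ (Free.ChooseBasisIndex ℤ I) := by
    refine Fintype.equivOfCardEq ?_
    rw [← finrank_eq_card_chooseBasisIndex, ← finrank_eq_card_chooseBasisIndex, fractionalIdeal_rank]
  have h := det_basisOfFractionalIdeal_eq_absNorm K I e
  set b := (basisOfFractionalIdeal K I).reindex e.symm with hb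
  have h1 : Algebra.discr ℚ (basisOfFractionalIdeal K I) = Algebra.discr ℚ b := by
    rw [hb, Basis.coe_reindex, Equiv.symm_symm]
    have := Algebra.discr_reindex ℚ (basisOfFractionalIdeal K I) e.symm
    rw [Equiv.symm_symm] at this
    rw [this]
  have h2 := Algebra.discr_of_matrix_vecMul (A := ℚ) (integralBasis K) ((integralBasis K).toMatrix b)
  rw [Basis.toMatrix_map_vecMul] at h2
  rw [h1, h2, abs_mul, ← h, ← coe_discr, mul_comm, abs_pow, Basis.det_apply]

lemma Th_fe (I : FractionalIdeal (𝓞 K)⁰ K) (hI : I ≠ 0) (y : InfinitePlace K → ℝ) (hy : ∀ w, 0 < y w) :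
    Th I y = ENNReal.ofReal (√|(discr K : ℝ)| * FractionalIdeal.absNorm I * √(∏ w, y w ^ w.mult))⁻¹ *
      Th (FractionalIdeal.dual ℤ ℚ I) (fun w => (y w)⁻¹) := by
  set J := Units.mk0 I hI
  set b := basisOfFractionalIdeal K J
  have e : (Free.ChooseBasisIndex ℤ J) ≃ (K →ₐ[ℚ] ℂ) := by
    refine Fintype.equivOfCardEq ?_
    rw [AlgHom.card, ← finrank_eq_card_chooseBasisIndex, fractionalIdeal_rank, RingOfIntegers.rank]
  have hS : ∀ x, x ∈ Submodule.span ℤ (Set.range b) ↔ x ∈ (I : Set K) := fun x =>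
    mem_span_basisOfFractionalIdeal K
  have hS' : ∀ x, x ∈ Submodule.span ℤ (Set.range b.traceDual) ↔ x ∈ (FractionalIdeal.dual ℤ ℚ I : Set K) := by
    intro x
    have := Submodule.traceDual_span_of_basis ℤ (I : Submodule (𝓞 K) K) b (by
      ext x; rw [hS]; rfl)
    rw [← this, Submodule.restrictScalars_mem, ← FractionalIdeal.coe_dual ℤ ℚ hI]
    rfl
  have hd : Algebra.discr ℚ b ≠ 0 := Algebra.discr_not_zero_of_basis ℚ b
  have h1 : Th I y = _ := tsum_gram b y hy I e hS
  have h2 : Th (FractionalIdeal.dual ℤ ℚ I) (fun w => (y w)⁻¹) = _ :=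
    tsum_gram b.traceDual (fun w => (y w)⁻¹) (fun w => inv_pos.mpr (hy w)) _ e hS'
  rw [h1, h2, (poisson_A _ (gram_posDef b y hy e hd)).2, gram_inv b y hy e, ENNReal.ofReal_mul (by positivity)]
  congr 3
  have hp : 0 ≤ ∏ w, y w ^ w.mult := Finset.prod_nonneg fun w _ => (pow_pos (hy w) _).le
  rw [gram_det b y e]
  have h3 : |(Algebra.discr ℚ b : ℝ)| = |(discr K : ℝ)| * (FractionalIdeal.absNorm I : ℝ) ^ 2 := by
    exact_mod_cast congrArg (fun q : ℚ => (q : ℝ)) (discr_frac J)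
  rw [Rat.cast_abs, h3, sqrt_mul (by positivity), sqrt_mul (by positivity), sqrt_sq]
  exact_mod_cast FractionalIdeal.absNorm_nonneg I

lemma dual_norm (I : FractionalIdeal (𝓞 K)⁰ K) :
    (FractionalIdeal.absNorm (FractionalIdeal.dual ℤ ℚ I) : ℝ) =
      (|(discr K : ℝ)| * FractionalIdeal.absNorm I)⁻¹ := by
  rw [FractionalIdeal.dual_eq_mul_inv]
  have h1 := coeIdeal_differentIdeal ℤ ℚ K (𝓞 K)
  have h2 : FractionalIdeal.dual ℤ ℚ (1 : FractionalIdeal (𝓞 K)⁰ K) = (↑(differentIdeal ℤ (𝓞 K)))⁻¹ := by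
    rw [h1, inv_inv]
  rw [h2, map_mul, map_inv₀, map_inv₀, FractionalIdeal.coeIdeal_absNorm, absNorm_differentIdeal K (𝓞 K)]
  push_cast
  rw [mul_inv]
  simp

end MRH

namespace MRH
open MeasureTheory Real NumberField Module
open NumberField.Units NumberField.Units.dirichletUnitTheorem
open scoped nonZeroDivisors
variable {K : Type*} [Field K] [NumberField K]

def ev (v : logSpace K) (w : InfinitePlace K) : ℝ := if h : w = w₀ then -∑ i, v i else v ⟨w, h⟩

lemma ev_add (v v' : logSpace K) (w) : ev (v + v') w = ev v w + ev v' w := by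
  unfold ev; split_ifs <;> simp [Finset.sum_add_distrib]; ring

lemma ev_neg (v : logSpace K) (w) : ev (-v) w = - ev v w := by
  unfold ev; split_ifs <;> simp

lemma sum_split (g : InfinitePlace K → ℝ) : ∑ w, g w = g w₀ + ∑ i : {w : InfinitePlace K // w ≠ w₀}, g i := by
  rw [← Fintype.sum_subtype_add_sum_subtype (fun w => w = (w₀ : InfinitePlace K)) g]
  congr 1
  have : ((default : {w : InfinitePlace K // w = w₀}) : InfinitePlace K) = w₀ := (default : {w : InfinitePlace K // w = w₀}).2
  simp [this]

lemma ev_sum (v : logSpace K) : ∑ w, ev v w = 0 := by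
  rw [sum_split]
  have : ∀ i : {w : InfinitePlace K // w ≠ w₀}, ev v i = v i := fun i => by simp [ev, i.2]
  simp_rw [this]
  simp [ev]

lemma ev_of (g : InfinitePlace K → ℝ) (hg : ∑ w, g w = 0) (w) : ev (fun i => g i) w = g w := by
  unfold ev
  split_ifs with h
  · rw [sum_split] at hg
    rw [h]; linarith
  · rfl

lemma ev_cont (w : InfinitePlace K) : Continuous (fun v : logSpace K => ev v w) := by
  unfold ev; split_ifs <;> fun_prop

def yv (τ : ℝ) (v : logSpace K) (w : InfinitePlace K) : ℝ :=
  τ ^ (2 / (finrank ℚ K : ℝ)) * rexp (2 * ev v w / w.mult)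

lemma yv_pos {τ : ℝ} (hτ : 0 < τ) (v : logSpace K) (w) : 0 < yv τ v w := by unfold yv; positivity

lemma yv_inv {τ : ℝ} (hτ : 0 < τ) (v : logSpace K) (w) : (yv τ v w)⁻¹ = yv τ⁻¹ (-v) w := by
  unfold yv
  rw [mul_inv, ← Real.inv_rpow hτ.le, ← exp_neg, ev_neg]
  congr 2; ring

lemma fr_pos : 0 < (finrank ℚ K : ℝ) := by exact_mod_cast finrank_pos

lemma mult_pos' (w : InfinitePlace K) : 0 < (w.mult : ℝ) := by exact_mod_cast w.mult_pos

lemma sum_mult_real : ∑ w : InfinitePlace K, (w.mult : ℝ) = finrank ℚ K := by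
  exact_mod_cast InfinitePlace.sum_mult_eq (K := K)

lemma yv_prod {τ : ℝ} (hτ : 0 < τ) (v : logSpace K) : √(∏ w, yv τ v w ^ w.mult) = τ := by
  have : ∏ w, yv τ v w ^ w.mult = τ ^ 2 := by
    unfold yv
    simp_rw [mul_pow, Finset.prod_mul_distrib, ← exp_nat_mul]
    rw [← exp_sum, Finset.prod_pow_eq_pow_sum, InfinitePlace.sum_mult_eq, ← Real.rpow_natCast,
      ← Real.rpow_mul hτ.le, div_mul_cancel₀ _ fr_pos.ne']
    have : ∑ w : InfinitePlace K, (w.mult : ℝ) * (2 * ev v w / w.mult) = 0 := by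
      have h := congrArg (fun x => 2 * x) (ev_sum v)
      simp only [Finset.mul_sum, mul_zero] at h
      rw [← h]
      exact Finset.sum_congr rfl fun w _ => by have := mult_pos' w; field_simp
    rw [this]; simp
  rw [this, sqrt_sq hτ.le]

def nm (a : K) : ℝ := |(Algebra.norm ℚ a : ℝ)|

lemma yv_shift {τ : ℝ} (hτ : 0 < τ) (v : logSpace K) (a : K) (ha : a ≠ 0) (w : InfinitePlace K) :
    yv τ v w * w a ^ 2 = yv (τ * nm a) (v + fun i => (i.1.mult : ℝ) * (Real.log (i.1 a)
      - Real.log (nm a) / finrank ℚ K)) w := by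
  have hN : (0:ℝ) < nm a := by
    rw [nm, abs_pos]; exact_mod_cast (Algebra.norm_ne_zero_iff.mpr ha)
  have hsum : ∑ w : InfinitePlace K, (w.mult : ℝ) * Real.log (w a) = Real.log (nm a) := by
    have := InfinitePlace.prod_eq_abs_norm a
    rw [Rat.cast_abs] at this
    rw [nm, ← this, Real.log_prod (fun w _ => pow_ne_zero _ (by simpa using ha))]
    simp
  have hg : ∑ w : InfinitePlace K, ((w.mult : ℝ) * (Real.log (w a)
      - Real.log (nm a) / finrank ℚ K)) = 0 := by
    simp_rw [mul_sub, Finset.sum_sub_distrib, ← Finset.sum_mul]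
    rw [hsum, sum_mult_real, mul_div_cancel₀ _ fr_pos.ne', sub_self]
  unfold yv
  rw [ev_add, ev_of (fun w : InfinitePlace K => ((w.mult : ℝ) * (Real.log (w a)
      - Real.log (nm a) / finrank ℚ K))) hg]
  have hw : 0 < w a := by rw [InfinitePlace.pos_iff]; exact ha
  have hm := mult_pos' w
  rw [Real.mul_rpow hτ.le hN.le, Real.rpow_def_of_pos hN, mul_assoc, mul_assoc, ← exp_add]
  conv_lhs => rw [← Real.exp_log hw, ← Real.exp_nat_mul, ← exp_add]
  congr 2
  field_simp
  push_cast
  ring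

def EE (τ : ℝ) (a : K) (v : logSpace K) : ENNReal := ENNReal.ofReal (rexp (-π * nq (yv τ v) a))

lemma nq_cont (τ : ℝ) (a : K) : Continuous (fun v : logSpace K => nq (yv τ v) a) := by
  unfold nq yv
  have := ev_cont (K := K)
  fun_prop

lemma EE_meas (τ : ℝ) (a : K) : Measurable (EE τ a) := by
  unfold EE
  have := nq_cont (K := K) τ a
  exact (ENNReal.continuous_ofReal.comp (by fun_prop)).measurable

def GG (K : Type*) [Field K] [NumberField K] (τ : ℝ) : ENNReal := ∫⁻ v : logSpace K, EE τ (1 : K) v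

lemma EE_shift {τ : ℝ} (hτ : 0 < τ) (v : logSpace K) (a : K) (ha : a ≠ 0) :
    EE τ a v = EE (τ * nm a) 1 (v + fun i => (i.1.mult : ℝ) * (Real.log (i.1 a)
      - Real.log (nm a) / finrank ℚ K)) := by
  unfold EE nq
  simp_rw [yv_shift hτ v a ha]
  simp

lemma EE_int {τ : ℝ} (hτ : 0 < τ) (a : K) (ha : a ≠ 0) :
    ∫⁻ v : logSpace K, EE τ a v = GG K (τ * nm a) := by
  simp_rw [EE_shift hτ _ a ha]
  rw [lintegral_add_right_eq_self (μ := (volume : Measure (logSpace K))) (EE (τ * nm a) (1 : K)), GG]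

lemma EE_unit {τ : ℝ} (hτ : 0 < τ) (v : logSpace K) (a : K) (u : (𝓞 K)ˣ) :
    EE τ (((u : 𝓞 K) : K) * a) v = EE τ a (logEmbedding K (Additive.ofMul u) + v) := by
  unfold EE nq
  have hu : ((u : 𝓞 K) : K) ≠ 0 := by simp
  have hN' : nm ((u : 𝓞 K) : K) = 1 := by
    rw [nm]; exact_mod_cast congrArg (fun q : ℚ => (q:ℝ)) (NumberField.Units.norm (K := K) u)
  have : ∀ w : InfinitePlace K, yv τ v w * w (((u : 𝓞 K) : K) * a) ^ 2 =
      yv τ (logEmbedding K (Additive.ofMul u) + v) w * w a ^ 2 := by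
    intro w
    rw [map_mul, mul_pow, ← mul_assoc, yv_shift hτ v _ hu, hN']
    rw [add_comm v]
    congr 2
    · simp
    · congr 1
      ext i
      simp [logEmbedding_component]
  simp_rw [this]

lemma tsum_units (g : logSpace K → ENNReal) :
    ∑' u : (𝓞 K)ˣ, g (logEmbedding K (Additive.ofMul u)) =
      torsionOrder K * ∑' l : unitLattice K, g l := by
  let L : (𝓞 K)ˣ → unitLattice K := fun u => ⟨logEmbedding K (Additive.ofMul u), ⟨Additive.ofMul u, trivial, rfl⟩⟩
  rw [← (Equiv.sigmaFiberEquiv L).tsum_eq, ENNReal.tsum_sigma', ← ENNReal.tsum_mul_left]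
  refine tsum_congr fun l => ?_
  obtain ⟨_, u0, -, rfl⟩ := l
  have : ∀ u : {u // L u = ⟨_, ⟨u0, trivial, rfl⟩⟩}, g (logEmbedding K (Additive.ofMul ((Equiv.sigmaFiberEquiv L) ⟨_, u⟩))) =
     g ((logEmbedding K).toIntLinearMap u0) := by
    intro u
    have := congrArg Subtype.val u.2
    exact congrArg g this
  rw [tsum_congr this]
  have E : {u // L u = ⟨_, ⟨u0, trivial, rfl⟩⟩} ≃ torsion K :=
    { toFun := fun u => ⟨(Additive.toMul u0)⁻¹ * u, by
        rw [← logEmbedding_eq_zero_iff]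
        have h := congrArg Subtype.val u.2
        change logEmbedding K (Additive.ofMul u.1) = logEmbedding K u0 at h
        change logEmbedding K (- u0 + Additive.ofMul u.1) = 0
        rw [map_add, h, map_neg]; simp⟩
      invFun := fun z => ⟨Additive.toMul u0 * z, by
        have := logEmbedding_eq_zero_iff.mpr z.2
        apply Subtype.ext
        change logEmbedding K (u0 + Additive.ofMul z.1) = logEmbedding K u0
        rw [map_add, this, add_zero]⟩
      left_inv := fun u => by apply Subtype.ext; simp
      right_inv := fun z => by apply Subtype.ext; simp }
  rw [← E.symm.tsum_eq]
  rw [ENNReal.tsum_const, torsionOrder, ENat.card_eq_coe_natCard]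
  rfl

instance vinv : VAddInvariantMeasure (unitLattice K) (logSpace K) volume :=
  ⟨fun c s _ => measure_preimage_add volume (c : logSpace K) s⟩

lemma unfold_units {τ : ℝ} (hτ : 0 < τ) (a : K) (ha : a ≠ 0) (F : Set (logSpace K))
    (hF : IsAddFundamentalDomain (unitLattice K) F (volume : Measure (logSpace K))) :
    ∑' u : (𝓞 K)ˣ, ∫⁻ v in F, EE τ (((u : 𝓞 K) : K) * a) v =
      torsionOrder K * GG K (τ * nm a) := by
  simp_rw [EE_unit hτ]
  rw [tsum_units (fun l => ∫⁻ v in F, EE τ a (l + v)), ← EE_int hτ a ha, hF.lintegral_eq_tsum'']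
  rfl

end MRH

namespace MRH
open MeasureTheory Real NumberField Module
open NumberField.Units NumberField.Units.dirichletUnitTheorem
open scoped nonZeroDivisors
variable {K : Type*} [Field K] [NumberField K]

def XX (A : FractionalIdeal (𝓞 K)⁰ K) : Type _ :=
  {I : Ideal (𝓞 K) // ∃ a : K, a ≠ 0 ∧ (I : FractionalIdeal (𝓞 K)⁰ K) * A = FractionalIdeal.spanSingleton _ a}

lemma XX_nm (A : FractionalIdeal (𝓞 K)⁰ K) (I : Ideal (𝓞 K)) (a : K)
    (h : (I : FractionalIdeal (𝓞 K)⁰ K) * A = FractionalIdeal.spanSingleton _ a) :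
    nm a = Ideal.absNorm I * FractionalIdeal.absNorm A := by
  have := congrArg FractionalIdeal.absNorm h
  rw [FractionalIdeal.absNorm_span_singleton, map_mul, FractionalIdeal.coeIdeal_absNorm] at this
  rw [nm]
  exact_mod_cast (congrArg (fun q : ℚ => (q : ℝ)) this).symm

lemma tsum_split {α β : Type*} (f : α → ENNReal) (z : α) (P : β → α) (hP : Function.Injective P)
    (h0 : ∀ b, P b ≠ z) (h1 : ∀ a, a ≠ z → a ∈ Set.range P) : ∑' a, f a = f z + ∑' b, f (P b) := by
  rw [ENNReal.tsum_eq_add_tsum_ite z]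
  congr 1
  rw [← hP.tsum_eq]
  · exact tsum_congr fun p => if_neg (h0 p)
  · intro b hb
    apply h1
    rintro rfl
    simp at hb

lemma Th_unfold (A : FractionalIdeal (𝓞 K)⁰ K) (hA : A ≠ 0) {τ : ℝ} (hτ : 0 < τ) (F : Set (logSpace K))
    (hF : IsAddFundamentalDomain (unitLattice K) F (volume : Measure (logSpace K))) :
    ∫⁻ v in F, Th A (yv τ v) = volume F + torsionOrder K * ∑' I : XX A,
      GG K (τ * (Ideal.absNorm I.1 * FractionalIdeal.absNorm A)) := by
  choose a ha0 ha using fun I : XX A => I.2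
  have hmem : ∀ p : XX A × (𝓞 K)ˣ, ((p.2 : 𝓞 K) : K) * a p.1 ∈ A := by
    intro p
    have h1 : a p.1 ∈ (p.1.1 : FractionalIdeal (𝓞 K)⁰ K) * A := by
      rw [ha]; exact FractionalIdeal.mem_spanSingleton_self _ _
    have h2 : (p.1.1 : FractionalIdeal (𝓞 K)⁰ K) * A ≤ A := by
      calc _ ≤ 1 * A := by gcongr; exact FractionalIdeal.coeIdeal_le_one
        _ = A := one_mul A
    have := (A : Submodule (𝓞 K) K).smul_mem (p.2 : 𝓞 K) (h2 h1)
    rwa [Algebra.smul_def] at this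
  let P : XX A × (𝓞 K)ˣ → A := fun p => ⟨_, hmem p⟩
  have hP0 : ∀ p, (P p : K) ≠ 0 := fun p => mul_ne_zero (by simp) (ha0 _)
  have hspan : ∀ (u : (𝓞 K)ˣ) (b : K), FractionalIdeal.spanSingleton (𝓞 K)⁰ (((u : 𝓞 K) : K) * b) =
      FractionalIdeal.spanSingleton (𝓞 K)⁰ b := by
    intro u b
    symm
    rw [FractionalIdeal.spanSingleton_eq_spanSingleton]
    exact ⟨u, by rw [Units.smul_def, Algebra.smul_def]⟩
  have hPinj : Function.Injective P := by
    rintro ⟨I, u⟩ ⟨I', u'⟩ h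
    have h : ((u : 𝓞 K) : K) * a I = ((u' : 𝓞 K) : K) * a I' := congrArg Subtype.val h
    have h1 : I = I' := by
      apply Subtype.ext
      have h2 := congrArg (FractionalIdeal.spanSingleton (𝓞 K)⁰) h
      rw [hspan, hspan, ← ha, ← ha] at h2
      exact FractionalIdeal.coeIdeal_injective (mul_right_cancel₀ hA h2)
    subst h1
    have h3 := mul_right_cancel₀ (ha0 _) h
    rw [Prod.mk.injEq]
    exact ⟨rfl, by ext; exact_mod_cast h3⟩
  have hPsurj : ∀ b : A, (b : K) ≠ 0 → b ∈ Set.range P := by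
    intro b hb
    have hle : FractionalIdeal.spanSingleton (𝓞 K)⁰ (b : K) * A⁻¹ ≤ 1 := by
      calc _ ≤ A * A⁻¹ := by
            gcongr
            rw [FractionalIdeal.spanSingleton_le_iff_mem]; exact b.2
        _ = 1 := mul_inv_cancel₀ hA
    obtain ⟨I, hI⟩ := FractionalIdeal.le_one_iff_exists_coeIdeal.mp hle
    have hI' : (I : FractionalIdeal (𝓞 K)⁰ K) * A = FractionalIdeal.spanSingleton (𝓞 K)⁰ (b : K) := by
      rw [hI, mul_assoc, inv_mul_cancel₀ hA, mul_one]
    let I0 : XX A := ⟨I, b, hb, hI'⟩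
    have h4 : FractionalIdeal.spanSingleton (𝓞 K)⁰ (a I0) = FractionalIdeal.spanSingleton (𝓞 K)⁰ (b : K) := by
      rw [← ha, ← hI']
    obtain ⟨u, hu⟩ := FractionalIdeal.spanSingleton_eq_spanSingleton.mp h4
    refine ⟨(I0, u), Subtype.ext ?_⟩
    rw [← hu, Units.smul_def, Algebra.smul_def]
  have hTh : ∀ v, Th A (yv τ v) = 1 + ∑' p : XX A × (𝓞 K)ˣ, EE τ (((p.2 : 𝓞 K) : K) * a p.1) v := by
    intro v
    have h := tsum_split (fun b : A => ENNReal.ofReal (rexp (-π * nq (yv τ v) (b : K)))) ⟨0, zero_mem (A : Submodule (𝓞 K) K)⟩ P hPinj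
      (fun p h => hP0 p (by rw [h])) (fun b hb => hPsurj b (fun h => hb (Subtype.ext h)))
    rw [Th, h]
    congr 1
    simp [nq]
  have : Countable K := (Module.finBasis ℚ K).equivFun.injective.countable
  have : Countable (XX A × (𝓞 K)ˣ) := (Subtype.val_injective.comp hPinj).countable
  simp_rw [hTh]
  rw [lintegral_add_left measurable_const, lintegral_const, one_mul, Measure.restrict_apply_univ,
    lintegral_tsum (fun p => (EE_meas _ _).aemeasurable), ENNReal.tsum_prod']
  congr 1
  rw [← ENNReal.tsum_mul_left]
  refine tsum_congr fun I => ?_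
  rw [unfold_units hτ (a I) (ha0 I) F hF, XX_nm A I.1 (a I) (ha I)]

def ff (K : Type*) [Field K] [NumberField K] (V : ENNReal) (τ : ℝ) : ENNReal :=
  Fintype.card (ClassGroup (𝓞 K)) * V + torsionOrder K * ∑' I : {I : Ideal (𝓞 K) // I ≠ ⊥},
      GG K (τ * Ideal.absNorm I.1)

lemma class_sum (J : ClassGroup (𝓞 K) → (FractionalIdeal (𝓞 K)⁰ K)ˣ)
    (hJ : Function.Bijective (fun c => ClassGroup.mk K (J c))) {τ : ℝ} (hτ : 0 < τ) (F : Set (logSpace K))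
    (hF : IsAddFundamentalDomain (unitLattice K) F (volume : Measure (logSpace K))) :
    ∑ c, ∫⁻ v in F, Th (J c).1 (yv (τ / FractionalIdeal.absNorm (J c).1) v) = ff K (volume F) τ := by
  have hN : ∀ c, (0:ℝ) < FractionalIdeal.absNorm (J c).1 := by
    intro c
    have := FractionalIdeal.absNorm_nonneg (J c).1
    have h2 : FractionalIdeal.absNorm (J c).1 ≠ 0 := by
      rw [Ne, FractionalIdeal.absNorm_eq_zero_iff]; exact (J c).ne_zero
    exact_mod_cast lt_of_le_of_ne this (Ne.symm h2)
  have h1 : ∀ c, ∫⁻ v in F, Th (J c).1 (yv (τ / FractionalIdeal.absNorm (J c).1) v) =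
      volume F + torsionOrder K * ∑' I : XX (J c).1, GG K (τ * Ideal.absNorm I.1) := by
    intro c
    rw [Th_unfold _ (J c).ne_zero (div_pos hτ (hN c)) F hF]
    congr 2
    refine tsum_congr fun I => ?_
    congr 1
    have := (hN c).ne'
    field_simp
  simp_rw [h1]
  rw [Finset.sum_add_distrib, ff, ← Finset.mul_sum]
  congr 1
  · simp
  congr 1
  rw [← tsum_fintype (L := .unconditional _), ← ENNReal.tsum_sigma' (fun p : Σ c, XX (J c).1 => GG K (τ * Ideal.absNorm p.2.1))]
  have hne : ∀ p : Σ c, XX (J c).1, p.2.1 ≠ ⊥ := by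
    rintro ⟨c, I, a, ha, h⟩ (h0 : I = ⊥)
    rw [h0] at h
    simp at h
    exact ha (by simpa [FractionalIdeal.spanSingleton_eq_zero_iff] using h.symm)
  have hmk : ∀ (c) (I : Ideal (𝓞 K)) (hI : I ≠ ⊥),
      (∃ a : K, a ≠ 0 ∧ (I : FractionalIdeal (𝓞 K)⁰ K) * (J c).1 = FractionalIdeal.spanSingleton _ a) ↔
      ClassGroup.mk K (J c) = (ClassGroup.mk K (Units.mk0 (I : FractionalIdeal (𝓞 K)⁰ K)
        (FractionalIdeal.coeIdeal_ne_zero.mpr hI)))⁻¹ := by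
    intro c I hI
    rw [eq_comm, inv_eq_iff_mul_eq_one, ← map_mul, ClassGroup.mk_eq_one_iff, FractionalIdeal.isPrincipal_iff]
    constructor
    · rintro ⟨a, -, h⟩; exact ⟨a, by simpa using h⟩
    · rintro ⟨a, h⟩
      refine ⟨a, ?_, by simpa using h⟩
      rintro rfl
      simp at h
      exact hI h
  let E : (Σ c, XX (J c).1) → {I : Ideal (𝓞 K) // I ≠ ⊥} := fun p => ⟨p.2.1, hne p⟩
  have hE : Function.Bijective E := by
    constructor
    · rintro ⟨c, I, hI⟩ ⟨c', I', hI'⟩ h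
      have h : I = I' := congrArg Subtype.val h
      subst h
      have hI0 := hne ⟨c, I, hI⟩
      have : c = c' := hJ.1 (by
        change ClassGroup.mk K (J c) = ClassGroup.mk K (J c')
        rw [(hmk c I hI0).mp hI, (hmk c' I hI0).mp hI'])
      subst this
      rfl
    · rintro ⟨I, hI⟩
      obtain ⟨c, hc⟩ := hJ.2 (ClassGroup.mk K (Units.mk0 (I : FractionalIdeal (𝓞 K)⁰ K)
        (FractionalIdeal.coeIdeal_ne_zero.mpr hI)))⁻¹
      exact ⟨⟨c, I, (hmk c I hI).mpr hc⟩, rfl⟩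
  exact (Equiv.ofBijective E hE).tsum_eq (fun I => GG K (τ * Ideal.absNorm I.1))

lemma ff_fe (F : Set (logSpace K)) (hFm : MeasurableSet F)
    (hF : IsAddFundamentalDomain (unitLattice K) F (volume : Measure (logSpace K))) {τ : ℝ} (hτ : 0 < τ) :
    ff K (volume F) τ = ENNReal.ofReal (√|(discr K : ℝ)| * τ)⁻¹ * ff K (volume F) (|(discr K : ℝ)| * τ)⁻¹ := by
  have hD : (0:ℝ) < |(discr K : ℝ)| := by rw [abs_pos]; exact_mod_cast discr_ne_zero K
  choose J hJ using fun c : ClassGroup (𝓞 K) => show ∃ J, ClassGroup.mk K J = c from ClassGroup.induction K (fun I => ⟨I, rfl⟩) c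
  have hN : ∀ c, (0:ℝ) < FractionalIdeal.absNorm (J c).1 := by
    intro c
    have := FractionalIdeal.absNorm_nonneg (J c).1
    have h2 : FractionalIdeal.absNorm (J c).1 ≠ 0 := by
      rw [Ne, FractionalIdeal.absNorm_eq_zero_iff]; exact (J c).ne_zero
    exact_mod_cast lt_of_le_of_ne this (Ne.symm h2)
  let J' : ClassGroup (𝓞 K) → (FractionalIdeal (𝓞 K)⁰ K)ˣ := fun c =>
    Units.mk0 (FractionalIdeal.dual ℤ ℚ (J c).1) (FractionalIdeal.dual_ne_zero ℤ ℚ (J c).ne_zero)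
  let d1 : (FractionalIdeal (𝓞 K)⁰ K)ˣ :=
    Units.mk0 (FractionalIdeal.dual ℤ ℚ 1) (FractionalIdeal.dual_ne_zero ℤ ℚ one_ne_zero)
  have hJ' : ∀ c, J' c = d1 * (J c)⁻¹ := by
    intro c
    ext1
    simp only [J', d1, Units.val_mk0, Units.val_mul, Units.val_inv_eq_inv_val]
    exact FractionalIdeal.dual_eq_mul_inv ℤ ℚ _
  have hb' : Function.Bijective (fun c => ClassGroup.mk K (J' c)) := by
    have : (fun c => ClassGroup.mk K (J' c)) = fun c => ClassGroup.mk K d1 * c⁻¹ := by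
      ext c; rw [hJ', map_mul, map_inv, hJ]
    rw [this]
    exact (Group.mulLeft_bijective _).comp inv_involutive.bijective
  have hb : Function.Bijective (fun c => ClassGroup.mk K (J c)) := by
    simp_rw [hJ]; exact Function.bijective_id
  have mp : MeasurePreserving (Neg.neg : logSpace K → logSpace K) volume volume := Measure.measurePreserving_neg _
  have hF' : IsAddFundamentalDomain (unitLattice K) (Neg.neg ⁻¹' F) (volume : Measure (logSpace K)) := by
    refine hF.preimage_of_equiv (f := Neg.neg) mp.quasiMeasurePreserving (e := fun g => -g)
      neg_involutive.bijective ?_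
    intro g x
    ext i
    simp [Submodule.vadd_def]
    ring
  have hV : volume (Neg.neg ⁻¹' F) = volume F := mp.measure_preimage hFm.nullMeasurableSet
  have h1 := class_sum J hb hτ F hF
  have h2 := class_sum J' hb' (τ := (|(discr K : ℝ)| * τ)⁻¹) (by positivity) (Neg.neg ⁻¹' F) hF'
  rw [hV] at h2
  rw [← h1, ← h2, Finset.mul_sum]
  refine Finset.sum_congr rfl fun c _ => ?_
  have h3 : ∀ v, Th (J c).1 (yv (τ / FractionalIdeal.absNorm (J c).1) v) =
    ENNReal.ofReal (√|(discr K : ℝ)| * τ)⁻¹ *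
      Th (J' c).1 (yv ((|(discr K : ℝ)| * τ)⁻¹ / FractionalIdeal.absNorm (J' c).1) (-v)) := by
    intro v
    have hp := div_pos hτ (hN c)
    rw [Th_fe (J c).1 (J c).ne_zero _ (yv_pos hp v), yv_prod hp]
    have e1 : √|(discr K : ℝ)| * FractionalIdeal.absNorm (J c).1 * (τ / FractionalIdeal.absNorm (J c).1) =
      √|(discr K : ℝ)| * τ := by have := (hN c).ne'; field_simp
    rw [e1]
    congr 2
    ext w
    rw [yv_inv hp]
    congr 1
    have := (hN c).ne'
    change _ = _ / ((FractionalIdeal.absNorm (FractionalIdeal.dual ℤ ℚ (J c).1) : ℚ) : ℝ)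
    rw [dual_norm]
    field_simp
  simp_rw [h3]
  rw [lintegral_const_mul' _ _ ENNReal.ofReal_ne_top]
  congr 1
  exact mp.setLIntegral_comp_preimage_emb (Homeomorph.neg _).measurableEmbedding
    (fun v => Th (J' c).1 (yv ((|(discr K : ℝ)| * τ)⁻¹ / FractionalIdeal.absNorm (J' c).1) v)) (Neg.neg ⁻¹' F) ▸ (by
      rw [← Set.preimage_comp]; simp)

end MRH

namespace MRH
open MeasureTheory Real NumberField Module
open NumberField.Units NumberField.Units.dirichletUnitTheorem
open scoped nonZeroDivisors
variable {K : Type*} [Field K] [NumberField K]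

lemma ff_exists (K : Type*) [Field K] [NumberField K] : ∃ V : ENNReal, V ≠ 0 ∧ V ≠ ⊤ ∧ ∀ τ : ℝ, 0 < τ →
    ff K V τ = ENNReal.ofReal (√|(discr K : ℝ)| * τ)⁻¹ * ff K V (|(discr K : ℝ)| * τ)⁻¹ := by
  let b := (basisUnitLattice K).ofZLatticeBasis ℝ (unitLattice K)
  refine ⟨volume (ZSpan.fundamentalDomain b), ZSpan.measure_fundamentalDomain_ne_zero b,
    (ZSpan.fundamentalDomain_isBounded b).measure_lt_top.ne, fun τ hτ => ?_⟩
  exact ff_fe _ (ZSpan.fundamentalDomain_measurableSet b) (ZLattice.isAddFundamentalDomain (basisUnitLattice K) _) hτ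

def E1 (m u : ℝ) : ℝ := rexp (-π * m * rexp (2 * u / m))

lemma E1_cont (m : ℝ) : Continuous (E1 m) := by unfold E1; fun_prop

def uu (T : ℝ) (v : logSpace K) (w : InfinitePlace K) : ℝ := if h : w = w₀ then T - ∑ i, v i else v ⟨w, h⟩

lemma GG_exp (T : ℝ) : GG K (rexp T) = ∫⁻ v : logSpace K, ∏ w, ENNReal.ofReal (E1 w.mult (uu T v w)) := by
  rw [GG, ← lintegral_add_right_eq_self (μ := (volume : Measure (logSpace K)))
    (fun v : logSpace K => ∏ w, ENNReal.ofReal (E1 w.mult (uu T v w)))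
    (fun i => (i.1.mult : ℝ) * T / finrank ℚ K)]
  refine lintegral_congr fun v => ?_
  unfold EE E1 nq
  rw [← ENNReal.ofReal_prod_of_nonneg (fun _ _ => (exp_pos _).le)]
  rw [← exp_sum, Finset.mul_sum]
  congr 2
  refine Finset.sum_congr rfl fun w _ => ?_
  have hm := (mult_pos' w).ne'
  have hd := (fr_pos (K := K)).ne'
  have h1 : uu T (v + fun i => (i.1.mult : ℝ) * T / finrank ℚ K) w = w.mult * T / finrank ℚ K + ev v w := by
    unfold uu ev
    split_ifs with h
    · have := sum_split (fun w : InfinitePlace K => (w.mult : ℝ))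
      rw [sum_mult_real] at this
      simp only [Pi.add_apply, Finset.sum_add_distrib]
      rw [← Finset.sum_div, ← Finset.sum_mul, h]
      rw [eq_sub_of_add_eq' this.symm]
      field_simp
      ring
    · simp [add_comm]
  rw [h1, yv, ← exp_mul, ← exp_add, map_one, one_pow, mul_one, mul_assoc]
  congr 3
  field_simp

lemma uu_add (T : ℝ) (v : logSpace K) (w : InfinitePlace K) : uu (T + ∑ i, v i) v w = if h : w = w₀ then T else v ⟨w, h⟩ := by
  unfold uu; split_ifs <;> simp

lemma uu_meas (w : InfinitePlace K) : Measurable (fun p : ℝ × logSpace K => uu p.1 p.2 w) := by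
  unfold uu; split_ifs <;> fun_prop

lemma lint_unique {ι : Type*} [hi : Fintype ι] [Unique ι] (g : (ι → ℝ) → ENNReal) :
    ∫⁻ x, g x = ∫⁻ T : ℝ, g (fun _ => T) := by
  obtain rfl : hi = Unique.fintype := Subsingleton.elim _ _
  rw [← (volume_preserving_funUnique ι ℝ).symm.lintegral_comp_emb (MeasurableEquiv.measurableEmbedding _)]
  rfl

lemma GG_push (h : ℝ → ENNReal) (hh : Measurable h) :
    ∫⁻ T, h T * GG K (rexp T) = ∫⁻ u : InfinitePlace K → ℝ, h (∑ w, u w) * ∏ w, ENNReal.ofReal (E1 w.mult (u w)) := by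
  have hm : Measurable (fun p : ℝ × logSpace K => h p.1 * ∏ w, ENNReal.ofReal (E1 w.mult (uu p.1 p.2 w))) := by
    refine (hh.comp measurable_fst).mul (Finset.measurable_prod _ fun w _ => ?_)
    exact ((E1_cont _).measurable.comp (uu_meas w)).ennreal_ofReal
  have hm1 : ∀ T, Measurable (fun v : logSpace K => ∏ w, ENNReal.ofReal (E1 w.mult (uu T v w))) := by
    intro T
    refine Finset.measurable_prod _ fun w _ => ?_
    exact ((E1_cont _).measurable.comp ((uu_meas w).comp measurable_prodMk_left)).ennreal_ofReal
  simp_rw [GG_exp]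
  have h0 : ∀ T, h T * ∫⁻ v : logSpace K, ∏ w, ENNReal.ofReal (E1 w.mult (uu T v w)) =
      ∫⁻ v : logSpace K, h T * ∏ w, ENNReal.ofReal (E1 w.mult (uu T v w)) :=
    fun T => (lintegral_const_mul (h T) (hm1 T)).symm
  simp_rw [h0]
  rw [lintegral_lintegral_swap hm.aemeasurable]
  have h2 : ∀ v : logSpace K, ∫⁻ T, h T * ∏ w, ENNReal.ofReal (E1 w.mult (uu T v w)) =
      ∫⁻ T, h (T + ∑ i, v i) * ∏ w, ENNReal.ofReal (E1 w.mult (if h : w = w₀ then T else v ⟨w, h⟩)) := by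
    intro v
    rw [← lintegral_add_right_eq_self (μ := (volume : Measure ℝ)) _ (∑ i, v i)]
    simp_rw [uu_add]
  simp_rw [h2]
  let e := MeasurableEquiv.piEquivPiSubtypeProd (fun _ : InfinitePlace K => ℝ) (fun w => w = w₀)
  have he := (volume_preserving_piEquivPiSubtypeProd (fun _ : InfinitePlace K => ℝ) (fun w => w = w₀)).symm
  rw [← he.lintegral_comp_emb e.symm.measurableEmbedding, Measure.volume_eq_prod, lintegral_prod_symm]
  · refine lintegral_congr fun v => ?_
    refine Eq.trans ?_ (@lint_unique {w : InfinitePlace K // w = w₀} (Subtype.fintype fun w => w = w₀) _ _).symm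
    refine lintegral_congr fun T => ?_
    have h3 : ∀ w, (MeasurableEquiv.piEquivPiSubtypeProd (fun _ : InfinitePlace K => ℝ) (fun w => w = w₀)).symm (fun _ => T, v) w =
        if h : w = w₀ then T else v ⟨w, h⟩ := by
      intro w
      simp only [MeasurableEquiv.piEquivPiSubtypeProd_symm_apply]
    simp_rw [h3]
    congr 2
    rw [sum_split]
    simp
    refine Finset.sum_congr rfl fun i _ => ?_
    rw [if_neg i.2]
  · refine Measurable.aemeasurable ?_
    have h4 : Measurable (fun u : InfinitePlace K → ℝ => h (∑ w, u w) * ∏ w, ENNReal.ofReal (E1 w.mult (u w))) := by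
      refine (hh.comp (by fun_prop)).mul (Finset.measurable_prod _ fun w _ => ?_)
      exact ((E1_cont _).measurable.comp (measurable_pi_apply w)).ennreal_ofReal
    exact h4.comp e.symm.measurable

end MRH

namespace MRH
open MeasureTheory Real NumberField Module Set
open NumberField.Units NumberField.Units.dirichletUnitTheorem
variable {K : Type*} [Field K] [NumberField K]

lemma E1_nonneg (m u : ℝ) : 0 ≤ E1 m u := (exp_pos _).le

lemma exp_image : rexp '' univ = Ioi 0 := by rw [image_univ, range_exp]

lemma mellin_log (g : ℝ → ℂ) (s : ℂ) : mellin g s = ∫ T : ℝ, Complex.exp (s * T) * g (rexp T) := by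
  rw [mellin, ← exp_image, integral_image_eq_integral_abs_deriv_smul MeasurableSet.univ
    (fun x _ => (hasDerivAt_exp x).hasDerivWithinAt) exp_injective.injOn, setIntegral_univ]
  refine integral_congr_ae (ae_of_all _ fun T => ?_)
  simp only [abs_exp, smul_eq_mul, Complex.real_smul]
  rw [← mul_assoc]
  congr 1
  rw [Complex.cpow_def_of_ne_zero (by exact_mod_cast (exp_pos T).ne'), ← Complex.ofReal_log (exp_pos T).le,
    log_exp, Complex.ofReal_exp, ← Complex.exp_add]
  congr 1; ring

lemma mellinConv_log (g : ℝ → ℂ) (s : ℂ) : MellinConvergent g s ↔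
    Integrable (fun T : ℝ => Complex.exp (s * T) * g (rexp T)) := by
  rw [MellinConvergent, ← exp_image, integrableOn_image_iff_integrableOn_abs_deriv_smul MeasurableSet.univ
    (fun x _ => (hasDerivAt_exp x).hasDerivWithinAt) exp_injective.injOn, integrableOn_univ]
  refine integrable_congr (ae_of_all _ fun T => ?_)
  simp only [abs_exp, smul_eq_mul, Complex.real_smul]
  rw [← mul_assoc]
  congr 1
  rw [Complex.cpow_def_of_ne_zero (by exact_mod_cast (exp_pos T).ne'), ← Complex.ofReal_log (exp_pos T).le,
    log_exp, Complex.ofReal_exp, ← Complex.exp_add]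
  congr 1; ring

def gt1 (m : ℝ) (s : ℂ) : ℂ := (m / 2 : ℝ) * ((1 / ((π * m : ℝ) : ℂ)) ^ (m * s / 2) * Complex.Gamma (m * s / 2))

lemma I1 {m : ℝ} (hm : 0 < m) {s : ℂ} (hs : 0 < s.re) :
    ∫ u : ℝ, Complex.exp (s * u) * (E1 m u : ℂ) = gt1 m s := by
  have h1 := mellin_log (fun t => ((rexp (-((π * m) * t ^ (2 / m))) : ℝ) : ℂ)) s
  have h2 : ∀ T, rexp (-((π * m) * (rexp T) ^ (2 / m))) = E1 m T := by
    intro T; rw [E1, ← exp_mul]; congr 1; ring_nf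
  simp_rw [h2] at h1
  rw [← h1, mellin_comp_rpow (fun t => ((rexp (-((π * m) * t)) : ℝ) : ℂ)), mellin]
  have h4 : s / ((2 / m : ℝ) : ℂ) = m * s / 2 := by
    have : (m : ℂ) ≠ 0 := by exact_mod_cast hm.ne'
    push_cast; field_simp
  rw [h4]
  have h3 : 0 < (m * s / 2 : ℂ).re := by
    have : (m * s / 2 : ℂ) = ((m / 2 : ℝ) : ℂ) * s := by push_cast; ring
    rw [this, Complex.re_ofReal_mul]; positivity
  have := Complex.integral_cpow_mul_exp_neg_mul_Ioi h3 (show 0 < π * m by positivity)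
  simp only [smul_eq_mul]
  push_cast at this ⊢
  rw [this, gt1, abs_of_pos (by positivity)]
  rw [Complex.real_smul]
  push_cast
  simp

lemma gt1_ne {m : ℝ} (hm : 0 < m) {s : ℂ} (hs : 0 < s.re) : gt1 m s ≠ 0 := by
  unfold gt1
  have : ((π * m : ℝ) : ℂ) ≠ 0 := by exact_mod_cast (show π * m ≠ 0 by positivity)
  have h3 : 0 < (m * s / 2 : ℂ).re := by
    have : (m * s / 2 : ℂ) = ((m / 2 : ℝ) : ℂ) * s := by push_cast; ring
    rw [this, Complex.re_ofReal_mul]; positivity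
  refine mul_ne_zero (by exact_mod_cast (show m / 2 ≠ 0 by positivity)) (mul_ne_zero ?_ (Complex.Gamma_ne_zero_of_re_pos h3))
  rw [Complex.cpow_def_of_ne_zero (by simpa using this)]
  exact Complex.exp_ne_zero _

lemma I1_int {m : ℝ} (hm : 0 < m) {s : ℂ} (hs : 0 < s.re) :
    Integrable (fun u : ℝ => Complex.exp (s * u) * (E1 m u : ℂ)) := by
  apply Integrable.of_integral_ne_zero
  rw [I1 hm hs]; exact gt1_ne hm hs

def Gt (K : Type*) [Field K] [NumberField K] (s : ℂ) : ℂ := ∏ w : InfinitePlace K, gt1 w.mult s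

lemma Gt_ne {s : ℂ} (hs : 0 < s.re) : Gt K s ≠ 0 := Finset.prod_ne_zero_iff.mpr fun w _ => gt1_ne (mult_pos' w) hs

lemma pint {s : ℂ} (hs : 0 < s.re) : Integrable (fun u : InfinitePlace K → ℝ =>
    Complex.exp (s * (∑ w, u w : ℝ)) * ((∏ w, E1 w.mult (u w) : ℝ) : ℂ)) ∧
    ∫ u : InfinitePlace K → ℝ, Complex.exp (s * (∑ w, u w : ℝ)) * ((∏ w, E1 w.mult (u w) : ℝ) : ℂ) = Gt K s := by
  have h : ∀ u : InfinitePlace K → ℝ, Complex.exp (s * (∑ w, u w : ℝ)) * ((∏ w, E1 w.mult (u w) : ℝ) : ℂ) =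
      ∏ w, (Complex.exp (s * u w) * (E1 w.mult (u w) : ℂ)) := by
    intro u; push_cast; rw [Finset.mul_sum, Complex.exp_sum, Finset.prod_mul_distrib]
  simp_rw [h]
  constructor
  · exact Integrable.fintype_prod (f := fun (w : InfinitePlace K) (u : ℝ) => Complex.exp (s * u) * (E1 w.mult u : ℂ))
      (fun w => I1_int (mult_pos' w) hs)
  · rw [integral_fintype_prod_volume_eq_prod (f := fun (w : InfinitePlace K) (u : ℝ) => Complex.exp (s * u) * (E1 w.mult u : ℂ))]
    exact Finset.prod_congr rfl fun w _ => I1 (mult_pos' w) hs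

def BB (K : Type*) [Field K] [NumberField K] (σ : ℝ) : ENNReal := ∫⁻ T : ℝ, ENNReal.ofReal (rexp (σ * T)) * GG K (rexp T)

lemma BB_fin {σ : ℝ} (hσ : 0 < σ) : BB K σ ≠ ⊤ := by
  rw [BB, GG_push (fun T => ENNReal.ofReal (rexp (σ * T))) (by fun_prop)]
  have h := (pint (K := K) (s := (σ : ℂ)) (by simpa using hσ)).1.norm.lintegral_lt_top
  refine ne_of_lt (lt_of_eq_of_lt (lintegral_congr fun u => ?_) h)
  have hp : 0 ≤ ∏ w : InfinitePlace K, E1 w.mult (u w) := Finset.prod_nonneg fun _ _ => (exp_pos _).le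
  rw [← ENNReal.ofReal_prod_of_nonneg (fun _ _ => E1_nonneg _ _), ← ENNReal.ofReal_mul (exp_pos _).le]
  congr 1
  rw [norm_mul, Complex.norm_exp, Complex.norm_real, norm_of_nonneg hp]
  congr 2
  rw [← Complex.ofReal_mul, Complex.ofReal_re]

lemma GG_anti {a b : ℝ} (ha : 0 < a) (hab : a ≤ b) : GG K b ≤ GG K a := by
  refine lintegral_mono fun v => ENNReal.ofReal_le_ofReal (exp_le_exp.mpr ?_)
  rw [neg_mul, neg_mul, neg_le_neg_iff]
  refine mul_le_mul_of_nonneg_left ?_ pi_pos.le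
  unfold nq yv
  refine Finset.sum_le_sum fun w _ => ?_
  gcongr

lemma GG_bound {σ τ : ℝ} (hσ : 0 < σ) (hτ : 0 < τ) : GG K τ * ENNReal.ofReal (τ ^ σ / σ) ≤ BB K σ := by
  have h1 : ∫⁻ T in Iic (log τ), ENNReal.ofReal (rexp (σ * T)) = ENNReal.ofReal (τ ^ σ / σ) := by
    rw [← ofReal_integral_eq_lintegral_ofReal (integrableOn_exp_mul_Iic hσ _) (ae_of_all _ fun _ => (exp_pos _).le),
      integral_exp_mul_Iic hσ, rpow_def_of_pos hτ]
    ring_nf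
  rw [← h1, ← lintegral_const_mul _ (by fun_prop)]
  refine le_trans ?_ (setLIntegral_le_lintegral (Iic (log τ)) _)
  refine setLIntegral_mono' measurableSet_Iic fun T hT => ?_
  rw [mul_comm]
  gcongr
  exact GG_anti (exp_pos _) (by rw [← exp_log hτ]; exact exp_le_exp.mpr hT)

lemma GG_fin {τ : ℝ} (hτ : 0 < τ) : GG K τ ≠ ⊤ := by
  intro h
  have := GG_bound (K := K) one_pos hτ
  rw [h, ENNReal.top_mul (by simp; positivity), top_le_iff] at this
  exact BB_fin one_pos this

lemma GG_meas : Measurable (fun T => GG K (rexp T)) := by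
  apply Antitone.measurable
  intro a b hab
  exact GG_anti (exp_pos _) (exp_le_exp.mpr hab)

lemma G_mellin {s : ℂ} (hs : 0 < s.re) : HasMellin (fun t => ((GG K t).toReal : ℂ)) s (Gt K s) := by
  rw [HasMellin, mellinConv_log, mellin_log]
  have hm2 : Measurable (fun u : InfinitePlace K → ℝ => ∏ w, ENNReal.ofReal (E1 w.mult (u w))) := by
    refine Finset.measurable_prod _ fun w _ => ?_
    exact ((E1_cont _).measurable.comp (measurable_pi_apply w)).ennreal_ofReal
  have hS : Measurable (fun u : InfinitePlace K → ℝ => ∑ w, u w) := by fun_prop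
  have key : (volume : Measure ℝ).withDensity (fun T => GG K (rexp T)) =
      ((volume : Measure (InfinitePlace K → ℝ)).withDensity (fun u => ∏ w, ENNReal.ofReal (E1 w.mult (u w)))).map
        (fun u => ∑ w, u w) := by
    ext S hS'
    rw [Measure.map_apply hS hS', withDensity_apply _ hS', withDensity_apply _ (hS hS')]
    have := GG_push (K := K) (S.indicator 1) (measurable_one.indicator hS')
    rw [← lintegral_indicator hS', ← lintegral_indicator (hS hS')]
    convert! this using 2
    · ext T
      by_cases h : T ∈ S <;> simp [h]
    · ext u
      by_cases h : ∑ w, u w ∈ S <;> simp [h]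
  have hp : ∀ u : InfinitePlace K → ℝ, (∏ w, ENNReal.ofReal (E1 w.mult (u w))).toReal = ∏ w, E1 w.mult (u w) := by
    intro u
    rw [← ENNReal.ofReal_prod_of_nonneg (fun _ _ => E1_nonneg _ _), ENNReal.toReal_ofReal]
    exact Finset.prod_nonneg fun _ _ => (exp_pos _).le
  have hf1 : ∀ᵐ T : ℝ, GG K (rexp T) < ⊤ := ae_of_all _ fun T => (GG_fin (exp_pos _)).lt_top
  have hf2 : ∀ᵐ u : InfinitePlace K → ℝ, ∏ w, ENNReal.ofReal (E1 w.mult (u w)) < ⊤ :=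
    ae_of_all _ fun u => ENNReal.prod_lt_top fun _ _ => ENNReal.ofReal_lt_top
  have hc : Continuous (fun T : ℝ => Complex.exp (s * T)) := by fun_prop
  obtain ⟨p1, p2⟩ := pint (K := K) hs
  constructor
  · have := (integrable_withDensity_iff_integrable_smul' (g := fun T : ℝ => Complex.exp (s * T)) GG_meas hf1)
    rw [key, integrable_map_measure hc.aestronglyMeasurable hS.aemeasurable,
      integrable_withDensity_iff_integrable_smul' hm2 hf2] at this
    convert! this.mp ?_ using 2 with T
    · rw [Complex.real_smul, mul_comm]
    · convert! p1 using 2 with u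
      rw [hp, Complex.real_smul, mul_comm, Function.comp]
  · have := integral_withDensity_eq_integral_toReal_smul GG_meas hf1 (fun T : ℝ => Complex.exp (s * T))
    rw [key, integral_map hS.aemeasurable hc.aestronglyMeasurable,
      integral_withDensity_eq_integral_toReal_smul hm2 hf2] at this
    rw [← p2]
    convert! this.symm using 2
    · ext T; rw [Complex.real_smul, mul_comm]
    · ext u; rw [hp, Complex.real_smul, mul_comm]
end MRH

namespace MRH
open MeasureTheory Real NumberField Module Set Filter Topology Asymptotics
variable {K : Type*} [Field K] [NumberField K]

abbrev II (K : Type*) [Field K] [NumberField K] := {I : Ideal (𝓞 K) // I ≠ ⊥}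

lemma II_pos (I : II K) : 0 < Ideal.absNorm I.1 := by
  rw [Nat.pos_iff_ne_zero, Ne, Ideal.absNorm_eq_zero_iff]; exact I.2

lemma II_pos' (I : II K) : (0:ℝ) < Ideal.absNorm I.1 := by exact_mod_cast II_pos I

lemma cnt_summable {s : ℂ} (hs : 1 < s.re) :
    LSeriesSummable (fun n => ((Nat.card {I : Ideal (𝓞 K) // Ideal.absNorm I = n} : ℝ) : ℂ)) s := by
  refine LSeriesSummable_of_sum_norm_bigO_and_nonneg (r := 1) (f := fun n => (Nat.card {I : Ideal (𝓞 K) // Ideal.absNorm I = n} : ℝ)) ?_ (fun _ => Nat.cast_nonneg _) zero_le_one hs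
  have h : Tendsto (fun n : ℕ => (∑ k ∈ Finset.Icc 1 n, (Nat.card {I : Ideal (𝓞 K) // Ideal.absNorm I = k} : ℝ)) / n) atTop
      (𝓝 (dedekindZeta_residue K)) := by
    refine ((NumberField.Ideal.tendsto_norm_le_div_atTop₀ K).comp tendsto_natCast_atTop_atTop).congr fun n ↦ ?_
    simp only [Function.comp_apply, Nat.cast_le, ← Nat.cast_sum]
    congr
    rw [← add_left_inj 1, ← Ideal.card_norm_le_eq_card_norm_le_add_one,
      show Finset.Icc 1 n = Finset.Ioc 0 n from Finset.Icc_succ_left_eq_Ioc _ _,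
      show 1 = Nat.card {I : Ideal (𝓞 K) // Ideal.absNorm I = 0} by simp [Ideal.absNorm_eq_zero_iff],
      Finset.sum_Ioc_add_eq_sum_Icc (n.zero_le),
      ← Finset.card_preimage_eq_sum_card_image_eq (fun k _ ↦ Ideal.finite_setOfPred_absNorm_eq k)]
    simp [Set.coe_eq_subtype]
  simp only [rpow_one]
  refine isBigO_of_div_tendsto_nhds ?_ _ h
  filter_upwards [eventually_gt_atTop 0] with n hn h0
  exact absurd h0 (by positivity)

lemma sum_II (h : ℕ → ENNReal) : ∑' I : II K, h (Ideal.absNorm I.1) =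
    ∑' n : ℕ, if n = 0 then 0 else (Nat.card {I : Ideal (𝓞 K) // Ideal.absNorm I = n} : ENNReal) * h n := by
  rw [← (Equiv.sigmaFiberEquiv (fun I : II K => Ideal.absNorm I.1)).tsum_eq, ENNReal.tsum_sigma']
  refine tsum_congr fun n => ?_
  have h1 : ∀ x : {I : II K // Ideal.absNorm I.1 = n}, h (Ideal.absNorm ((Equiv.sigmaFiberEquiv (fun I : II K => Ideal.absNorm I.1)) ⟨n, x⟩).1) = h n := by
    intro x; exact congrArg h x.2
  simp_rw [h1]
  split_ifs with hn
  · rw [ENNReal.tsum_eq_zero]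
    intro x
    exact absurd (x.2.trans hn) (II_pos x.1).ne'
  · have : Finite {I : Ideal (𝓞 K) // Ideal.absNorm I = n} := Ideal.finite_setOfPred_absNorm_eq n
    let e : {I : II K // Ideal.absNorm I.1 = n} ≃ {I : Ideal (𝓞 K) // Ideal.absNorm I = n} :=
      ⟨fun x => ⟨x.1.1, x.2⟩, fun x => ⟨⟨x.1, fun h => hn (by rw [← x.2, h]; simp)⟩, x.2⟩, fun _ => rfl, fun _ => rfl⟩
    rw [ENNReal.tsum_const, ENat.card_congr e, ENat.card_eq_coe_natCard]
    simp

lemma zsum {σ : ℝ} (hσ : 1 < σ) : Summable (fun I : II K => (Ideal.absNorm I.1 : ℝ) ^ (-σ)) := by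
  have h1 := (cnt_summable (K := K) (s := (σ:ℂ)) (by simpa using hσ)).norm
  have h2 : ∑' I : II K, ENNReal.ofReal ((Ideal.absNorm I.1 : ℝ) ^ (-σ)) ≠ ⊤ := by
    rw [sum_II (fun n => ENNReal.ofReal ((n : ℝ) ^ (-σ)))]
    convert! h1.tsum_ofReal_ne_top using 3 with n
    split_ifs with h
    · simp [h]
    · rw [LSeries.norm_term_eq, if_neg h, ← ENNReal.ofReal_natCast, ← ENNReal.ofReal_mul (by positivity), Complex.norm_real,
        Complex.ofReal_re, norm_of_nonneg (by positivity), rpow_neg (by positivity)]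
      rfl
  refine (ENNReal.summable_toReal h2).congr fun I => ?_
  rw [ENNReal.toReal_ofReal (by positivity)]

instance : Countable (II K) := by
  have h := (zsum (K := K) (σ := 2) (by norm_num)).countable_support
  have : Function.support (fun I : II K => (Ideal.absNorm I.1 : ℝ) ^ (-2:ℝ)) = Set.univ := by
    ext I; exact iff_of_true (rpow_pos_of_pos (II_pos' I) _).ne' trivial
  rw [this] at h
  exact Set.countable_univ_iff.mp h

def SG (K : Type*) [Field K] [NumberField K] (τ : ℝ) : ENNReal := ∑' I : II K, GG K (τ * Ideal.absNorm I.1)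

lemma SG_bound {σ : ℝ} (hσ : 1 < σ) : ∃ B : ℝ, 0 ≤ B ∧ ∀ τ > 0, SG K τ ≤ ENNReal.ofReal (B * τ ^ (-σ)) := by
  have hσ0 : 0 < σ := by linarith
  have hG : ∀ τ > 0, GG K τ ≤ ENNReal.ofReal ((BB K σ).toReal * σ * τ ^ (-σ)) := by
    intro τ hτ
    have h := GG_bound (K := K) hσ0 hτ
    have h0 : 0 < τ ^ σ / σ := by positivity
    rw [← ENNReal.le_div_iff_mul_le (by left; simpa using h0) (by left; simp)] at h
    refine h.trans (le_of_eq ?_)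
    rw [mul_assoc, ENNReal.ofReal_mul (by positivity), ENNReal.ofReal_toReal (BB_fin hσ0), div_eq_mul_inv,
      ← ENNReal.ofReal_inv_of_pos h0, rpow_neg hτ.le]
    congr 2; field_simp
  refine ⟨(BB K σ).toReal * σ * ∑' I : II K, (Ideal.absNorm I.1 : ℝ) ^ (-σ), by positivity, fun τ hτ => ?_⟩
  calc SG K τ ≤ ∑' I : II K, ENNReal.ofReal ((BB K σ).toReal * σ * τ ^ (-σ) * (Ideal.absNorm I.1 : ℝ) ^ (-σ)) := by
        refine ENNReal.tsum_le_tsum fun I => (hG _ (mul_pos hτ (II_pos' I))).trans (le_of_eq ?_)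
        rw [mul_rpow hτ.le (by positivity)]; ring_nf
    _ = _ := by
        rw [← ENNReal.ofReal_tsum_of_nonneg (fun I => by positivity) ((zsum hσ).mul_left _), tsum_mul_left]
        ring_nf

lemma SG_fin {τ : ℝ} (hτ : 0 < τ) : SG K τ ≠ ⊤ := by
  obtain ⟨B, -, h⟩ := SG_bound (K := K) (σ := 2) (by norm_num)
  exact ne_top_of_le_ne_top ENNReal.ofReal_ne_top (h τ hτ)

lemma SG_anti {a b : ℝ} (ha : 0 < a) (hab : a ≤ b) : SG K b ≤ SG K a :=
  ENNReal.tsum_le_tsum fun I => GG_anti (mul_pos ha (II_pos' I)) (by gcongr)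

def zs (K : Type*) [Field K] [NumberField K] (s : ℂ) : ℂ := ∑' I : II K, (Ideal.absNorm I.1 : ℂ) ^ (-s)

lemma SG_mellin {s : ℂ} (hs : 1 < s.re) : mellin (fun t => ((SG K t).toReal : ℂ)) s = Gt K s * zs K s := by
  have hs0 : 0 < s.re := by linarith
  have h1 : ∀ I : II K, HasMellin (fun t => ((GG K (t * Ideal.absNorm I.1)).toReal : ℂ)) s
      ((Ideal.absNorm I.1 : ℂ) ^ (-s) * Gt K s) := by
    intro I
    have := G_mellin (K := K) hs0
    have hc := (MellinConvergent.comp_mul_left (f := fun t => ((GG K t).toReal : ℂ)) (s := s) (II_pos' I)).mpr this.1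
    have he := mellin_comp_mul_left (fun t => ((GG K t).toReal : ℂ)) s (II_pos' I)
    rw [this.2] at he
    simp_rw [mul_comm _ (Ideal.absNorm I.1 : ℝ)]
    exact ⟨hc, by rw [he, smul_eq_mul]; norm_cast⟩
  have h_int : ∀ I : II K, ∫ t in Ioi (0:ℝ), ‖(t:ℂ) ^ (s-1) • ((GG K (t * Ideal.absNorm I.1)).toReal : ℂ)‖ =
      (Ideal.absNorm I.1 : ℝ) ^ (-s.re) * ∫ t in Ioi (0:ℝ), t ^ (s.re - 1) * (GG K t).toReal := by
    intro I
    have hc := II_pos' I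
    have h2 : ∀ t ∈ Ioi (0:ℝ), ‖(t:ℂ) ^ (s-1) • ((GG K (t * Ideal.absNorm I.1)).toReal : ℂ)‖ =
      (Ideal.absNorm I.1 : ℝ) ^ (1-s.re) * (((Ideal.absNorm I.1 : ℝ) * t) ^ (s.re - 1) * (GG K (Ideal.absNorm I.1 * t)).toReal) := by
      intro t ht
      rw [norm_smul, Complex.norm_cpow_eq_rpow_re_of_pos ht, Complex.norm_real, norm_of_nonneg (by positivity),
        mul_rpow hc.le (le_of_lt ht), mul_comm t, ← mul_assoc, ← mul_assoc, ← rpow_add hc]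
      simp
    rw [setIntegral_congr_fun measurableSet_Ioi h2, integral_const_mul,
      integral_comp_mul_left_Ioi (fun t => t ^ (s.re - 1) * (GG K t).toReal) 0 hc, mul_zero, smul_eq_mul, ← mul_assoc,
      ← rpow_neg_one, ← rpow_add hc]
    congr 2; ring
  have hsum := hasSum_integral_of_summable_integral_norm (F := fun (I : II K) (t : ℝ) => (t:ℂ) ^ (s-1) • ((GG K (t * Ideal.absNorm I.1)).toReal : ℂ))
    (μ := volume.restrict (Ioi 0)) (fun I => (h1 I).1) (by
      simp_rw [h_int]; exact (zsum hs).mul_right _)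
  have h3 : ∀ t ∈ Ioi (0:ℝ), ∑' I : II K, (t:ℂ) ^ (s-1) • ((GG K (t * Ideal.absNorm I.1)).toReal : ℂ) =
      (t:ℂ) ^ (s-1) • ((SG K t).toReal : ℂ) := by
    intro t ht
    simp_rw [smul_eq_mul]
    rw [tsum_mul_left, ← Complex.ofReal_tsum, SG, ENNReal.tsum_toReal_eq]
    exact fun I => GG_fin (mul_pos ht (II_pos' I))
  rw [setIntegral_congr_fun measurableSet_Ioi h3] at hsum
  rw [mellin, ← hsum.tsum_eq, zs, ← tsum_mul_left]
  refine tsum_congr fun I => ?_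
  rw [mul_comm]; exact (h1 I).2
end MRH

namespace MRH
open MeasureTheory Real NumberField Module Set Filter Topology Asymptotics NumberField.Units
variable {K : Type*} [Field K] [NumberField K]

def DD (K : Type*) [Field K] [NumberField K] : ℝ := |(discr K : ℝ)|
lemma DD_pos : 0 < DD K := by simp [DD, discr_ne_zero]
lemma DD_one : 1 ≤ DD K := by
  have h : 1 ≤ |discr K| := Int.one_le_abs (discr_ne_zero K)
  rw [DD]; exact_mod_cast h

def FF (K : Type*) [Field K] [NumberField K] (t : ℝ) : ℝ := torsionOrder K * (SG K (t / √(DD K))).toReal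

lemma FF_nonneg (t : ℝ) : 0 ≤ FF K t := by rw [FF]; positivity

lemma sD_pos : 0 < √(DD K) := sqrt_pos.mpr DD_pos

lemma FF_exists (K : Type*) [Field K] [NumberField K] : ∃ κ : ℝ, 0 < κ ∧ ∀ x > 0, κ + FF K (1/x) = x * (κ + FF K x) := by
  obtain ⟨V, hV0, hV, h⟩ := ff_exists K
  refine ⟨(Fintype.card (ClassGroup (𝓞 K)) * V).toReal, ?_, fun x hx => ?_⟩
  · refine ENNReal.toReal_pos (mul_ne_zero ?_ hV0) (ENNReal.mul_ne_top (by simp) hV)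
    simp [Fintype.card_ne_zero]
  have key : ∀ y > 0, (ff K V (y / √(DD K))).toReal = (Fintype.card (ClassGroup (𝓞 K)) * V).toReal + FF K y := by
    intro y hy
    have := SG_fin (K := K) (div_pos hy (sD_pos (K := K)))
    rw [ff, ENNReal.toReal_add (ENNReal.mul_ne_top (by simp) hV)
      (ENNReal.mul_ne_top (by simp) (by exact this)), FF]
    congr 1
    rw [ENNReal.toReal_mul]; simp [SG]
  have h1 := h (x / √(DD K)) (div_pos hx sD_pos)
  have hs : √|(discr K : ℝ)| = √(DD K) := rfl
  have e1 : √|(discr K : ℝ)| * (x / √(DD K)) = x := by rw [hs]; field_simp [sD_pos.ne']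
  have e2 : (|(discr K : ℝ)| * (x / √(DD K)))⁻¹ = (1 / x) / √(DD K) := by
    rw [show |(discr K : ℝ)| = √(DD K) * √(DD K) from (mul_self_sqrt DD_pos.le).symm]
    have := (sD_pos (K := K)).ne'
    field_simp
  rw [e1, e2] at h1
  have h2 := congrArg ENNReal.toReal h1
  rw [ENNReal.toReal_mul, key x hx, key _ (by positivity), ENNReal.toReal_ofReal (by positivity)] at h2
  rw [h2]; field_simp

lemma FF_anti : AntitoneOn (FF K) (Ioi 0) := by
  intro a ha b hb hab
  have h1 : 0 < a / √(DD K) := div_pos ha sD_pos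
  rw [FF, FF]
  gcongr
  · exact SG_fin h1
  · exact SG_anti h1 (by gcongr)

lemma FF_bigO (r : ℝ) : (fun t => ((FF K t : ℝ) : ℂ)) =O[atTop] (fun t : ℝ => t ^ r) := by
  obtain ⟨B, hB, h⟩ := SG_bound (K := K) (σ := 2 + |r|) (by have := abs_nonneg r; linarith)
  refine IsBigO.of_bound (torsionOrder K * (B * (√(DD K)) ^ (2 + |r|))) ?_
  filter_upwards [eventually_ge_atTop 1] with t ht
  have ht0 : 0 < t := by linarith
  have h1 := ENNReal.toReal_le_of_le_ofReal (by positivity) (h _ (div_pos ht0 (sD_pos (K := K))))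
  rw [Complex.norm_real, norm_of_nonneg (FF_nonneg t), norm_of_nonneg (by positivity), FF, mul_assoc]
  gcongr
  refine h1.trans ?_
  rw [div_rpow ht0.le sD_pos.le, rpow_neg sD_pos.le, div_inv_eq_mul, mul_comm (t ^ _), mul_assoc]
  gcongr
  have := neg_abs_le r
  linarith

def FP (κ : ℝ) (h : ∀ x > 0, κ + FF K (1/x) = x * (κ + FF K x)) : WeakFEPair ℂ :=
  have hi : LocallyIntegrableOn (fun t => ((κ + FF K t : ℝ) : ℂ)) (Ioi 0) := by
    rw [locallyIntegrableOn_iff isOpen_Ioi.isLocallyClosed]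
    intro k hk hkc
    refine Integrable.ofReal ?_
    exact AntitoneOn.integrableOn_isCompact hkc (fun a ha b hb hab => by
      exact add_le_add le_rfl (FF_anti (hk ha) (hk hb) hab))
  have ht : ∀ r : ℝ, ((fun t => ((κ + FF K t : ℝ) : ℂ)) · - (κ:ℂ)) =O[atTop] (fun t : ℝ => t ^ r) := fun r => by
    refine (FF_bigO (K := K) r).congr_left fun t => ?_
    push_cast; ring
  { f := fun t => ((κ + FF K t : ℝ) : ℂ)
    g := fun t => ((κ + FF K t : ℝ) : ℂ)
    k := 1
    ε := 1
    f₀ := κ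
    g₀ := κ
    hf_int := hi
    hg_int := hi
    hk := one_pos
    hε := one_ne_zero
    h_feq := fun x hx => by
      rw [h x hx]; simp
    hf_top := ht
    hg_top := ht }

def fm (K : Type*) [Field K] [NumberField K] (t : ℝ) : ℝ := if 1 < t then FF K t else if 0 < t ∧ t < 1 then t⁻¹ * FF K (1/t) else 0

lemma fm_nonneg (t : ℝ) : 0 ≤ fm K t := by
  rw [fm]; split_ifs with h h
  · exact FF_nonneg _
  · exact mul_nonneg (inv_nonneg.mpr h.1.le) (FF_nonneg _)
  · rfl

lemma FP_modif (κ : ℝ) (h : ∀ x > 0, κ + FF K (1/x) = x * (κ + FF K x)) : (FP κ h).f_modif = fun t => (fm K t : ℂ) := by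
  funext t
  rw [WeakFEPair.f_modif, Pi.add_apply, fm]
  by_cases h1 : 1 < t
  · rw [indicator_of_mem (mem_Ioi.mpr h1), indicator_of_notMem (notMem_Ioo_of_ge h1.le), if_pos h1]
    simp [FP]
  · rw [indicator_of_notMem (by simpa using h1), if_neg h1]
    by_cases h2 : 0 < t ∧ t < 1
    · rw [indicator_of_mem (show t ∈ Ioo (0:ℝ) 1 from h2), if_pos h2]
      have := h t h2.1
      have e : FF K t = t⁻¹ * (κ + FF K (1/t)) - κ := by rw [this]; have := h2.1.ne'; field_simp; ring
      simp only [FP, e, zero_add, one_mul, rpow_neg_one, smul_eq_mul]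
      push_cast; ring
    · rw [indicator_of_notMem (show t ∉ Ioo (0:ℝ) 1 from h2), if_neg h2]; simp

lemma Lam_exists (K : Type*) [Field K] [NumberField K] : ∃ (L : ℂ → ℂ) (κ : ℝ), 0 < κ ∧ Differentiable ℂ L ∧
    (∀ s : ℂ, 1 < s.re → torsionOrder K * (√(DD K) : ℂ) ^ s * Gt K s * zs K s = L s - κ / s - κ / (1 - s)) ∧
    (∀ s : ℂ, -3 ≤ s.re → s.re ≤ 4 → ‖L s‖ ≤ 2 * ‖torsionOrder K * (√(DD K) : ℂ) ^ (4:ℂ) * Gt K 4 * zs K 4‖) ∧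
    κ ≤ 12 * ‖torsionOrder K * (√(DD K) : ℂ) ^ (4:ℂ) * Gt K 4 * zs K 4‖ := by
  obtain ⟨κ, hκ, h⟩ := FF_exists K
  have hL : ∀ s : ℂ, 1 < s.re → torsionOrder K * (√(DD K) : ℂ) ^ s * Gt K s * zs K s = (FP κ h).Λ₀ s - κ / s - κ / (1 - s) := by
    intro s hs
    have h1 := ((FP κ h).hasMellin (s := s) hs).2
    have h2 : (fun t => (FP κ h).f t - (FP κ h).f₀) = fun t => (torsionOrder K : ℂ) • ((fun t => ((SG K t).toReal : ℂ)) ((√(DD K))⁻¹ * t)) := by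
      funext t; simp [FP, FF, div_eq_inv_mul]
    rw [h2, mellin_const_smul, mellin_comp_mul_left (fun t => ((SG K t).toReal : ℂ)) s (inv_pos.mpr sD_pos), SG_mellin hs] at h1
    rw [WeakFEPair.Λ] at h1
    simp only [FP, smul_eq_mul] at h1 ⊢
    have e : (((√(DD K))⁻¹ : ℝ) : ℂ) ^ (-s) = (√(DD K) : ℂ) ^ s := by
      rw [Complex.ofReal_inv, Complex.inv_cpow, Complex.cpow_neg, inv_inv]
      rw [Complex.arg_ofReal_of_nonneg (sqrt_nonneg _)]; exact pi_pos.ne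
    rw [e] at h1
    rw [mul_assoc, mul_assoc, h1]
    push_cast; ring
  have h_int : ∀ σ : ℝ, IntegrableOn (fun t => t ^ (σ - 1) * fm K t) (Ioi 0) := by
    intro σ
    have := ((FP κ h).isStrongFEPair_toStrongFEPair.hasMellin σ).1
    have h3 := Integrable.norm this
    refine IntegrableOn.congr_fun h3 (fun t ht => ?_) measurableSet_Ioi
    have e : (FP κ h).toStrongFEPair.f = fun t => (fm K t : ℂ) := FP_modif κ h
    simp only [e]
    rw [norm_smul, Complex.norm_cpow_eq_rpow_re_of_pos ht, Complex.norm_real, norm_of_nonneg (fm_nonneg t)]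
    simp
  have hre : ∀ σ : ℝ, (FP κ h).Λ₀ σ = ((∫ t in Ioi (0:ℝ), t ^ (σ - 1) * fm K t : ℝ) : ℂ) := by
    intro σ
    rw [WeakFEPair.Λ₀, mellin, FP_modif, ← integral_complex_ofReal]
    refine setIntegral_congr_fun measurableSet_Ioi fun t ht => ?_
    simp only [smul_eq_mul]
    push_cast
    rw [Complex.ofReal_cpow (le_of_lt ht)]; push_cast; rfl
  have hpos : ∀ σ : ℝ, 0 ≤ ∫ t in Ioi (0:ℝ), t ^ (σ - 1) * fm K t := fun σ =>
    setIntegral_nonneg measurableSet_Ioi fun t ht => mul_nonneg (rpow_nonneg (le_of_lt ht) _) (fm_nonneg t)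
  have hsym : (FP κ h).Λ₀ (-3 : ℝ) = (FP κ h).Λ₀ (4 : ℝ) := by
    have h4 := (FP κ h).functional_equation₀ 4
    have e : (FP κ h).symm = FP κ h := by simp [WeakFEPair.symm, FP]
    rw [e] at h4
    simp only [FP, one_smul] at h4 ⊢
    convert! h4 using 2
    push_cast; norm_num
  have h4 : (∫ t in Ioi (0:ℝ), t ^ ((4:ℝ) - 1) * fm K t) + κ / 12 = ‖torsionOrder K * (√(DD K) : ℂ) ^ (4:ℂ) * Gt K 4 * zs K 4‖ := by
    have h5 := hL 4 (by norm_num)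
    have h6 := hre 4
    push_cast at h6
    rw [h5, h6]
    rw [show (((∫ t in Ioi (0:ℝ), t ^ ((4:ℝ) - 1) * fm K t : ℝ) : ℂ) - κ / 4 - κ / (1 - 4)) = (((∫ t in Ioi (0:ℝ), t ^ ((4:ℝ) - 1) * fm K t) + κ / 12 : ℝ) : ℂ) by push_cast; ring]
    rw [Complex.norm_real, norm_of_nonneg (by have := hpos 4; positivity)]
  have hs4 : ∫ t in Ioi (0:ℝ), t ^ ((-3:ℝ) - 1) * fm K t = ∫ t in Ioi (0:ℝ), t ^ ((4:ℝ) - 1) * fm K t := by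
    rw [hre, hre] at hsym; exact_mod_cast hsym
  have hp4 := hpos 4
  generalize hJ : ∫ t in Ioi (0:ℝ), t ^ ((4:ℝ) - 1) * fm K t = J at h4 hs4 hp4
  refine ⟨(FP κ h).Λ₀, κ, hκ, (FP κ h).differentiable_Λ₀, hL, fun s hs1 hs2 => ?_, ?_⟩
  · have h7 : ‖(FP κ h).Λ₀ s‖ ≤ ∫ t in Ioi (0:ℝ), t ^ (s.re - 1) * fm K t := by
      rw [WeakFEPair.Λ₀, mellin, FP_modif]
      refine (norm_integral_le_integral_norm _).trans (le_of_eq ?_)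
      refine setIntegral_congr_fun measurableSet_Ioi fun t ht => ?_
      simp only
      rw [norm_smul, Complex.norm_cpow_eq_rpow_re_of_pos ht, Complex.norm_real, norm_of_nonneg (fm_nonneg t)]
      simp
    have h8 : ∫ t in Ioi (0:ℝ), t ^ (s.re - 1) * fm K t ≤ ∫ t in Ioi (0:ℝ), (t ^ ((4:ℝ) - 1) * fm K t + t ^ ((-3:ℝ) - 1) * fm K t) := by
      refine setIntegral_mono_on (h_int _) ((h_int _).add (h_int _)) measurableSet_Ioi fun t ht => ?_
      rw [← add_mul]
      refine mul_le_mul_of_nonneg_right ?_ (fm_nonneg t)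
      have ht : 0 < t := ht
      rcases le_total 1 t with h1 | h1
      · have := rpow_le_rpow_of_exponent_le h1 (show s.re - 1 ≤ 4 - 1 by linarith)
        have := rpow_nonneg ht.le ((-3:ℝ)-1); linarith
      · have := rpow_le_rpow_of_exponent_ge ht h1 (show (-3) - 1 ≤ s.re - 1 by linarith)
        have := rpow_nonneg ht.le ((4:ℝ)-1); linarith
    rw [integral_add (h_int _) (h_int _), hs4, hJ] at h8
    linarith
  · linarith
end MRH

namespace MRH
open MeasureTheory Real NumberField Module Set Filter Topology Asymptotics NumberField.Units

lemma norm_Gamma_le' {z : ℂ} (hz : 0 < z.re) : ‖Complex.Gamma z‖ ≤ Real.Gamma z.re := by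
  rw [Complex.Gamma_eq_integral hz, Complex.GammaIntegral, Real.Gamma_eq_integral hz]
  refine (norm_integral_le_integral_norm _).trans (le_of_eq ?_)
  refine setIntegral_congr_fun measurableSet_Ioi fun t ht => ?_
  simp only [norm_mul, Complex.norm_cpow_eq_rpow_re_of_pos ht, Complex.norm_real, norm_of_nonneg (exp_pos _).le]
  simp

lemma norm_sin_le (w : ℂ) : ‖Complex.sin w‖ ≤ 2 * ‖w‖ * rexp (2 * ‖w‖) * rexp ‖w‖ := by
  have h0 : ∀ u : ℂ, ‖Complex.exp u - 1‖ ≤ ‖u‖ * rexp ‖u‖ := fun u => by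
    simpa using Complex.norm_exp_sub_sum_le_norm_mul_exp u 1
  have h1 : Complex.sin w = Complex.exp (-w * Complex.I) * (1 - Complex.exp (2 * w * Complex.I)) * Complex.I / 2 := by
    rw [Complex.sin, mul_sub, ← Complex.exp_add]; ring_nf
  rw [h1]
  have h2 := h0 (2 * w * Complex.I)
  have h3 : ‖Complex.exp (-w * Complex.I)‖ ≤ rexp ‖w‖ := by
    refine (Complex.norm_exp_le_exp_norm _).trans (by simp)
  rw [norm_div, norm_mul, norm_mul, norm_sub_rev]
  simp only [norm_mul, Complex.norm_I, mul_one, Complex.norm_ofNat] at h2 ⊢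
  have := norm_nonneg (Complex.exp (2 * w * Complex.I) - 1)
  have h5 : ‖Complex.exp (-w * Complex.I)‖ * ‖Complex.exp (2 * w * Complex.I) - 1‖ ≤ rexp ‖w‖ * (2 * ‖w‖ * rexp (2 * ‖w‖)) := by
    gcongr
  have h6 : 0 ≤ ‖Complex.exp (-w * Complex.I)‖ * ‖Complex.exp (2 * w * Complex.I) - 1‖ := by positivity
  linarith

lemma norm_le_re_im (z : ℂ) {a : ℝ} (h : |z.re| ≤ a) : ‖z‖ ≤ a + |z.im| :=
  (Complex.norm_le_abs_re_add_abs_im z).trans (by linarith)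

lemma inv_Gamma_base : ∃ B : ℝ, 1 ≤ B ∧ ∀ z : ℂ, 1/4 ≤ z.re → z.re ≤ 5/4 → ‖(Complex.Gamma z)⁻¹‖ ≤ B * rexp (3 * π * (1 + |z.im|)) := by
  have hcont : ContinuousOn Real.Gamma (Icc (3/4) (7/4)) := fun x hx =>
    (Real.differentiableAt_Gamma (fun m => by
      have := hx.1; have : (0:ℝ) ≤ m := by positivity
      linarith)).continuousAt.continuousWithinAt
  obtain ⟨B, hB⟩ := isCompact_Icc.exists_bound_of_continuousOn hcont
  refine ⟨2 * |B| + 1, by have := abs_nonneg B; linarith, fun z h1 h2 => ?_⟩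
  by_cases hz : z = 1
  · rw [hz]
    simp only [Complex.Gamma_one, inv_one, norm_one, Complex.one_im, abs_zero, add_zero, mul_one]
    have := one_le_exp (x := 3 * π) (by positivity)
    have := abs_nonneg B
    nlinarith
  have hz' : 1 - z ≠ 0 := sub_ne_zero.mpr (Ne.symm hz)
  have hG : Complex.Gamma (2 - z) = (1 - z) * Complex.Gamma (1 - z) := by
    rw [← Complex.Gamma_add_one _ hz']; ring_nf
  have h3 := Complex.Gamma_mul_Gamma_one_sub z
  have hr2 : (2 - z).re = 2 - z.re := by simp
  have hg2 : Complex.Gamma (2 - z) ≠ 0 := Complex.Gamma_ne_zero_of_re_pos (by rw [hr2]; linarith)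
  have hg1 : Complex.Gamma z ≠ 0 := Complex.Gamma_ne_zero_of_re_pos (by linarith)
  have hg3 : Complex.Gamma (1 - z) ≠ 0 := fun h => hg2 (by rw [hG, h, mul_zero])
  have hpi : (π : ℂ) ≠ 0 := by exact_mod_cast pi_pos.ne'
  have hs : Complex.sin (π * z) ≠ 0 := fun h => by
    rw [h, div_zero] at h3; exact mul_ne_zero hg1 hg3 h3
  have hs' : Complex.sin (π * z) = Complex.sin (π * (1 - z)) := by
    rw [mul_sub, mul_one, Complex.sin_pi_sub]
  have h4 : (Complex.Gamma z)⁻¹ = Complex.Gamma (2 - z) * (Complex.sin (π * (1 - z)) / (π * (1 - z))) := by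
    rw [hG, ← hs']
    have : Complex.Gamma z * Complex.Gamma (1 - z) * Complex.sin (π * z) = π := by rw [h3]; field_simp
    generalize Complex.sin (π * z) = S at *
    field_simp
    linear_combination -this
  have h5 := norm_sin_le (π * (1 - z))
  have hn : ‖(π : ℂ) * (1 - z)‖ = π * ‖1 - z‖ := by rw [norm_mul, Complex.norm_real, norm_of_nonneg pi_pos.le]
  have hp : 0 < π * ‖1 - z‖ := mul_pos pi_pos (norm_pos_iff.mpr hz')
  have h6 : ‖1 - z‖ ≤ 1 + |z.im| := by
    have := norm_le_re_im (1 - z) (a := 1) (by rw [abs_le]; constructor <;> simp <;> linarith)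
    simpa using this
  have h7 : ‖Complex.Gamma (2 - z)‖ ≤ |B| := by
    refine (norm_Gamma_le' (by rw [hr2]; linarith)).trans ?_
    rw [hr2]
    refine (le_abs_self _).trans ((hB _ ⟨by linarith, by linarith⟩).trans (le_abs_self _))
  rw [h4, norm_mul, norm_div, hn]
  rw [hn] at h5
  have h8 : ‖Complex.sin (π * (1 - z))‖ / (π * ‖1 - z‖) ≤ 2 * rexp (3 * π * (1 + |z.im|)) := by
    rw [div_le_iff₀ hp]
    refine h5.trans ?_
    rw [mul_assoc, ← exp_add]
    have : rexp (2 * (π * ‖1 - z‖) + π * ‖1 - z‖) ≤ rexp (3 * π * (1 + |z.im|)) := by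
      apply exp_le_exp.mpr; nlinarith [pi_pos]
    nlinarith
  have h9 : 0 ≤ ‖Complex.sin (π * (1 - z))‖ / (π * ‖1 - z‖) := by positivity
  have := exp_pos (3 * π * (1 + |z.im|))
  calc _ ≤ |B| * (2 * rexp (3 * π * (1 + |z.im|))) := by gcongr
    _ ≤ _ := by nlinarith

lemma inv_Gamma_bound : ∃ A : ℝ, 0 < A ∧ ∀ z : ℂ, 1/4 ≤ z.re → z.re ≤ 4 → ‖(Complex.Gamma z)⁻¹‖ ≤ rexp (A * (1 + |z.im|)) := by
  obtain ⟨B, hB1, hB⟩ := inv_Gamma_base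
  have step : ∀ n : ℕ, ∀ z : ℂ, 1/4 ≤ z.re → z.re ≤ 5/4 + n → ‖(Complex.Gamma z)⁻¹‖ ≤ 4 ^ n * B * rexp (3 * π * (1 + |z.im|)) := by
    intro n
    induction n with
    | zero => intro z h1 h2; simpa using hB z h1 (by simpa using h2)
    | succ n ih =>
      intro z h1 h2
      by_cases h3 : z.re ≤ 5/4
      · refine (hB z h1 h3).trans ?_
        have : (1:ℝ) ≤ 4 ^ (n+1) := one_le_pow₀ (by norm_num)
        gcongr
        nlinarith
      push_cast at h2
      have h4 := ih (z - 1) (by simp; linarith) (by simp; linarith)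
      have hz : z - 1 ≠ 0 := fun h => by
        have : (z-1).re = 0 := by rw [h]; rfl
        simp at this; linarith
      have h5 : Complex.Gamma z = (z - 1) * Complex.Gamma (z - 1) := by
        rw [← Complex.Gamma_add_one _ hz]; ring_nf
      have h6 : 1/4 ≤ ‖z - 1‖ := le_trans (by simp; linarith) (Complex.re_le_norm (z-1))
      rw [h5, mul_inv, norm_mul, norm_inv]
      simp only [Complex.sub_im, Complex.one_im, sub_zero] at h4
      have h7 : ‖z - 1‖⁻¹ ≤ 4 := by
        rw [inv_le_comm₀ (by linarith) (by norm_num)]; linarith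
      calc _ ≤ 4 * (4 ^ n * B * rexp (3 * π * (1 + |z.im|))) := by gcongr
        _ = _ := by ring
  refine ⟨log (64 * B) + 3 * π, by have := log_pos (show 1 < 64 * B by linarith); positivity, fun z h1 h2 => ?_⟩
  refine (step 3 z h1 (by norm_num; linarith)).trans ?_
  have h8 : (4:ℝ)^3 * B = rexp (log (64 * B)) := by rw [exp_log (by positivity)]; norm_num
  rw [h8, ← exp_add]
  apply exp_le_exp.mpr
  have := log_pos (show 1 < 64 * B by linarith)
  have := abs_nonneg z.im
  nlinarith

def ig1 (m : ℝ) (s : ℂ) : ℂ := (2 / m : ℝ) * ((π * m : ℝ) : ℂ) ^ (m * s / 2) * (Complex.Gamma (m * s / 2))⁻¹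
def ih1 (m : ℝ) (s : ℂ) : ℂ := ((π * m : ℝ) : ℂ) ^ (m * s / 2) * (Complex.Gamma (m * s / 2 + 1))⁻¹

lemma ih1_mul {m : ℝ} (hm : 0 < m) (s : ℂ) : s * ih1 m s = ig1 m s := by
  rw [ih1, ig1, Complex.one_div_Gamma_eq_self_mul_one_div_Gamma_add_one (m * s / 2)]
  have : (m:ℂ) ≠ 0 := by exact_mod_cast hm.ne'
  push_cast; field_simp

lemma ig1_diff {m : ℝ} (hm : 0 < m) : Differentiable ℂ (ig1 m) := by
  have h0 : ((π * m : ℝ) : ℂ) ≠ 0 := by exact_mod_cast (show π * m ≠ 0 by positivity)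
  have h1 : Differentiable ℂ (fun s : ℂ => m * s / 2) := by fun_prop
  exact ((differentiable_const _).mul (h1.const_cpow (Or.inl h0))).mul (Complex.differentiable_one_div_Gamma.comp h1)

lemma ih1_diff {m : ℝ} (hm : 0 < m) : Differentiable ℂ (ih1 m) := by
  have h0 : ((π * m : ℝ) : ℂ) ≠ 0 := by exact_mod_cast (show π * m ≠ 0 by positivity)
  have h1 : Differentiable ℂ (fun s : ℂ => m * s / 2) := by fun_prop
  exact (h1.const_cpow (Or.inl h0)).mul (Complex.differentiable_one_div_Gamma.comp (h1.add_const 1))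

lemma gt1_ig1 {m : ℝ} (hm : 0 < m) {s : ℂ} (hs : 0 < s.re) : gt1 m s * ig1 m s = 1 := by
  have h3 : 0 < (m * s / 2 : ℂ).re := by
    have : (m * s / 2 : ℂ) = ((m / 2 : ℝ) : ℂ) * s := by push_cast; ring
    rw [this, Complex.re_ofReal_mul]; positivity
  have h4 := Complex.Gamma_ne_zero_of_re_pos h3
  have h0 : ((π * m : ℝ) : ℂ) ≠ 0 := by exact_mod_cast (show π * m ≠ 0 by positivity)
  have h5 : (1 / ((π * m : ℝ) : ℂ)) ^ (m * s / 2) = (((π * m : ℝ) : ℂ) ^ (m * s / 2))⁻¹ := by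
    rw [one_div, Complex.inv_cpow]
    rw [Complex.arg_ofReal_of_nonneg (by positivity)]; exact pi_pos.ne
  have h6 : ((π * m : ℝ) : ℂ) ^ (m * s / 2) ≠ 0 := by rw [Ne, Complex.cpow_eq_zero_iff]; exact fun h => h0 h.1
  have : (m:ℂ) ≠ 0 := by exact_mod_cast hm.ne'
  rw [gt1, ig1, h5]
  generalize ((π * m : ℝ) : ℂ) ^ (m * s / 2) = X at *
  push_cast
  field_simp

lemma ig1_bound : ∃ A : ℝ, 0 < A ∧ ∀ m : ℝ, (m = 1 ∨ m = 2) → ∀ s : ℂ, 1/2 ≤ s.re → s.re ≤ 4 →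
    ‖gt1 m 4 * ig1 m s‖ ≤ rexp (A * (1 + |s.im|)) := by
  obtain ⟨A, hA, h⟩ := inv_Gamma_bound
  set Q := (‖gt1 1 4‖ + ‖gt1 2 4‖ + 1) * (2 * (2 * π) ^ (4:ℝ)) with hQ
  have h2p : (1:ℝ) ≤ 2 * π := by linarith [pi_gt_three]
  have hQ1 : 1 ≤ Q := by
    have h1 : (1:ℝ) ≤ (2*π)^(4:ℝ) := one_le_rpow h2p (by norm_num)
    have := norm_nonneg (gt1 1 4); have := norm_nonneg (gt1 2 4)
    nlinarith [mul_nonneg (add_nonneg (norm_nonneg (gt1 1 4)) (norm_nonneg (gt1 2 4))) (by linarith : 0 ≤ (2*π)^(4:ℝ))]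
  refine ⟨log Q + A, by have := log_nonneg hQ1; linarith, fun m hm s h1 h2 => ?_⟩
  have hm0 : 0 < m := by rcases hm with rfl | rfl <;> norm_num
  have hm1 : 1 ≤ m := by rcases hm with rfl | rfl <;> norm_num
  have hm2 : m ≤ 2 := by rcases hm with rfl | rfl <;> norm_num
  have e : (m * s / 2 : ℂ) = ((m / 2 : ℝ) : ℂ) * s := by push_cast; ring
  have er : (m * s / 2 : ℂ).re = m / 2 * s.re := by rw [e, Complex.re_ofReal_mul]
  have ei : (m * s / 2 : ℂ).im = m / 2 * s.im := by rw [e, Complex.im_ofReal_mul]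
  have hb := h (m * s / 2) (by rw [er]; nlinarith) (by rw [er]; nlinarith)
  rw [ei, abs_mul, abs_of_pos (by positivity : 0 < m / 2)] at hb
  have hb2 : rexp (A * (1 + m / 2 * |s.im|)) ≤ rexp (A * (1 + |s.im|)) := by
    apply exp_le_exp.mpr
    have := abs_nonneg s.im
    gcongr
    nlinarith
  have hg : ‖gt1 m 4‖ ≤ ‖gt1 1 4‖ + ‖gt1 2 4‖ + 1 := by
    have := norm_nonneg (gt1 1 4); have := norm_nonneg (gt1 2 4)
    rcases hm with rfl | rfl <;> linarith
  have hc : ‖((π * m : ℝ) : ℂ) ^ (m * s / 2 : ℂ)‖ ≤ (2 * π) ^ (4:ℝ) := by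
    rw [Complex.norm_cpow_eq_rpow_re_of_pos (by positivity), er]
    refine (rpow_le_rpow (by positivity) (show π * m ≤ 2 * π by nlinarith [pi_pos]) (by nlinarith)).trans ?_
    exact rpow_le_rpow_of_exponent_le h2p (by nlinarith)
  have hd : ‖((2 / m : ℝ) : ℂ)‖ ≤ 2 := by
    rw [Complex.norm_real, norm_of_nonneg (by positivity), div_le_iff₀ hm0]; linarith
  rw [ig1, norm_mul, norm_mul, norm_mul]
  calc _ ≤ (‖gt1 1 4‖ + ‖gt1 2 4‖ + 1) * (2 * (2 * π) ^ (4:ℝ) * rexp (A * (1 + |s.im|))) := by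
        gcongr; exact hb.trans hb2
    _ = rexp (log Q) * rexp (A * (1 + |s.im|)) := by rw [exp_log (by linarith), hQ]; ring
    _ ≤ _ := by
      rw [← exp_add]; apply exp_le_exp.mpr
      have := log_nonneg hQ1; have := abs_nonneg s.im
      nlinarith
end MRH

namespace MRH
open MeasureTheory Real NumberField Module Set Filter Topology Asymptotics NumberField.Units

lemma card_places_le (K : Type*) [Field K] [NumberField K] : (Fintype.card (InfinitePlace K) : ℝ) ≤ finrank ℚ K := by
  rw [← sum_mult_real, Fintype.card_eq_sum_ones]
  push_cast
  refine Finset.sum_le_sum fun w _ => ?_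
  exact_mod_cast w.mult_pos

set_option maxHeartbeats 1000000 in
lemma Z_exists : ∃ A : ℝ, 0 < A ∧ ∀ (K : Type) [Field K] [NumberField K], ∃ Z : ℂ → ℂ, Differentiable ℂ Z ∧ Z 1 ≠ 0 ∧
    (∀ s : ℂ, 1 < s.re → Z s = (s - 1) * zs K s) ∧
    ∀ s : ℂ, 1/2 ≤ s.re → s.re ≤ 4 → ‖Z s‖ ≤ ‖zs K 4‖ * DD K ^ 2 * rexp (A * finrank ℚ K * (1 + |s.im|)) := by
  obtain ⟨A, hA, hig⟩ := ig1_bound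
  refine ⟨A + log 90, by have := log_pos (show (1:ℝ) < 90 by norm_num); linarith, fun K _ _ => ?_⟩
  obtain ⟨L, κ, hκ, hL, hLz, hLb, hκb⟩ := Lam_exists K
  have hw : (torsionOrder K : ℂ) ≠ 0 := by exact_mod_cast (torsionOrder_ne_zero K)
  have hD : (√(DD K) : ℂ) ≠ 0 := by exact_mod_cast (sD_pos (K := K)).ne'
  have hDs : ∀ s : ℂ, (√(DD K) : ℂ) ^ s ≠ 0 := fun s => by rw [Ne, Complex.cpow_eq_zero_iff]; exact fun h => hD h.1
  let w0 : InfinitePlace K := Classical.arbitrary _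
  obtain ⟨P, hP⟩ : ∃ P : ℂ → ℂ, P = fun s => (torsionOrder K : ℂ)⁻¹ * (√(DD K) : ℂ) ^ (-s) * ∏ v : InfinitePlace K, ig1 v.mult s := ⟨_, rfl⟩
  obtain ⟨Q, hQ⟩ : ∃ Q : ℂ → ℂ, Q = fun s => (torsionOrder K : ℂ)⁻¹ * (√(DD K) : ℂ) ^ (-s) * (ih1 w0.mult s * ∏ v ∈ Finset.univ.erase w0, ig1 (v : InfinitePlace K).mult s) := ⟨_, rfl⟩
  have hpow : Differentiable ℂ (fun s : ℂ => (√(DD K) : ℂ) ^ (-s)) := differentiable_id.neg.const_cpow (Or.inl hD)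
  have hPd : Differentiable ℂ P := by
    rw [hP]
    refine ((differentiable_const _).mul hpow).mul ?_
    exact Differentiable.fun_finsetProd fun v _ => ig1_diff (mult_pos' v)
  have hQd : Differentiable ℂ Q := by
    rw [hQ]
    refine ((differentiable_const _).mul hpow).mul ((ih1_diff (mult_pos' w0)).mul ?_)
    exact Differentiable.fun_finsetProd fun v _ => ig1_diff (mult_pos' v)
  have hPQ : ∀ s, s * Q s = P s := by
    intro s
    rw [hP, hQ]; simp only
    rw [← Finset.mul_prod_erase Finset.univ _ (Finset.mem_univ w0), ← ih1_mul (mult_pos' w0) s]; ring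
  have hP1 : ∀ s : ℂ, 0 < s.re → (torsionOrder K * (√(DD K) : ℂ) ^ s * Gt K s) * P s = 1 := by
    intro s hs
    rw [hP, Gt]; simp only
    have h1 : (∏ v : InfinitePlace K, gt1 v.mult s) * ∏ v : InfinitePlace K, ig1 v.mult s = 1 := by
      rw [← Finset.prod_mul_distrib]
      exact Finset.prod_eq_one fun v _ => gt1_ig1 (mult_pos' v) hs
    rw [Complex.cpow_neg]
    have := hDs s
    field_simp
    linear_combination h1
  have hPne : ∀ s : ℂ, 0 < s.re → P s ≠ 0 := fun s hs h => by simpa [h] using hP1 s hs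
  refine ⟨fun s => (s - 1) * L s * P s - κ * (s - 1) * Q s + κ * P s, ?_, ?_, ?_, ?_⟩
  · fun_prop
  · simp only [sub_self, zero_mul, mul_zero, zero_add]
    exact mul_ne_zero (by exact_mod_cast hκ.ne') (hPne 1 (by simp))
  · intro s hs
    have h1 := hLz s hs
    have h2 := hP1 s (by linarith)
    have h3 := hPQ s
    have hs0 : s ≠ 0 := fun h => by rw [h] at hs; simp at hs; linarith
    have hs1 : 1 - s ≠ 0 := fun h => by
      have : s = 1 := by linear_combination -h
      rw [this] at hs; simp at hs
    have h4 : zs K s = P s * (L s - κ / s - κ / (1 - s)) := by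
      rw [← h1]; linear_combination (-zs K s) * h2
    beta_reduce
    rw [h4, ← h3]; field_simp; ring
  · intro s hs1 hs2
    set N := ‖torsionOrder K * (√(DD K) : ℂ) ^ (4:ℂ) * Gt K 4 * zs K 4‖ with hN
    have hsn : 1/2 ≤ ‖s‖ := hs1.trans (Complex.re_le_norm s)
    have hQn : ‖Q s‖ ≤ 2 * ‖P s‖ := by
      rw [← hPQ s, norm_mul]; nlinarith [norm_nonneg (Q s)]
    have hs1n : ‖s - 1‖ ≤ 3 + |s.im| := by
      have := norm_le_re_im (s - 1) (a := 3) (by rw [abs_le]; constructor <;> simp <;> linarith)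
      simpa using this
    have him := abs_nonneg s.im
    have hNP : N * ‖P s‖ ≤ ‖zs K 4‖ * DD K ^ 2 * rexp (A * finrank ℚ K * (1 + |s.im|)) := by
      rw [hN, ← norm_mul, hP, Gt]; simp only
      have e : torsionOrder K * (√(DD K) : ℂ) ^ (4:ℂ) * (∏ w : InfinitePlace K, gt1 w.mult 4) * zs K 4 * ((torsionOrder K : ℂ)⁻¹ * (√(DD K) : ℂ) ^ (-s) * ∏ v : InfinitePlace K, ig1 v.mult s)
        = zs K 4 * (√(DD K) : ℂ) ^ (4 - s) * ∏ v : InfinitePlace K, (gt1 v.mult 4 * ig1 v.mult s) := by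
        rw [Finset.prod_mul_distrib, sub_eq_add_neg, Complex.cpow_add _ _ hD]
        field_simp
      rw [e, norm_mul, norm_mul, norm_prod]
      have h1 : ∏ v : InfinitePlace K, ‖gt1 v.mult 4 * ig1 v.mult s‖ ≤ rexp (A * finrank ℚ K * (1 + |s.im|)) := by
        refine (Finset.prod_le_prod (fun _ _ => norm_nonneg _) (fun v _ => hig v.mult ?_ s hs1 hs2)).trans ?_
        · rcases v.isReal_or_isComplex with h | h
          · left; simp [InfinitePlace.mult, h]
          · right; simp [InfinitePlace.mult, InfinitePlace.not_isReal_iff_isComplex.mpr h]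
        · rw [Finset.prod_const, ← exp_nat_mul, Finset.card_univ]
          apply exp_le_exp.mpr
          have := card_places_le K
          have : (Fintype.card (InfinitePlace K) : ℝ) * (A * (1 + |s.im|)) ≤ finrank ℚ K * (A * (1 + |s.im|)) := by gcongr
          linarith
      have h2 : ‖(√(DD K) : ℂ) ^ (4 - s)‖ ≤ DD K ^ 2 := by
        rw [Complex.norm_cpow_eq_rpow_re_of_pos sD_pos]
        have h3 : 1 ≤ √(DD K) := one_le_sqrt.mpr DD_one
        refine (rpow_le_rpow_of_exponent_le h3 (show (4 - s).re ≤ ((4:ℕ):ℝ) by simp; linarith)).trans (le_of_eq ?_)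
        rw [rpow_natCast, show (4:ℕ) = 2 * 2 by norm_num, pow_mul, sq_sqrt DD_pos.le]
      exact mul_le_mul (mul_le_mul_of_nonneg_left h2 (norm_nonneg _)) h1 (Finset.prod_nonneg fun _ _ => norm_nonneg _) (by positivity)
    have h1 := hLb s (by linarith) hs2
    have hd : (1:ℝ) ≤ finrank ℚ K := by exact_mod_cast finrank_pos
    have hκn : ‖(κ:ℂ)‖ = κ := by rw [Complex.norm_real, norm_of_nonneg hκ.le]
    calc _ ≤ ‖s - 1‖ * ‖L s‖ * ‖P s‖ + κ * ‖s - 1‖ * ‖Q s‖ + κ * ‖P s‖ := by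
          refine (norm_add_le _ _).trans (add_le_add ((norm_sub_le _ _).trans (le_of_eq ?_)) (le_of_eq ?_))
          · simp only [norm_mul, hκn]
          · rw [norm_mul, hκn]
      _ ≤ (3 + |s.im|) * (2 * N) * ‖P s‖ + (12 * N) * (3 + |s.im|) * (2 * ‖P s‖) + (12 * N) * ‖P s‖ := by
          gcongr
      _ = N * ‖P s‖ * (90 + 26 * |s.im|) := by ring
      _ ≤ (‖zs K 4‖ * DD K ^ 2 * rexp (A * finrank ℚ K * (1 + |s.im|))) * rexp (log 90 * (finrank ℚ K * (1 + |s.im|))) := by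
          gcongr
          have h5 : rexp (log 90 * (1 + |s.im|)) ≤ rexp (log 90 * (finrank ℚ K * (1 + |s.im|))) := by
            apply exp_le_exp.mpr
            have := log_pos (show (1:ℝ) < 90 by norm_num)
            gcongr
            nlinarith
          refine le_trans ?_ h5
          rw [mul_add, exp_add, mul_one, exp_log (by norm_num)]
          have h6 := add_one_le_exp (log 90 * |s.im|)
          have h7 : (1:ℝ) ≤ log 90 := by
            rw [le_log_iff_exp_le (by norm_num)]; linarith [exp_one_lt_d9]
          nlinarith
      _ = _ := by rw [mul_assoc, ← exp_add]; congr 2; ring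
end MRH

namespace MRH
open MeasureTheory Real NumberField Module Set Filter Topology Asymptotics
variable {K : Type*} [Field K] [NumberField K]

abbrev PP (K : Type*) [Field K] [NumberField K] := {P : Ideal (𝓞 K) // P.IsPrime ∧ P ≠ ⊥}
abbrev QQ (K : Type*) [Field K] [NumberField K] := PP K × ℕ

def np (P : PP K) : ℕ := Ideal.absNorm P.1
def nq' (q : QQ K) : ℕ := np q.1 ^ (q.2 + 1)

lemma PP_prime (P : PP K) : Prime P.1 := Ideal.prime_of_isPrime P.2.2 P.2.1

lemma PP_rat (P : PP K) : ∃ p f : ℕ, p.Prime ∧ (p : 𝓞 K) ∈ P.1 ∧ 0 < f ∧ np P = p ^ f := by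
  have hP := P.2.1
  have h0 : np P ≠ 0 := by rw [np, Ne, Ideal.absNorm_eq_zero_iff]; exact P.2.2
  have h1 : np P ≠ 1 := by rw [np, Ne, Ideal.absNorm_eq_one_iff]; exact hP.ne_top
  have hm : ((np P : ℕ) : 𝓞 K) ∈ P.1 := Ideal.absNorm_mem P.1
  have h2 : ∃ p ∈ (np P).primeFactorsList, (p : 𝓞 K) ∈ P.1 := by
    rw [← Nat.prod_primeFactorsList h0] at hm
    have : ∀ l : List ℕ, ((l.prod : ℕ) : 𝓞 K) ∈ P.1 → ∃ p ∈ l, (p : 𝓞 K) ∈ P.1 := by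
      intro l
      induction l with
      | nil => intro h; simp only [List.prod_nil, Nat.cast_one] at h; exact absurd ((Ideal.eq_top_iff_one _).mpr h) hP.ne_top
      | cons a l ih =>
        intro h
        rw [List.prod_cons, Nat.cast_mul] at h
        rcases hP.mem_or_mem h with h | h
        · exact ⟨a, by simp, h⟩
        · obtain ⟨p, hp, hp'⟩ := ih h; exact ⟨p, by simp [hp], hp'⟩
    exact this _ hm
  obtain ⟨p, hp, hpP⟩ := h2
  have hpp := Nat.prime_of_mem_primeFactorsList hp
  have h3 : np P ∣ p ^ finrank ℤ (𝓞 K) := by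
    rw [← Ideal.absNorm_span_natCast]
    exact Ideal.absNorm_dvd_absNorm_of_le ((Ideal.span_singleton_le_iff_mem _).mpr hpP)
  obtain ⟨f, -, hf⟩ := (Nat.dvd_prime_pow hpp).mp h3
  refine ⟨p, f, hpp, hpP, Nat.pos_of_ne_zero fun h => h1 (by rw [hf, h, pow_zero]), hf⟩

def pr (P : PP K) : ℕ := (PP_rat P).choose
def fdeg (P : PP K) : ℕ := (PP_rat P).choose_spec.choose
lemma pr_prime (P : PP K) : (pr P).Prime := (PP_rat P).choose_spec.choose_spec.1
lemma pr_mem (P : PP K) : (pr P : 𝓞 K) ∈ P.1 := (PP_rat P).choose_spec.choose_spec.2.1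
lemma fdeg_pos (P : PP K) : 0 < fdeg P := (PP_rat P).choose_spec.choose_spec.2.2.1
lemma np_eq (P : PP K) : np P = pr P ^ fdeg P := (PP_rat P).choose_spec.choose_spec.2.2.2

lemma pr_le_np (P : PP K) : pr P ≤ np P := by
  rw [np_eq]; exact Nat.le_self_pow (fdeg_pos P).ne' _

lemma np_two (P : PP K) : 2 ≤ np P := (pr_prime P).two_le.trans (pr_le_np P)

lemma PP_count (p : ℕ) (S : Finset (PP K)) (hS : ∀ P ∈ S, pr P = p) : S.card ≤ finrank ℚ K := by
  rcases S.eq_empty_or_nonempty with rfl | ⟨P0, hP0⟩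
  · simp
  have hp : p.Prime := hS P0 hP0 ▸ pr_prime P0
  have h1 : ∏ P ∈ S, P.1 ∣ Ideal.span {(p : 𝓞 K)} := by
    refine Finset.prod_dvd_of_isRelPrime ?_ ?_
    · intro P hP P' hP' hne
      refine (Irreducible.isRelPrime_iff_not_dvd (PP_prime P).irreducible).mpr fun h => hne ?_
      exact Subtype.ext (associated_iff_eq.mp ((PP_prime P).associated_of_dvd (PP_prime P') h))
    · intro P hP
      rw [Ideal.dvd_span_singleton, ← hS P hP]; exact pr_mem P
  have h2 := Ideal.absNorm_dvd_absNorm_of_le (Ideal.le_of_dvd h1)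
  rw [Ideal.absNorm_span_natCast, map_prod, RingOfIntegers.rank] at h2
  have h3 : p ^ S.card ∣ ∏ P ∈ S, Ideal.absNorm P.1 := by
    rw [← Finset.prod_const]
    refine Finset.prod_dvd_prod_of_dvd _ _ fun P hP => ?_
    have : Ideal.absNorm P.1 = pr P ^ fdeg P := np_eq P
    rw [this, hS P hP]; exact dvd_pow_self _ (fdeg_pos P).ne'
  exact (Nat.pow_dvd_pow_iff_le_right hp.one_lt).mp (h3.trans h2)

lemma log_sum (I : Ideal (𝓞 K)) : I ≠ ⊥ → ∑' q : QQ K, (if q.1.1 ^ (q.2 + 1) ∣ I then ENNReal.ofReal (log (np q.1)) else 0) =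
    ENNReal.ofReal (log (Ideal.absNorm I)) := by
  induction I using UniqueFactorizationMonoid.induction_on_prime with
  | h₁ => intro h; exact absurd rfl h
  | h₂ x hx =>
    intro _
    have : x = ⊤ := Ideal.isUnit_iff.mp hx
    rw [this]
    simp only [Ideal.absNorm_top, Nat.cast_one, log_one, ENNReal.ofReal_zero, ENNReal.tsum_eq_zero]
    intro q
    rw [if_neg]
    intro h
    exact (PP_prime q.1).not_isUnit (isUnit_of_dvd_unit ((dvd_pow_self _ (by omega)).trans h) (by simp [Ideal.isUnit_iff]))
  | h₃ J P hJ hP ih =>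
    intro _
    have hJ' : J ≠ ⊥ := hJ
    have hP0 : P ≠ ⊥ := hP.ne_zero
    let P0 : PP K := ⟨P, Ideal.isPrime_of_prime hP, hP0⟩
    have hN1 : (0:ℝ) < Ideal.absNorm P := by exact_mod_cast Nat.pos_of_ne_zero (by rwa [Ne, Ideal.absNorm_eq_zero_iff])
    have hN2 : (0:ℝ) < Ideal.absNorm J := by exact_mod_cast Nat.pos_of_ne_zero (by rwa [Ne, Ideal.absNorm_eq_zero_iff])
    have hl1 : 0 ≤ log (Ideal.absNorm P) := log_natCast_nonneg _
    have hl2 : 0 ≤ log (Ideal.absNorm J) := log_natCast_nonneg _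
    rw [map_mul, Nat.cast_mul, log_mul hN1.ne' hN2.ne', ENNReal.ofReal_add hl1 hl2, ← ih hJ', ENNReal.tsum_prod', ENNReal.tsum_prod']
    have h1 : ENNReal.ofReal (log (Ideal.absNorm P)) = ∑' Q : PP K, if Q = P0 then ENNReal.ofReal (log (np Q)) else 0 := by
      rw [tsum_eq_single P0]
      · simp [P0, np]
      · intro Q hQ; simp [hQ]
    rw [h1, ← ENNReal.tsum_add]
    refine tsum_congr fun Q => ?_
    by_cases hQ : Q = P0
    · rw [if_pos hQ, tsum_eq_zero_add' ENNReal.summable]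
      congr 1
      · simp [hQ, P0]
      · refine tsum_congr fun k => ?_
        have : Q.1 ^ (k + 1 + 1) ∣ P * J ↔ Q.1 ^ (k + 1) ∣ J := by
          rw [hQ, pow_succ']; exact mul_dvd_mul_iff_left hP.ne_zero
        simp only [this]
    · rw [if_neg hQ, zero_add]
      refine tsum_congr fun k => ?_
      have : Q.1 ^ (k + 1) ∣ P * J ↔ Q.1 ^ (k + 1) ∣ J := by
        refine ⟨fun h => ?_, fun h => h.mul_left _⟩
        refine IsRelPrime.dvd_of_dvd_mul_left (IsRelPrime.pow_left ?_) h
        refine (Irreducible.isRelPrime_iff_not_dvd (PP_prime Q).irreducible).mpr fun h => hQ ?_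
        exact Subtype.ext (associated_iff_eq.mp ((PP_prime Q).associated_of_dvd hP h))
      simp only [this]

lemma log_conv (h : ℕ → ENNReal) (hm : ∀ a b, h (a * b) = h a * h b) :
    (∑' q : QQ K, ENNReal.ofReal (log (np q.1)) * h (nq' q)) * ∑' J : II K, h (Ideal.absNorm J.1) =
    ∑' I : II K, ENNReal.ofReal (log (Ideal.absNorm I.1)) * h (Ideal.absNorm I.1) := by
  have h1 : ∀ q : QQ K, ∑' I : II K, (if q.1.1 ^ (q.2 + 1) ∣ I.1 then ENNReal.ofReal (log (np q.1)) else 0) * h (Ideal.absNorm I.1)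
      = ENNReal.ofReal (log (np q.1)) * h (nq' q) * ∑' J : II K, h (Ideal.absNorm J.1) := by
    intro q
    have hq0 : q.1.1 ^ (q.2 + 1) ≠ ⊥ := pow_ne_zero _ (PP_prime q.1).ne_zero
    let g : II K → II K := fun J => ⟨q.1.1 ^ (q.2 + 1) * J.1, mul_ne_zero hq0 J.2⟩
    have hg : Function.Injective g := fun J J' hJ => Subtype.ext (mul_left_cancel₀ hq0 (Subtype.ext_iff.mp hJ))
    rw [← hg.tsum_eq, ← ENNReal.tsum_mul_left]
    · refine tsum_congr fun J => ?_
      rw [if_pos (dvd_mul_right _ _), mul_assoc, ← hm]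
      congr 2
      simp [g, nq', np]
    · intro I hI
      rw [Function.mem_support] at hI
      by_cases hd : q.1.1 ^ (q.2 + 1) ∣ I.1
      · obtain ⟨J, hJ⟩ := hd
        exact ⟨⟨J, fun h => I.2 (by rw [hJ, h]; simp)⟩, Subtype.ext hJ.symm⟩
      · simp [hd] at hI
  rw [← ENNReal.tsum_mul_right]
  simp_rw [← h1]
  rw [ENNReal.tsum_comm]
  refine tsum_congr fun I => ?_
  rw [ENNReal.tsum_mul_right, log_sum _ I.2]
end MRH

namespace MRH
open MeasureTheory Real NumberField Module Set Filter Topology Asymptotics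
variable {K : Type*} [Field K] [NumberField K]

lemma fiber_sum {α : Type*} (φ : α → ℕ) (D : ℕ) (hφ : ∀ n (S : Finset α), (∀ a ∈ S, φ a = n) → S.card ≤ D) (h : ℕ → ENNReal) :
    ∑' a, h (φ a) ≤ D * ∑' n, h n := by
  rw [← (Equiv.sigmaFiberEquiv φ).tsum_eq, ENNReal.tsum_sigma', ← ENNReal.tsum_mul_left]
  refine ENNReal.tsum_le_tsum fun n => ?_
  rw [ENNReal.tsum_eq_iSup_sum]
  refine iSup_le fun S => ?_
  have h1 : ∀ x ∈ S, h (φ ((Equiv.sigmaFiberEquiv φ) ⟨n, x⟩)) = h n := fun x _ => congrArg h x.2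
  rw [Finset.sum_congr rfl h1, Finset.sum_const, nsmul_eq_mul]
  have h2 := hφ n (S.map (Function.Embedding.subtype _)) (by simp only [Finset.mem_map]; rintro a ⟨x, _, rfl⟩; exact x.2)
  rw [Finset.card_map] at h2
  gcongr

lemma q_fiber (n : ℕ) (S : Finset (QQ K)) (hS : ∀ q ∈ S, pr q.1 ^ (q.2 + 1) = n) : S.card ≤ finrank ℚ K := by
  have hp : ∀ q ∈ S, pr q.1 = n.minFac := fun q hq => by
    rw [← hS q hq, Nat.Prime.pow_minFac (pr_prime _) (by omega)]
  rw [← Finset.card_image_of_injOn (f := Prod.fst)]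
  · refine PP_count n.minFac _ fun P hP => ?_
    obtain ⟨q, hq, rfl⟩ := Finset.mem_image.mp hP
    exact hp q hq
  · intro q hq q' hq' h
    have h1 := hS q hq
    rw [← hS q' hq', h] at h1
    have := Nat.pow_right_injective (pr_prime q'.1).two_le h1
    exact Prod.ext h (by omega)

lemma q_sum (h : ℕ → ENNReal) (hh : ∀ a b, 1 ≤ a → a ≤ b → h b ≤ h a) : ∑' q : QQ K, h (nq' q) ≤ finrank ℚ K * ∑' n, h n := by
  refine le_trans (ENNReal.tsum_le_tsum fun q => ?_) (fiber_sum (fun q : QQ K => pr q.1 ^ (q.2 + 1)) _ q_fiber h)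
  exact hh _ _ (Nat.one_le_pow _ _ (pr_prime _).pos) (Nat.pow_le_pow_left (pr_le_np _) _)

lemma nq_two (q : QQ K) : 2 ≤ nq' q := (np_two q.1).trans (Nat.le_self_pow (by omega) _)

lemma q_summable' {σ : ℝ} (hσ : 1 < σ) : ∑' q : QQ K, ENNReal.ofReal ((nq' q : ℝ) ^ (-σ)) ≤
    ENNReal.ofReal (finrank ℚ K * ∑' n : ℕ, (n : ℝ) ^ (-σ)) := by
  have h1 := q_sum (K := K) (fun n => ENNReal.ofReal ((n : ℝ) ^ (-σ))) (fun a b ha hab => by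
    apply ENNReal.ofReal_le_ofReal
    have : (0:ℝ) < a := by exact_mod_cast ha
    exact rpow_le_rpow_of_nonpos this (by exact_mod_cast hab) (by linarith))
  rw [← ENNReal.ofReal_tsum_of_nonneg (fun n => by positivity) (Real.summable_nat_rpow.mpr (by linarith)),
    ← ENNReal.ofReal_natCast, ← ENNReal.ofReal_mul (by positivity)] at h1
  exact h1

lemma q_summable {σ : ℝ} (hσ : 1 < σ) : Summable (fun q : QQ K => (nq' q : ℝ) ^ (-σ)) := by
  refine (ENNReal.summable_toReal (ne_top_of_le_ne_top ENNReal.ofReal_ne_top (q_summable' (K := K) hσ))).congr fun q => ?_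
  rw [ENNReal.toReal_ofReal (by positivity)]

lemma q_tsum_le {σ : ℝ} (hσ : 1 < σ) : ∑' q : QQ K, (nq' q : ℝ) ^ (-σ) ≤ finrank ℚ K * ∑' n : ℕ, (n : ℝ) ^ (-σ) := by
  have h := q_summable' (K := K) hσ
  rw [← ENNReal.ofReal_tsum_of_nonneg (fun n => by positivity) (q_summable hσ)] at h
  exact (ENNReal.ofReal_le_ofReal_iff (mul_nonneg (by positivity) (tsum_nonneg fun n => by positivity))).mp h

def DS {ι : Type*} (c : ι → ℝ) (N : ι → ℕ) (s : ℂ) : ℂ := ∑' i, (c i : ℂ) * (N i : ℂ) ^ (-s)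

section
variable {ι : Type*} {c : ι → ℝ} {N : ι → ℕ}

lemma DS_norm_term (hN : ∀ i, 1 ≤ N i) (hc : ∀ i, 0 ≤ c i) (i : ι) (s : ℂ) : ‖(c i : ℂ) * (N i : ℂ) ^ (-s)‖ = c i * (N i : ℝ) ^ (-s.re) := by
  have : (0:ℝ) < N i := by exact_mod_cast hN i
  rw [norm_mul, Complex.norm_real, norm_of_nonneg (hc i), ← Complex.ofReal_natCast, Complex.norm_cpow_eq_rpow_re_of_pos this]; simp

lemma DS_summable (hN : ∀ i, 1 ≤ N i) (hc : ∀ i, 0 ≤ c i)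
    (hs : ∀ σ : ℝ, 1 < σ → Summable (fun i => c i * (N i : ℝ) ^ (-σ))) {s : ℂ} (h : 1 < s.re) : Summable (fun i => (c i : ℂ) * (N i : ℂ) ^ (-s)) :=
  Summable.of_norm ((hs _ h).congr fun i => (DS_norm_term hN hc i s).symm)

lemma DS_norm_le (hN : ∀ i, 1 ≤ N i) (hc : ∀ i, 0 ≤ c i)
    (hs : ∀ σ : ℝ, 1 < σ → Summable (fun i => c i * (N i : ℝ) ^ (-σ))) {s : ℂ} (h : 1 < s.re) : ‖DS c N s‖ ≤ ∑' i, c i * (N i : ℝ) ^ (-s.re) := by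
  refine (norm_tsum_le_tsum_norm ((hs _ h).congr fun i => (DS_norm_term hN hc i s).symm)).trans (le_of_eq ?_)
  exact tsum_congr fun i => DS_norm_term hN hc i s

lemma DS_aux (hN : ∀ i, 1 ≤ N i) (hc : ∀ i, 0 ≤ c i)
    (hs : ∀ σ : ℝ, 1 < σ → Summable (fun i => c i * (N i : ℝ) ^ (-σ))) {σ : ℝ} (hσ : 1 < σ) : DifferentiableOn ℂ (DS c N) {s | σ < s.re} ∧ ∀ s : ℂ, σ < s.re →
    HasSum (fun i => -((c i * log (N i) : ℝ) : ℂ) * (N i : ℂ) ^ (-s)) (deriv (DS c N) s) := by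
  have hU : IsOpen {s : ℂ | σ < s.re} := isOpen_lt continuous_const Complex.continuous_re
  have hne : ∀ i, (N i : ℂ) ≠ 0 := fun i => by exact_mod_cast (Nat.pos_iff_ne_zero.mp (hN i))
  have hd : ∀ i, Differentiable ℂ (fun s : ℂ => (c i : ℂ) * (N i : ℂ) ^ (-s)) := fun i =>
    (differentiable_const _).mul (differentiable_id.neg.const_cpow (Or.inl (hne i)))
  have hb : ∀ i, ∀ w ∈ {s : ℂ | σ < s.re}, ‖(c i : ℂ) * (N i : ℂ) ^ (-w)‖ ≤ c i * (N i : ℝ) ^ (-σ) := by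
    intro i w hw
    rw [DS_norm_term hN hc]
    have : (1:ℝ) ≤ N i := by exact_mod_cast hN i
    exact mul_le_mul_of_nonneg_left (rpow_le_rpow_of_exponent_le this (by have : σ < w.re := hw; linarith)) (hc i)
  refine ⟨Complex.differentiableOn_tsum_of_summable_norm (hs σ hσ) (fun i => (hd i).differentiableOn) hU hb, fun s h => ?_⟩
  have h1 := Complex.hasSum_deriv_of_summable_norm (hs σ hσ) (fun i => (hd i).differentiableOn) hU hb (z := s) h
  convert! h1 using 2 with i
  have h2 : HasDerivAt (fun s : ℂ => (N i : ℂ) ^ (-s)) ((N i : ℂ) ^ (-s) * Complex.log (N i) * (-1)) s :=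
    (hasDerivAt_id s).neg.const_cpow (Or.inl (hne i))
  rw [(h2.const_mul (c i : ℂ)).deriv, ← Complex.natCast_log]
  push_cast; ring

lemma DS_diff (hN : ∀ i, 1 ≤ N i) (hc : ∀ i, 0 ≤ c i)
    (hs : ∀ σ : ℝ, 1 < σ → Summable (fun i => c i * (N i : ℝ) ^ (-σ))) : DifferentiableOn ℂ (DS c N) {s | 1 < s.re} := by
  intro s hs'
  obtain ⟨σ, h1, h2⟩ := exists_between (show 1 < s.re from hs')
  have hU : IsOpen {s : ℂ | σ < s.re} := isOpen_lt continuous_const Complex.continuous_re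
  exact ((DS_aux hN hc hs h1).1.differentiableAt (hU.mem_nhds h2)).differentiableWithinAt

lemma DS_deriv (hN : ∀ i, 1 ≤ N i) (hc : ∀ i, 0 ≤ c i)
    (hs : ∀ σ : ℝ, 1 < σ → Summable (fun i => c i * (N i : ℝ) ^ (-σ))) {s : ℂ} (h : 1 < s.re) : HasSum (fun i => -((c i * log (N i) : ℝ) : ℂ) * (N i : ℂ) ^ (-s)) (deriv (DS c N) s) := by
  obtain ⟨σ, h1, h2⟩ := exists_between h
  exact (DS_aux hN hc hs h1).2 s h2

lemma DS_log_summable (hN : ∀ i, 1 ≤ N i) (hc : ∀ i, 0 ≤ c i)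
    (hs : ∀ σ : ℝ, 1 < σ → Summable (fun i => c i * (N i : ℝ) ^ (-σ))) {σ : ℝ} (h : 1 < σ) : Summable (fun i => (c i * log (N i)) * (N i : ℝ) ^ (-σ)) := by
  have h1 := (DS_deriv hN hc hs (s := (σ:ℂ)) (by simpa using h)).summable.norm
  refine h1.congr fun i => ?_
  have := DS_norm_term (c := fun i => c i * log (N i)) hN (fun i => mul_nonneg (hc i) (log_natCast_nonneg _)) i (σ:ℂ)
  rw [neg_mul, norm_neg, this]; simp

lemma DS_lim (hN : ∀ i, 1 ≤ N i) (hc : ∀ i, 0 ≤ c i)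
    (hs : ∀ σ : ℝ, 1 < σ → Summable (fun i => c i * (N i : ℝ) ^ (-σ))) : Tendsto (fun σ : ℝ => DS c N σ) atTop (𝓝 (∑' i, if N i = 1 then (c i : ℂ) else 0)) := by
  refine tendsto_tsum_of_dominated_convergence (bound := fun i => c i * (N i : ℝ) ^ (-2:ℝ)) (hs 2 (by norm_num)) ?_ ?_
  · intro i
    split_ifs with h
    · simp [h]
    · have h2 : (1:ℝ) < N i := by have := hN i; exact_mod_cast (by omega : 1 < N i)
      rw [tendsto_zero_iff_norm_tendsto_zero]
      simp_rw [DS_norm_term hN hc, Complex.ofReal_re]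
      have : Tendsto (fun σ : ℝ => (N i : ℝ) ^ (-σ)) atTop (𝓝 0) := by
        exact (tendsto_rpow_atBot_of_base_gt_one _ h2).comp tendsto_neg_atTop_atBot
      simpa using this.const_mul (c i)
  · filter_upwards [eventually_ge_atTop 2] with σ hσ i
    rw [DS_norm_term hN hc]
    have : (1:ℝ) ≤ N i := by exact_mod_cast hN i
    exact mul_le_mul_of_nonneg_left (rpow_le_rpow_of_exponent_le this (by simpa using hσ)) (hc i)
end

def ell (K : Type*) [Field K] [NumberField K] : ℂ → ℂ := DS (fun q : QQ K => 1 / ((q.2 : ℝ) + 1)) nq'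
def LL (K : Type*) [Field K] [NumberField K] : ℂ → ℂ := DS (fun q : QQ K => log (np q.1)) nq'

lemma zs_DS : zs K = DS (fun _ : II K => 1) (fun I => Ideal.absNorm I.1) := by
  funext s; simp [zs, DS]

lemma zs_h : ∀ σ : ℝ, 1 < σ → Summable (fun I : II K => (1:ℝ) * (Ideal.absNorm I.1 : ℝ) ^ (-σ)) := fun σ h => by
  simpa using zsum (K := K) h

lemma nq_one (q : QQ K) : 1 ≤ nq' q := by have := nq_two q; omega

lemma ell_c (q : QQ K) : 0 ≤ 1 / ((q.2 : ℝ) + 1) := by positivity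

lemma ell_h : ∀ σ : ℝ, 1 < σ → Summable (fun q : QQ K => 1 / ((q.2 : ℝ) + 1) * (nq' q : ℝ) ^ (-σ)) := fun σ h => by
  refine Summable.of_nonneg_of_le (fun q => by positivity) (fun q => ?_) (q_summable (K := K) h)
  refine mul_le_of_le_one_left (by positivity) ?_
  rw [div_le_one (by positivity)]; linarith [(Nat.cast_nonneg q.2 : (0:ℝ) ≤ q.2)]

lemma ell_log (q : QQ K) : 1 / ((q.2 : ℝ) + 1) * log (nq' q) = log (np q.1) := by
  rw [nq', Nat.cast_pow, log_pow]; push_cast; field_simp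

lemma LL_c (q : QQ K) : 0 ≤ log (np q.1) := log_natCast_nonneg _

lemma LL_h : ∀ σ : ℝ, 1 < σ → Summable (fun q : QQ K => log (np q.1) * (nq' q : ℝ) ^ (-σ)) := fun σ h => by
  refine (DS_log_summable nq_one ell_c ell_h h).congr fun q => ?_
  rw [ell_log]

lemma ell_deriv {s : ℂ} (h : 1 < s.re) : deriv (ell K) s = - LL K s := by
  have h1 := DS_deriv nq_one ell_c (ell_h (K := K)) h
  rw [ell, ← h1.tsum_eq, LL, DS, ← tsum_neg]
  refine tsum_congr fun q => ?_
  rw [ell_log, neg_mul]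

lemma DS_real {ι : Type*} (c : ι → ℝ) (N : ι → ℕ) (σ : ℝ) : DS c N σ = ((∑' i, c i * (N i : ℝ) ^ (-σ) : ℝ) : ℂ) := by
  rw [DS, Complex.ofReal_tsum]
  refine tsum_congr fun i => ?_
  rw [Complex.ofReal_mul, Complex.ofReal_cpow (by positivity)]; simp

lemma zs_deriv_real {σ : ℝ} (h : 1 < σ) : deriv (zs K) σ = - (LL K σ * zs K σ) := by
  have hh : 1 < ((σ:ℝ):ℂ).re := by simpa using h
  have h1 := DS_deriv (fun I : II K => II_pos I) (fun _ => zero_le_one) (zs_h (K := K)) hh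
  rw [zs_DS, ← h1.tsum_eq, LL]
  simp_rw [neg_mul]
  rw [tsum_neg]
  congr 1
  change DS _ _ _ = _
  rw [DS_real, DS_real, DS_real, ← Complex.ofReal_mul]
  congr 1
  have hL := DS_log_summable (fun I : II K => II_pos I) (fun _ => zero_le_one) (zs_h (K := K)) h
  have hc := log_conv (K := K) (fun n => ENNReal.ofReal ((n:ℝ) ^ (-σ))) (fun a b => by
    rw [Nat.cast_mul, mul_rpow (by positivity) (by positivity), ENNReal.ofReal_mul (by positivity)])
  have e1 : ∀ q : QQ K, 0 ≤ log (np q.1) * (nq' q : ℝ) ^ (-σ) := fun q => mul_nonneg (LL_c q) (by positivity)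
  have e2 : ∀ I : II K, 0 ≤ log (Ideal.absNorm I.1) * (Ideal.absNorm I.1 : ℝ) ^ (-σ) := fun I => mul_nonneg (log_natCast_nonneg _) (by positivity)
  simp_rw [← ENNReal.ofReal_mul (log_natCast_nonneg _)] at hc
  simp only [one_mul] at hL ⊢
  rw [← ENNReal.ofReal_tsum_of_nonneg e1 (LL_h σ h), ← ENNReal.ofReal_tsum_of_nonneg e2 hL,
    ← ENNReal.ofReal_tsum_of_nonneg (fun I => by positivity) (zsum h), ← ENNReal.ofReal_mul (tsum_nonneg e1)] at hc
  exact ((ENNReal.ofReal_eq_ofReal_iff (mul_nonneg (tsum_nonneg e1) (tsum_nonneg fun I => by positivity)) (tsum_nonneg e2)).mp hc).symm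

lemma zs_diff : DifferentiableOn ℂ (zs K) {s | 1 < s.re} := by
  rw [zs_DS]; exact DS_diff (fun I : II K => II_pos I) (fun _ => zero_le_one) zs_h
lemma ell_diff : DifferentiableOn ℂ (ell K) {s | 1 < s.re} := DS_diff nq_one ell_c ell_h
lemma LL_diff : DifferentiableOn ℂ (LL K) {s | 1 < s.re} := DS_diff nq_one LL_c LL_h

lemma hU1 : IsOpen {s : ℂ | 1 < s.re} := isOpen_lt continuous_const Complex.continuous_re
lemma hU1c : IsPreconnected {s : ℂ | 1 < s.re} := (convex_halfSpace_re_gt 1).isPreconnected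

lemma zs_deriv {s : ℂ} (h : 1 < s.re) : deriv (zs K) s = - (LL K s * zs K s) := by
  have h1 : AnalyticOnNhd ℂ (deriv (zs K)) {s | 1 < s.re} := (zs_diff.analyticOnNhd hU1).deriv
  have h2 : AnalyticOnNhd ℂ (fun s => - (LL K s * zs K s)) {s | 1 < s.re} :=
    (LL_diff.mul zs_diff).neg.analyticOnNhd hU1
  refine h1.eqOn_of_preconnected_of_frequently_eq h2 hU1c (z₀ := 2) (by simp) ?_ h
  have ht : Tendsto (fun n : ℕ => ((2 + 1 / ((n:ℝ) + 1) : ℝ) : ℂ)) atTop (𝓝[≠] 2) := by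
    refine tendsto_nhdsWithin_iff.mpr ⟨?_, ?_⟩
    · have := (tendsto_one_div_add_atTop_nhds_zero_nat (𝕜 := ℝ)).const_add 2
      rw [add_zero] at this
      exact (Complex.continuous_ofReal.tendsto 2).comp this
    · refine Eventually.of_forall fun n => ?_
      have : (2 + 1 / ((n:ℝ) + 1) : ℝ) ≠ 2 := by have : 0 < 1 / ((n:ℝ) + 1) := by positivity
                                                 linarith
      exact fun h => this (Complex.ofReal_injective h)
  refine ht.frequently (Eventually.of_forall fun n => ?_).frequently
  exact zs_deriv_real (by have : 0 < 1 / ((n:ℝ) + 1) := by positivity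
                          linarith)

lemma zs_exp {s : ℂ} (h : 1 < s.re) : zs K s = Complex.exp (ell K s) := by
  have hd : DifferentiableOn ℂ (fun s => zs K s * Complex.exp (-ell K s)) {s | 1 < s.re} :=
    zs_diff.mul ell_diff.neg.cexp
  have h0 : EqOn (deriv (fun s => zs K s * Complex.exp (-ell K s))) 0 {s | 1 < s.re} := by
    intro s hs
    have e1 := (zs_diff (K := K)).hasDerivAt (hU1.mem_nhds hs)
    have e2 := (ell_diff (K := K)).hasDerivAt (hU1.mem_nhds hs)
    have e3 := (e1.mul e2.neg.cexp).deriv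
    rw [zs_deriv hs, ell_deriv hs] at e3
    refine Eq.trans e3 ?_
    simp only [Pi.zero_apply, Pi.neg_apply]; ring
  obtain ⟨a, ha⟩ := hU1.exists_is_const_of_deriv_eq_zero hU1c hd h0
  have hlim : Tendsto (fun σ : ℝ => zs K σ * Complex.exp (-ell K σ)) atTop (𝓝 1) := by
    have l1 := DS_lim (fun I : II K => II_pos I) (fun _ => zero_le_one) (zs_h (K := K))
    have l2 := DS_lim nq_one ell_c (ell_h (K := K))
    have t1 : (∑' I : II K, if Ideal.absNorm I.1 = 1 then (((1:ℝ)):ℂ) else 0) = 1 := by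
      rw [tsum_eq_single ⟨⊤, top_ne_bot⟩]
      · simp
      · intro I hI
        rw [if_neg]
        rw [Ideal.absNorm_eq_one_iff]
        exact fun h => hI (Subtype.ext h)
    have t2 : (∑' q : QQ K, if nq' q = 1 then ((1 / ((q.2 : ℝ) + 1) : ℝ) : ℂ) else 0) = 0 := by
      exact (tsum_congr fun q => if_neg (by have := nq_two q; omega)).trans tsum_zero
    rw [t1] at l1; rw [t2] at l2
    rw [← zs_DS] at l1
    have := l1.mul (Complex.continuous_exp.continuousAt.tendsto.comp l2.neg)
    simp only [neg_zero, Complex.exp_zero, mul_one] at this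
    exact this
  have ha1 : a = 1 := by
    refine tendsto_nhds_unique (Tendsto.congr' ?_ tendsto_const_nhds) hlim
    filter_upwards [eventually_gt_atTop 1] with σ hσ
    exact (ha _ (by simpa using hσ)).symm
  have := ha s h
  rw [ha1, Complex.exp_neg] at this
  field_simp [Complex.exp_ne_zero] at this
  exact this
end MRH

namespace MRH
open MeasureTheory Real NumberField Module Set Filter Topology Asymptotics
variable {K : Type*} [Field K] [NumberField K]

def B2 : ℝ := ∑' n : ℕ, (n : ℝ) ^ (-2:ℝ)

lemma B2_nonneg : 0 ≤ B2 := tsum_nonneg fun n => by positivity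

lemma ell_bound {s : ℂ} (h : 2 ≤ s.re) : ‖ell K s‖ ≤ finrank ℚ K * B2 := by
  have h1 : 1 < s.re := by linarith
  refine (DS_norm_le nq_one ell_c (ell_h (K := K)) h1).trans (le_trans ?_ (q_tsum_le (K := K) (by norm_num : (1:ℝ) < 2)))
  refine Summable.tsum_le_tsum (fun q => ?_) (ell_h _ h1) (q_summable (by norm_num))
  have h2 : 1 / ((q.2 : ℝ) + 1) ≤ 1 := by
    rw [div_le_one (by positivity)]; linarith [(Nat.cast_nonneg q.2 : (0:ℝ) ≤ q.2)]
  have h3 : (1:ℝ) ≤ nq' q := by exact_mod_cast nq_one q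
  have h4 : (nq' q : ℝ) ^ (-s.re) ≤ (nq' q : ℝ) ^ (-2:ℝ) := rpow_le_rpow_of_exponent_le h3 (by linarith)
  have h5 : 0 ≤ (nq' q : ℝ) ^ (-s.re) := by positivity
  nlinarith

lemma zs_upper {s : ℂ} (h : 2 ≤ s.re) : ‖zs K s‖ ≤ rexp (finrank ℚ K * B2) := by
  rw [zs_exp (by linarith), Complex.norm_exp]
  exact exp_le_exp.mpr ((Complex.re_le_norm _).trans (ell_bound h))

lemma zs_lower {s : ℂ} (h : 2 ≤ s.re) : rexp (-(finrank ℚ K * B2)) ≤ ‖zs K s‖ := by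
  rw [zs_exp (by linarith), Complex.norm_exp]
  refine exp_le_exp.mpr ?_
  have h1 := ell_bound (K := K) h
  have h2 := (abs_le.mp (Complex.abs_re_le_norm (ell K s))).1
  linarith

lemma zs_ne {s : ℂ} (h : 1 < s.re) : zs K s ≠ 0 := by
  rw [zs_exp h]; exact Complex.exp_ne_zero _

lemma ell_re {σ t : ℝ} (h : 1 < σ) : HasSum (fun q : QQ K => 1 / ((q.2 : ℝ) + 1) * (rexp (-σ * log (nq' q)) * Real.cos (t * log (nq' q)))) (ell K (σ + t * Complex.I)).re := by
  have h1 := Complex.hasSum_re (DS_summable nq_one ell_c (ell_h (K := K)) (s := σ + t * Complex.I) (by simpa using h)).hasSum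
  refine h1.congr_fun ?_
  intro q
  rw [Complex.re_ofReal_mul]
  congr 1
  have : (nq' q : ℂ) ≠ 0 := by have := nq_one q; exact_mod_cast (by omega : nq' q ≠ 0)
  rw [Complex.cpow_def_of_ne_zero this, ← Complex.natCast_log, Complex.exp_re]
  simp only [Complex.mul_re, Complex.mul_im, Complex.neg_re, Complex.neg_im, Complex.add_re, Complex.add_im, Complex.ofReal_re, Complex.ofReal_im, Complex.I_re, Complex.I_im]
  rw [← Real.cos_neg (t * _)]
  ring_nf

lemma three_four_one {σ : ℝ} (t : ℝ) (h : 1 < σ) :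
    0 ≤ 3 * (ell K (σ + (0:ℝ) * Complex.I)).re + 4 * (ell K (σ + t * Complex.I)).re + (ell K (σ + (2 * t : ℝ) * Complex.I)).re := by
  have := (((ell_re (K := K) (t := 0) h).mul_left 3).add ((ell_re (K := K) (t := t) h).mul_left 4)).add (ell_re (K := K) (t := 2 * t) h)
  refine this.nonneg fun q => ?_
  rw [zero_mul, Real.cos_zero, mul_assoc 2 t, Real.cos_two_mul]
  set u := Real.cos (t * log (nq' q))
  have e : 3 * (1 / ((q.2 : ℝ) + 1) * (rexp (-σ * log (nq' q)) * 1)) + 4 * (1 / ((q.2 : ℝ) + 1) * (rexp (-σ * log (nq' q)) * u)) + 1 / ((q.2 : ℝ) + 1) * (rexp (-σ * log (nq' q)) * (2 * u ^ 2 - 1))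
    = 1 / ((q.2 : ℝ) + 1) * rexp (-σ * log (nq' q)) * (2 * (1 + u) ^ 2) := by ring
  rw [e]; positivity

lemma zs_prod {σ : ℝ} (t : ℝ) (h : 1 < σ) :
    1 ≤ ‖zs K (σ + (0:ℝ) * Complex.I)‖ ^ 3 * ‖zs K (σ + t * Complex.I)‖ ^ 4 * ‖zs K (σ + (2 * t : ℝ) * Complex.I)‖ := by
  rw [zs_exp (by simpa using h), zs_exp (by simpa using h), zs_exp (by simpa using h)]
  simp only [Complex.norm_exp, ← Real.exp_nat_mul, ← Real.exp_add]
  rw [Real.one_le_exp_iff]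
  exact_mod_cast three_four_one t h

lemma Z_re_one {Z : ℂ → ℂ} (hd : Differentiable ℂ Z) (h1 : Z 1 ≠ 0) (hZ : ∀ s : ℂ, 1 < s.re → Z s = (s - 1) * zs K s)
    (t : ℝ) : Z (1 + t * Complex.I) ≠ 0 := by
  by_cases ht : t = 0
  · simpa [ht] using h1
  intro h0
  set s0 : ℂ := 1 + t * Complex.I with hs0
  have key : ∀ ε : ℝ, 0 < ε → ‖(ε : ℂ) + t * Complex.I‖ ^ 4 * ‖(ε : ℂ) + (2 * t : ℝ) * Complex.I‖ ≤
      ε * (‖Z ((1 + ε : ℝ) + (0:ℝ) * Complex.I)‖ ^ 3 * ‖dslope Z s0 (s0 + ε)‖ ^ 4 * ‖Z ((1 + ε : ℝ) + (2 * t : ℝ) * Complex.I)‖) := by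
    intro ε hε
    have hp := zs_prod (K := K) t (by linarith : (1:ℝ) < 1 + ε)
    have hk : ∀ u : ℝ, ‖Z ((1 + ε : ℝ) + u * Complex.I)‖ = ‖(ε : ℂ) + u * Complex.I‖ * ‖zs K ((1 + ε : ℝ) + u * Complex.I)‖ := fun u => by
      rw [hZ _ (by simpa using hε), norm_mul]; congr 2; push_cast; ring
    have hds : ‖Z ((1 + ε : ℝ) + t * Complex.I)‖ = ε * ‖dslope Z s0 (s0 + ε)‖ := by
      have := sub_smul_dslope Z s0 (s0 + ε)
      rw [h0, sub_zero] at this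
      have e : ((1 + ε : ℝ) : ℂ) + t * Complex.I = s0 + ε := by rw [hs0]; push_cast; ring
      rw [e, ← this, norm_smul]; simp [abs_of_pos hε]
    have h00 : ‖(ε : ℂ) + (0:ℝ) * Complex.I‖ = ε := by simp [abs_of_pos hε]
    have e1 := hk 0
    have e2 := hk t
    have e3 := hk (2 * t)
    rw [h00] at e1
    rw [hds] at e2
    generalize ‖dslope Z s0 (s0 + ε)‖ = G at *
    generalize ‖zs K ((1 + ε : ℝ) + (0:ℝ) * Complex.I)‖ = a at *
    generalize ‖zs K ((1 + ε : ℝ) + t * Complex.I)‖ = b at *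
    generalize ‖zs K ((1 + ε : ℝ) + (2 * t:ℝ) * Complex.I)‖ = c at *
    have hx : 0 ≤ ‖(ε : ℂ) + t * Complex.I‖ := norm_nonneg _
    have hy : 0 ≤ ‖(ε : ℂ) + (2 * t : ℝ) * Complex.I‖ := norm_nonneg _
    generalize ‖(ε : ℂ) + t * Complex.I‖ = x at *
    generalize ‖(ε : ℂ) + (2 * t : ℝ) * Complex.I‖ = y at *
    rw [e1, e3]
    have e4 : ε * ((ε * a) ^ 3 * G ^ 4 * (y * c)) = (ε * G) ^ 4 * a ^ 3 * (y * c) := by ring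
    rw [e4, e2]
    have := mul_le_mul_of_nonneg_left hp (by positivity : 0 ≤ x ^ 4 * y)
    nlinarith
  have hc := hd.continuous
  have l1 : Tendsto (fun ε : ℝ => ‖(ε : ℂ) + t * Complex.I‖ ^ 4 * ‖(ε : ℂ) + (2 * t : ℝ) * Complex.I‖) (𝓝[>] 0) (𝓝 (‖((0:ℝ) : ℂ) + t * Complex.I‖ ^ 4 * ‖((0:ℝ) : ℂ) + (2 * t : ℝ) * Complex.I‖)) :=
    (Continuous.tendsto (by fun_prop) 0).mono_left nhdsWithin_le_nhds
  have l2 : Tendsto (fun ε : ℝ => ε * (‖Z ((1 + ε : ℝ) + (0:ℝ) * Complex.I)‖ ^ 3 * ‖dslope Z s0 (s0 + ε)‖ ^ 4 * ‖Z ((1 + ε : ℝ) + (2 * t : ℝ) * Complex.I)‖)) (𝓝[>] 0) (𝓝 (0 * (‖Z ((1 + (0:ℝ) : ℝ) + (0:ℝ) * Complex.I)‖ ^ 3 * ‖dslope Z s0 (s0 + (0:ℝ))‖ ^ 4 * ‖Z ((1 + (0:ℝ) : ℝ) + (2 * t : ℝ) * Complex.I)‖))) := by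
    refine Tendsto.mono_left ?_ nhdsWithin_le_nhds
    have hds : ContinuousAt (fun ε : ℝ => dslope Z s0 (s0 + ε)) 0 := by
      have : ContinuousAt (dslope Z s0) (s0 + (0:ℝ)) := by
        simpa using continuousAt_dslope_same.mpr (hd s0)
      exact ContinuousAt.comp (f := fun ε : ℝ => s0 + (ε:ℂ)) this (by fun_prop)
    have c1 : ContinuousAt (fun ε : ℝ => Z ((1 + ε : ℝ) + (0:ℝ) * Complex.I)) 0 := by fun_prop
    have c2 : ContinuousAt (fun ε : ℝ => Z ((1 + ε : ℝ) + (2 * t:ℝ) * Complex.I)) 0 := by fun_prop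
    exact tendsto_id.mul (((c1.norm.pow 3).mul (hds.norm.pow 4)).mul c2.norm)
  have := le_of_tendsto_of_tendsto l1 l2 (eventually_nhdsWithin_of_forall fun ε hε => key ε hε)
  rw [zero_mul] at this
  have h3 : 0 < ‖((0:ℝ) : ℂ) + t * Complex.I‖ ^ 4 * ‖((0:ℝ) : ℂ) + (2 * t : ℝ) * Complex.I‖ := by
    have : (t:ℂ) ≠ 0 := by exact_mod_cast ht
    have a1 : ((0:ℝ) : ℂ) + t * Complex.I ≠ 0 := by simp [ht]
    have a2 : ((0:ℝ) : ℂ) + (2 * t : ℝ) * Complex.I ≠ 0 := by simp [ht]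
    positivity
  linarith

lemma logder_bound {Z : ℂ → ℂ} (hd : Differentiable ℂ Z) (c : ℂ) {M : ℝ} (hM : 0 < M)
    (hne : ∀ w ∈ Metric.ball c (3/2), Z w ≠ 0) (hb : ∀ w ∈ Metric.ball c (3/2), ‖Z w‖ ≤ rexp M * ‖Z c‖)
    {s : ℂ} (hs : ‖s - c‖ ≤ 5/4) : ‖deriv Z s / Z s‖ ≤ 176 * M := by
  have hcc : c ∈ Metric.ball c (3/2 : ℝ) := Metric.mem_ball_self (by norm_num)
  have hdd : DifferentiableOn ℂ (fun w => deriv Z w / Z w) (Metric.ball c (3/2)) :=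
    hd.deriv.differentiableOn.div hd.differentiableOn hne
  obtain ⟨g, hg0, hg⟩ := hdd.isExactOn_ball.with_val_at c 0
  have hgd : DifferentiableOn ℂ g (Metric.ball c (3/2)) := fun w hw => (hg w hw).differentiableAt.differentiableWithinAt
  have hZg : ∀ w ∈ Metric.ball c (3/2 : ℝ), Z w * Complex.exp (-g w) = Z c := by
    have h0 : EqOn (deriv (fun w => Z w * Complex.exp (-g w))) 0 (Metric.ball c (3/2)) := by
      intro w hw
      have := ((hd w).hasDerivAt.mul (hg w hw).neg.cexp).deriv
      refine Eq.trans this ?_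
      have := hne w hw
      simp only [Pi.zero_apply, Pi.neg_apply]; field_simp; ring
    obtain ⟨a, ha⟩ := Metric.isOpen_ball.exists_is_const_of_deriv_eq_zero (convex_ball c _).isPreconnected (hd.differentiableOn.mul hgd.neg.cexp) h0
    intro w hw
    refine (ha w hw).trans ((ha c hcc).symm.trans ?_)
    change Z c * Complex.exp (-g c) = Z c
    rw [hg0]; simp
  have hre : ∀ w ∈ Metric.ball c (3/2 : ℝ), (g w).re ≤ M := by
    intro w hw
    have h1 := hb w hw
    rw [← hZg w hw, norm_mul, Complex.norm_exp, Complex.neg_re] at h1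
    have h2 : 0 < ‖Z w‖ := norm_pos_iff.mpr (hne w hw)
    have h3 : 1 ≤ rexp (M - (g w).re) := by
      rw [sub_eq_add_neg, Real.exp_add]
      by_contra! h
      nlinarith
    have := Real.one_le_exp_iff.mp h3
    linarith
  have hgb : ∀ w, ‖w - c‖ ≤ 11/8 → ‖g w‖ ≤ 22 * M := by
    intro w hw
    have hmaps : MapsTo (fun z => c + z) (Metric.ball (0:ℂ) (3/2)) (Metric.ball c (3/2)) := fun z hz => by
      simpa using hz
    have h1 := Complex.borelCaratheodory_zero (f := fun z => g (c + z)) (R := 3/2) (z := w - c) hM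
      (hgd.comp (by fun_prop) hmaps) (fun z hz => hre _ (hmaps hz)) (by norm_num) (by simp; linarith) (by simpa using hg0)
    simp only [add_sub_cancel] at h1
    refine h1.trans ?_
    rw [div_le_iff₀ (by linarith)]
    nlinarith [norm_nonneg (w - c)]
  have hsb : s ∈ Metric.ball c (3/2) := by rw [Metric.mem_ball, dist_eq_norm]; linarith
  rw [← (hg s hsb).deriv]
  have hcl : ∀ w ∈ Metric.closedBall s (1/8), ‖w - c‖ ≤ 11/8 := fun w hw => by
    rw [Metric.mem_closedBall, dist_eq_norm] at hw
    calc ‖w - c‖ = ‖(w - s) + (s - c)‖ := by ring_nf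
      _ ≤ _ := norm_add_le _ _
      _ ≤ 11/8 := by linarith
  have := Complex.norm_deriv_le_of_forall_mem_sphere_norm_le (f := g) (c := s) (R := 1/8) (C := 22 * M) (by norm_num)
    (DifferentiableOn.diffContOnCl (by
      rw [closure_ball _ (by norm_num)]
      exact hgd.mono fun w hw => by rw [Metric.mem_ball, dist_eq_norm]; linarith [hcl w hw]))
    (fun w hw => hgb w (hcl w (Metric.sphere_subset_closedBall hw)))
  linarith

end MRH

namespace MRH
open MeasureTheory Real NumberField Module Set Filter Topology Asymptotics

lemma Z_nonvanish (hG : DedekindGRH) (K : Type) [Field K] [NumberField K] {Z : ℂ → ℂ} (hd : Differentiable ℂ Z) (h1 : Z 1 ≠ 0)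
    (hZ : ∀ s : ℂ, 1 < s.re → Z s = (s - 1) * zs K s) {s : ℂ} (hs : 1 / 2 < s.re) : Z s ≠ 0 := by
  rcases lt_trichotomy s.re 1 with h | h | h
  · intro h0
    have := hG K (fun s => Z s / (s - 1)) ⟨fun s hs => ?_, fun s hs => ?_⟩ s (by simp [h0]) (by linarith) h
    · linarith
    · have h2 : s - 1 ≠ 0 := sub_ne_zero.mpr hs
      have h3 : DifferentiableAt ℂ (fun s : ℂ => s - 1) s := by fun_prop
      exact (DifferentiableAt.fun_div (hd s) h3 h2).differentiableWithinAt
    · have : s - 1 ≠ 0 := sub_ne_zero.mpr fun h => by simp [h] at hs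
      beta_reduce
      rw [hZ s hs]; field_simp; rfl
  · have := Z_re_one hd h1 hZ s.im
    have e : s = 1 + s.im * Complex.I := by apply Complex.ext <;> simp [h]
    rwa [← e] at this
  · rw [hZ s h]
    exact mul_ne_zero (sub_ne_zero.mpr fun h' => by simp [h'] at h) (zs_ne h)

def FGood (K : Type) [Field K] [NumberField K] (M : ℝ) (F : ℂ → ℂ) : Prop :=
  DifferentiableOn ℂ F {s | 1 / 2 < s.re} ∧ (∀ s : ℂ, 1 < s.re → F s = LL K s - 1 / (s - 1)) ∧
  ∀ s : ℂ, 3 / 4 ≤ s.re → s.re ≤ 2 → ‖F s‖ ≤ M * (1 + |s.im|)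

set_option maxHeartbeats 1000000 in
theorem F_exists (hG : DedekindGRH) : ∃ A > 0, ∀ (K : Type) [Field K] [NumberField K], ∃ F : ℂ → ℂ,
    FGood K (A * (finrank ℚ K + log (DD K))) F := by
  obtain ⟨A, hA, H⟩ := Z_exists
  refine ⟨176 * (3 * A + 2 * B2 + 2), by have := B2_nonneg; positivity, fun K _ _ => ?_⟩
  obtain ⟨Z, hd, h1, hZ, hb⟩ := H K
  have hne : ∀ s : ℂ, 1 / 2 < s.re → Z s ≠ 0 := fun s hs => Z_nonvanish hG K hd h1 hZ hs
  refine ⟨fun s => -(deriv Z s / Z s), ?_, ?_, ?_⟩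
  · exact (hd.deriv.differentiableOn.div hd.differentiableOn fun s hs => hne s hs).neg
  · intro s hs
    have e : deriv Z s = 1 * zs K s + (s - 1) * deriv (zs K) s := by
      have h2 : Z =ᶠ[𝓝 s] fun s => (s - 1) * zs K s := by
        filter_upwards [hU1.mem_nhds hs] with w hw using hZ w hw
      rw [h2.deriv_eq]
      exact (((hasDerivAt_id s).sub_const 1).mul ((zs_diff (K := K)).hasDerivAt (hU1.mem_nhds hs))).deriv
    have h3 : s - 1 ≠ 0 := sub_ne_zero.mpr fun h => by simp [h] at hs
    have h4 := zs_ne (K := K) hs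
    beta_reduce
    rw [e, zs_deriv hs, hZ s hs]
    field_simp
    ring
  · intro s hs1 hs2
    beta_reduce
    rw [norm_neg]
    set d : ℝ := ((finrank ℚ K : ℕ) : ℝ) with hdd
    have hd1 : 1 ≤ d := by rw [hdd]; exact_mod_cast (finrank_pos : 0 < finrank ℚ K)
    have hl : 0 ≤ log (DD K) := log_nonneg DD_one
    have hB := B2_nonneg
    have hD := DD_pos (K := K)
    set M : ℝ := 2 * (d * B2) + 2 * log (DD K) + A * d * (5 / 2 + |s.im|) + d with hM
    have hMpos : 0 < M := by positivity
    have hc2 : (2 + s.im * Complex.I : ℂ).re = 2 := by simp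
    refine (logder_bound hd (2 + s.im * Complex.I) hMpos ?_ ?_ ?_).trans ?_
    · intro w hw
      refine hne w ?_
      rw [Metric.mem_ball, dist_eq_norm] at hw
      have := (abs_le.mp ((Complex.abs_re_le_norm _).trans hw.le)).1
      have h2 := (abs_lt.mp (lt_of_le_of_lt (Complex.abs_re_le_norm _) hw)).1
      rw [Complex.sub_re, hc2] at h2
      linarith
    · intro w hw
      rw [Metric.mem_ball, dist_eq_norm] at hw
      have h2 := (abs_lt.mp (lt_of_le_of_lt (Complex.abs_re_le_norm _) hw))
      have h3 := lt_of_le_of_lt (Complex.abs_im_le_norm _) hw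
      rw [Complex.sub_re, hc2] at h2
      have h4 : |w.im| ≤ |s.im| + 3 / 2 := by
        have : (w - (2 + s.im * Complex.I)).im = w.im - s.im := by simp
        rw [this] at h3
        have := abs_sub_abs_le_abs_sub w.im s.im
        linarith
      have h5 := hb w (by linarith) (by linarith)
      have h6 : ‖zs K 4‖ ≤ rexp (d * B2) := zs_upper (by simp; norm_num)
      have h7 : rexp (-(d * B2)) ≤ ‖Z (2 + s.im * Complex.I)‖ := by
        rw [hZ _ (by rw [hc2]; norm_num), norm_mul]
        have e1 := zs_lower (K := K) (s := 2 + s.im * Complex.I) (by rw [hc2])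
        have e2 : 1 ≤ ‖(2 + s.im * Complex.I : ℂ) - 1‖ := by
          refine le_trans ?_ (Complex.abs_re_le_norm _)
          simp; norm_num
        refine e1.trans (le_mul_of_one_le_left (norm_nonneg _) e2)
      have h8 : DD K ^ 2 = rexp (2 * log (DD K)) := by
        rw [mul_comm, Real.exp_mul, Real.exp_log hD]; norm_cast
      calc ‖Z w‖ ≤ ‖zs K 4‖ * DD K ^ 2 * rexp (A * d * (1 + |w.im|)) := h5
        _ ≤ rexp (d * B2) * rexp (2 * log (DD K)) * rexp (A * d * (1 + (|s.im| + 3 / 2))) := by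
          rw [h8]
          refine mul_le_mul (mul_le_mul_of_nonneg_right h6 (by positivity)) (exp_le_exp.mpr ?_) (by positivity) (by positivity)
          exact mul_le_mul_of_nonneg_left (by linarith) (by positivity)
        _ ≤ rexp M * rexp (-(d * B2)) := by
          rw [← Real.exp_add, ← Real.exp_add, ← Real.exp_add]
          apply exp_le_exp.mpr
          rw [hM]; nlinarith
        _ ≤ _ := mul_le_mul_of_nonneg_left h7 (by positivity)
    · have e : s - (2 + s.im * Complex.I) = ((s.re - 2 : ℝ) : ℂ) := by apply Complex.ext <;> simp
      rw [e, Complex.norm_real, Real.norm_eq_abs, abs_le]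
      constructor <;> linarith
    · have e0 := abs_nonneg s.im
      rw [hM]
      have : 0 ≤ d * |s.im| := by positivity
      have : 0 ≤ A * d := by positivity
      have : 0 ≤ A * (d * |s.im|) := by positivity
      have : 0 ≤ d * B2 := by positivity
      have : 0 ≤ B2 * (d * |s.im|) := by positivity
      have : 0 ≤ log (DD K) * |s.im| := by positivity
      have : 0 ≤ A * log (DD K) := by positivity
      have : 0 ≤ A * (log (DD K) * |s.im|) := by positivity
      have : 0 ≤ B2 * log (DD K) := by positivity
      have : 0 ≤ B2 * (log (DD K) * |s.im|) := by positivity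
      nlinarith
end MRH

namespace MRH
open MeasureTheory Real NumberField Module Set Filter Topology Asymptotics
open scoped FourierTransform

lemma lap_norm (n : ℕ) (s : ℂ) {u : ℝ} (hu : 0 < u) : ‖(u:ℂ) ^ n * Complex.exp (-(s * u))‖ = u ^ (n:ℝ) * rexp (-s.re * u) := by
  rw [norm_mul, norm_pow, Complex.norm_real, Complex.norm_exp, norm_of_nonneg hu.le, rpow_natCast]
  congr 2; simp

lemma lap_int (n : ℕ) {s : ℂ} (hs : 0 < s.re) : IntegrableOn (fun u : ℝ => (u:ℂ) ^ n * Complex.exp (-(s * u))) (Ioi 0) := by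
  have h := integrableOn_rpow_mul_exp_neg_mul_rpow (s := n) (p := 1) (b := s.re) (by linarith [(Nat.cast_nonneg n : (0:ℝ) ≤ n)]) one_pos hs
  refine Integrable.mono' h (by fun_prop) ?_
  refine (ae_restrict_iff' measurableSet_Ioi).mpr (Eventually.of_forall fun u hu => ?_)
  rw [lap_norm n s hu, rpow_one]

lemma lap_lim (n : ℕ) {s : ℂ} (hs : 0 < s.re) : Tendsto (fun u : ℝ => (u:ℂ) ^ n * Complex.exp (-(s * u))) atTop (𝓝 0) := by
  rw [tendsto_zero_iff_norm_tendsto_zero]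
  refine (tendsto_rpow_mul_exp_neg_mul_atTop_nhds_zero n s.re hs).congr' ?_
  filter_upwards [eventually_gt_atTop 0] with u hu
  rw [lap_norm n s hu]

lemma lap (n : ℕ) {s : ℂ} (hs : 0 < s.re) : ∫ u : ℝ in Ioi 0, (u:ℂ) ^ n * Complex.exp (-(s * u)) = n.factorial / s ^ (n + 1) := by
  have hs0 : s ≠ 0 := fun h => by simp [h] at hs
  induction n with
  | zero =>
    have := integral_exp_mul_complex_Ioi (a := -s) (by simpa using hs) 0
    simp only [pow_zero, one_mul, ← neg_mul]
    rw [this]; simp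
  | succ n ih =>
    have hd : ∀ u ∈ Ici (0:ℝ), HasDerivAt (fun u : ℝ => (u:ℂ) ^ (n + 1) * Complex.exp (-(s * u)))
        ((n + 1 : ℂ) * ((u:ℂ) ^ n * Complex.exp (-(s * u))) - s * ((u:ℂ) ^ (n + 1) * Complex.exp (-(s * u)))) u := by
      intro u _
      have h1 : HasDerivAt (fun u : ℝ => (u:ℂ)) 1 u := Complex.ofRealCLM.hasDerivAt
      have := (h1.pow (n + 1)).mul ((h1.const_mul s).neg.cexp)
      refine this.congr_deriv ?_
      simp only [Nat.add_sub_cancel, Pi.neg_apply, Pi.pow_apply]; push_cast; ring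
    have hi := ((lap_int n hs).const_mul (n + 1 : ℂ)).sub ((lap_int (n + 1) hs).const_mul s)
    have := integral_Ioi_of_hasDerivAt_of_tendsto' hd hi (lap_lim (n + 1) hs)
    rw [integral_sub ((lap_int n hs).const_mul (n + 1 : ℂ)) ((lap_int (n + 1) hs).const_mul s), integral_const_mul, integral_const_mul, ih] at this
    simp only [Complex.ofReal_zero, ne_eq, Nat.add_eq_zero_iff, one_ne_zero, and_false, not_false_eq_true, zero_pow, zero_mul, sub_zero] at this
    have e : ∫ u : ℝ in Ioi 0, (u:ℂ) ^ (n + 1) * Complex.exp (-(s * u)) = ((n + 1 : ℂ) * (n.factorial / s ^ (n + 1))) / s := by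
      rw [eq_div_iff hs0]; linear_combination -this
    rw [e, Nat.factorial_succ]; push_cast; field_simp; ring

def ln (σ y : ℝ) : ℂ := σ + (2 * π * y : ℝ) * Complex.I
lemma ln_re (σ y : ℝ) : (ln σ y).re = σ := by simp [ln]
lemma ln_im (σ y : ℝ) : (ln σ y).im = 2 * π * y := by simp [ln]
lemma ln_cont (σ : ℝ) : Continuous (ln σ) := by unfold ln; fun_prop

lemma lap_inv {φ : ℝ → ℂ} (hφ : Continuous φ) (h0 : φ 0 = 0) {G : ℂ → ℂ}
    (hi : IntegrableOn (fun u : ℝ => φ u * Complex.exp (-(2 * u))) (Ioi 0))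
    (hG : ∀ s : ℂ, s.re = 2 → ∫ u : ℝ in Ioi 0, φ u * Complex.exp (-(s * u)) = G s)
    (hGi : Integrable (fun y : ℝ => G (ln 2 y))) (T : ℝ) :
    ∫ y : ℝ, G (ln 2 y) * Complex.exp (ln 2 y * T) = φ (max T 0) := by
  set f : ℝ → ℂ := fun u => φ (max u 0) * Complex.exp (-(2 * u)) with hf
  have hfc : Continuous f := by fun_prop
  have hind : ∀ g : ℝ → ℂ, (fun u : ℝ => φ (max u 0) * g u) = (Ioi 0).indicator (fun u => φ u * g u) := by
    intro g
    funext u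
    by_cases hu : 0 < u
    · rw [indicator_of_mem (mem_Ioi.mpr hu), max_eq_left hu.le]
    · rw [indicator_of_notMem (by simpa using hu), max_eq_right (not_lt.mp hu), h0, zero_mul]
  have hfi : Integrable f := by
    rw [hf, hind]; exact (integrable_indicator_iff measurableSet_Ioi).mpr hi
  have hF : 𝓕 f = fun y => G (ln 2 y) := by
    funext y
    rw [Real.fourier_real_eq_integral_exp_smul, ← hG _ (ln_re 2 y), ← integral_indicator measurableSet_Ioi, ← hind]
    refine integral_congr_ae (Eventually.of_forall fun u => ?_)
    simp only [hf, smul_eq_mul, ln]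
    rw [mul_left_comm, ← Complex.exp_add]
    congr 2; push_cast; ring
  have h := congrFun (hfc.fourierInv_fourier_eq hfi (by rw [hF]; exact hGi)) T
  rw [Real.fourierInv_eq', hF] at h
  have h2 : ∫ y : ℝ, G (ln 2 y) * Complex.exp (ln 2 y * T) = Complex.exp (2 * T) * f T := by
    rw [← h, ← integral_const_mul]
    refine integral_congr_ae (Eventually.of_forall fun y => ?_)
    simp only [smul_eq_mul, ln]
    rw [← mul_assoc, ← Complex.exp_add, mul_comm]
    congr 2
    simp; ring
  rw [h2, hf]
  beta_reduce
  rw [mul_left_comm, ← Complex.exp_add]; simp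

lemma shift {f : ℂ → ℂ} {a b C : ℝ} (hab : a ≤ b) (hf : DifferentiableOn ℂ f {z | a ≤ z.re ∧ z.re ≤ b})
    (hb : ∀ z : ℂ, a ≤ z.re → z.re ≤ b → ‖f z‖ ≤ C * (1 + z.im ^ 2)⁻¹) :
    Integrable (fun y : ℝ => f (a + y * Complex.I)) ∧ Integrable (fun y : ℝ => f (b + y * Complex.I)) ∧
    ∫ y : ℝ, f (b + y * Complex.I) = ∫ y : ℝ, f (a + y * Complex.I) := by
  have hI : ∀ x : ℝ, a ≤ x → x ≤ b → Integrable (fun y : ℝ => f (x + y * Complex.I)) := by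
    intro x h1 h2
    refine Integrable.mono' (integrable_inv_one_add_sq.const_mul C) (Continuous.aestronglyMeasurable ?_) (Eventually.of_forall fun y => ?_)
    · exact hf.continuousOn.comp_continuous (by fun_prop) fun y => by simp [h1, h2]
    · simpa using hb (x + y * Complex.I) (by simpa using h1) (by simpa using h2)
  refine ⟨hI a le_rfl hab, hI b hab le_rfl, ?_⟩
  have lim : ∀ x : ℝ, a ≤ x → x ≤ b → Tendsto (fun n : ℕ => ∫ y in (-(n:ℝ))..n, f (x + y * Complex.I)) atTop (𝓝 (∫ y : ℝ, f (x + y * Complex.I))) := fun x h1 h2 =>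
    intervalIntegral_tendsto_integral (hI x h1 h2) (tendsto_neg_atTop_atBot.comp tendsto_natCast_atTop_atTop) tendsto_natCast_atTop_atTop
  have hz : ∀ e : ℝ, (e ^ 2 = 1) → Tendsto (fun n : ℕ => ∫ x in a..b, f (x + (e * n : ℝ) * Complex.I)) atTop (𝓝 0) := by
    intro e he
    refine squeeze_zero_norm (a := fun n : ℕ => (C * (1 + (n:ℝ) ^ 2)⁻¹) * |b - a|) (fun n => ?_) ?_
    · refine intervalIntegral.norm_integral_le_of_norm_le_const fun x hx => ?_
      rw [uIoc_of_le hab] at hx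
      have := hb (x + (e * n : ℝ) * Complex.I) (by simpa using hx.1.le) (by simpa using hx.2)
      have e2 : (x + (e * n : ℝ) * Complex.I : ℂ).im = e * n := by simp
      rwa [e2, mul_pow, he, one_mul] at this
    · have : Tendsto (fun n : ℕ => (1 + (n:ℝ) ^ 2)⁻¹) atTop (𝓝 0) := by
        refine tendsto_inv_atTop_zero.comp (tendsto_atTop_add_const_left _ _ ((tendsto_pow_atTop two_ne_zero).comp tendsto_natCast_atTop_atTop))
      simpa using (this.const_mul C).mul_const |b - a|
  have key : ∀ n : ℕ, (∫ y in (-(n:ℝ))..n, f (b + y * Complex.I)) - (∫ y in (-(n:ℝ))..n, f (a + y * Complex.I)) =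
      Complex.I * ((∫ x in a..b, f (x + (-1 * n : ℝ) * Complex.I)) - ∫ x in a..b, f (x + (1 * n : ℝ) * Complex.I)) := by
    intro n
    have h := Complex.integral_boundary_rect_eq_zero_of_differentiableOn f (a + (-1 * n : ℝ) * Complex.I) (b + (1 * n : ℝ) * Complex.I)
      (hf.mono fun z hz => by
        rw [Complex.mem_reProdIm] at hz
        have := hz.1
        simp only [Complex.add_re, Complex.ofReal_re, Complex.mul_re, Complex.I_re, mul_zero, Complex.ofReal_im, Complex.I_im, mul_one, sub_self, add_zero] at this
        rw [uIcc_of_le hab] at this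
        exact this)
    have r1 : (a + (-1 * n : ℝ) * Complex.I : ℂ).re = a := by simp
    have r2 : (b + (1 * n : ℝ) * Complex.I : ℂ).re = b := by simp
    have r3 : (a + (-1 * n : ℝ) * Complex.I : ℂ).im = -1 * n := by simp
    have r4 : (b + (1 * n : ℝ) * Complex.I : ℂ).im = 1 * n := by simp
    rw [r1, r2, r3, r4, smul_eq_mul, smul_eq_mul] at h
    have e1 : (-(n:ℝ)) = -1 * n := by ring
    have e2 : (∫ y in (-1 * n : ℝ)..n, f (b + y * Complex.I)) = (∫ y in (-1 * n : ℝ)..(1 * n), f (b + y * Complex.I)) := by rw [one_mul]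
    have e3 : (∫ y in (-1 * n : ℝ)..n, f (a + y * Complex.I)) = (∫ y in (-1 * n : ℝ)..(1 * n), f (a + y * Complex.I)) := by rw [one_mul]
    rw [e1, e2, e3]
    linear_combination (-Complex.I) * h + ((∫ y in (-1 * n : ℝ)..(1 * n), f (b + y * Complex.I)) - (∫ y in (-1 * n : ℝ)..(1 * n), f (a + y * Complex.I))) * Complex.I_mul_I
  have l1 := (lim b hab le_rfl).sub (lim a le_rfl hab)
  have l2 := ((hz (-1) (by norm_num)).sub (hz 1 (by norm_num))).const_mul Complex.I
  have := tendsto_nhds_unique (l1.congr key) l2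
  rw [sub_zero, mul_zero] at this
  exact sub_eq_zero.mp this
end MRH

namespace MRH
open MeasureTheory Real NumberField Module Set Filter Topology Asymptotics

def Kf (T : ℝ) : ℝ := (max T 0) ^ 2 / 2
def Ef (T : ℝ) : ℝ := rexp (max T 0) - 1 - max T 0 - (max T 0) ^ 2 / 2

lemma cube_bound {s : ℂ} (h : 3 / 4 ≤ s.re) : (1 + |s.im|) / ‖s‖ ^ 3 ≤ 4 * (1 + s.im ^ 2)⁻¹ := by
  have h1 : ‖s‖ ^ 2 = s.re ^ 2 + s.im ^ 2 := by rw [Complex.sq_norm, Complex.normSq_apply]; ring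
  have hs : 0 < ‖s‖ := by rw [norm_pos_iff]; rintro rfl; norm_num at h
  rw [← div_eq_mul_inv, div_le_div_iff₀ (by positivity) (by positivity)]
  have h2 : 9 / 16 * (1 + s.im ^ 2) ≤ ‖s‖ ^ 2 := by nlinarith [sq_nonneg s.im]
  refine (sq_le_sq₀ (by positivity) (by positivity)).mp ?_
  have h3 : (1 + |s.im|) ^ 2 ≤ 2 * (1 + s.im ^ 2) := by nlinarith [sq_nonneg (1 - |s.im|), sq_abs s.im]
  have h4 : (9 / 16 * (1 + s.im ^ 2)) ^ 3 ≤ (‖s‖ ^ 2) ^ 3 := pow_le_pow_left₀ (by positivity) h2 3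
  have h5 : (1 + |s.im|) ^ 2 * (1 + s.im ^ 2) ^ 2 ≤ 2 * (1 + s.im ^ 2) * (1 + s.im ^ 2) ^ 2 := mul_le_mul_of_nonneg_right h3 (by positivity)
  have h6 : 0 ≤ (1 + s.im ^ 2) ^ 3 := by positivity
  calc ((1 + |s.im|) * (1 + s.im ^ 2)) ^ 2 = (1 + |s.im|) ^ 2 * (1 + s.im ^ 2) ^ 2 := by ring
    _ ≤ 2 * (1 + s.im ^ 2) * (1 + s.im ^ 2) ^ 2 := h5
    _ ≤ 16 * (‖s‖ ^ 2) ^ 3 := by nlinarith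
    _ = (4 * ‖s‖ ^ 3) ^ 2 := by ring

lemma im_mono (y : ℝ) : (1 + (2 * π * y) ^ 2)⁻¹ ≤ (1 + y ^ 2)⁻¹ := by
  apply inv_anti₀ (by positivity)
  have : 1 ≤ (2 * π) ^ 2 := by nlinarith [pi_gt_three]
  nlinarith [sq_nonneg y]

lemma ln2_ne (y : ℝ) : ln 2 y ≠ 0 := fun h => by have := ln_re 2 y; simp [h] at this

lemma ln_cube (y : ℝ) : ‖1 / (ln 2 y) ^ 3‖ ≤ 4 * (1 + y ^ 2)⁻¹ := by
  have h := cube_bound (s := ln 2 y) (by rw [ln_re]; norm_num)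
  have hs : 0 < ‖ln 2 y‖ := norm_pos_iff.mpr (ln2_ne y)
  rw [norm_div, norm_pow, norm_one]
  refine le_trans ?_ (h.trans ?_)
  · gcongr; linarith [abs_nonneg (ln 2 y).im]
  · rw [ln_im]; linarith [im_mono y]

lemma cube_int : Integrable (fun y : ℝ => 1 / (ln 2 y) ^ 3) := by
  refine Integrable.mono' (integrable_inv_one_add_sq.const_mul 4) (Continuous.aestronglyMeasurable ?_) (Eventually.of_forall ln_cube)
  have := ln_cont 2
  exact continuous_const.div (this.pow 3) fun y => pow_ne_zero _ (ln2_ne y)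

lemma ln2_sub (y : ℝ) : 1 ≤ ‖ln 2 y - 1‖ := by
  refine le_trans ?_ (Complex.abs_re_le_norm _)
  rw [Complex.sub_re, ln_re]; norm_num

lemma cubeE_int : Integrable (fun y : ℝ => 1 / ((ln 2 y - 1) * (ln 2 y) ^ 3)) := by
  refine Integrable.mono' (integrable_inv_one_add_sq.const_mul 4) (Continuous.aestronglyMeasurable ?_) (Eventually.of_forall fun y => ?_)
  · have := ln_cont 2
    refine continuous_const.div (by fun_prop) fun y => mul_ne_zero (fun h => ?_) (pow_ne_zero _ (ln2_ne y))
    have := ln2_sub y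
    rw [h] at this; norm_num at this
  · refine le_trans ?_ (ln_cube y)
    have hs : 0 < ‖ln 2 y‖ := norm_pos_iff.mpr (ln2_ne y)
    rw [norm_div, norm_div, norm_mul, norm_pow]
    gcongr
    exact le_mul_of_one_le_left (by positivity) (ln2_sub y)

lemma kern2 (T : ℝ) : ∫ y : ℝ, 1 / (ln 2 y) ^ 3 * Complex.exp (ln 2 y * T) = (Kf T : ℂ) := by
  have h := lap_inv (φ := fun u => (u:ℂ) ^ 2 / 2) (G := fun s => 1 / s ^ 3) (by fun_prop) (by simp) ?_ ?_ cube_int T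
  · rw [h, Kf]; push_cast; rfl
  · refine ((lap_int 2 (s := 2) (by simp)).const_mul (1/2)).congr (Eventually.of_forall fun u => ?_)
    simp only []; ring
  · intro s hs
    have := lap 2 (s := s) (by rw [hs]; norm_num)
    rw [show (1 / s ^ 3 : ℂ) = 1 / 2 * ((Nat.factorial 2 : ℕ) / s ^ (2 + 1)) by norm_num [Nat.factorial]; ring, ← this, ← integral_const_mul]
    congr 1; funext u; ring

lemma kernE (T : ℝ) : ∫ y : ℝ, 1 / ((ln 2 y - 1) * (ln 2 y) ^ 3) * Complex.exp (ln 2 y * T) = (Ef T : ℂ) := by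
  have ex : ∀ (s : ℂ), (fun u : ℝ => (Complex.exp u - 1 - u - (u:ℂ) ^ 2 / 2) * Complex.exp (-(s * u))) =
      fun u : ℝ => (((u:ℂ) ^ 0 * Complex.exp (-((s - 1) * u)) - (u:ℂ) ^ 0 * Complex.exp (-(s * u))) - (u:ℂ) ^ 1 * Complex.exp (-(s * u))) - 1 / 2 * ((u:ℂ) ^ 2 * Complex.exp (-(s * u))) := by
    intro s; funext u
    have : Complex.exp (-((s - 1) * u)) = Complex.exp u * Complex.exp (-(s * u)) := by rw [← Complex.exp_add]; congr 1; ring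
    rw [this]; ring
  have i1 : ∀ s : ℂ, s.re = 2 → IntegrableOn (fun u : ℝ => (u:ℂ) ^ 0 * Complex.exp (-((s - 1) * u))) (Ioi 0) := fun s hs => lap_int 0 (by simp [hs])
  have i2 : ∀ n, ∀ s : ℂ, s.re = 2 → IntegrableOn (fun u : ℝ => (u:ℂ) ^ n * Complex.exp (-(s * u))) (Ioi 0) := fun n s hs => lap_int n (by simp [hs])
  have h := lap_inv (φ := fun u => Complex.exp u - 1 - u - (u:ℂ) ^ 2 / 2) (G := fun s => 1 / ((s - 1) * s ^ 3)) (by fun_prop) (by simp) ?_ ?_ cubeE_int T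
  · rw [h, Ef]; push_cast; rfl
  · rw [ex]
    exact (((i1 2 (by simp)).sub (i2 0 2 (by simp))).sub (i2 1 2 (by simp))).sub ((i2 2 2 (by simp)).const_mul _)
  · intro s hs
    have j1 : IntegrableOn (fun u : ℝ => (u:ℂ) ^ 0 * Complex.exp (-((s - 1) * u)) - (u:ℂ) ^ 0 * Complex.exp (-(s * u))) (Ioi 0) := (i1 s hs).sub (i2 0 s hs)
    have j2 : IntegrableOn (fun u : ℝ => (u:ℂ) ^ 0 * Complex.exp (-((s - 1) * u)) - (u:ℂ) ^ 0 * Complex.exp (-(s * u)) - (u:ℂ) ^ 1 * Complex.exp (-(s * u))) (Ioi 0) := j1.sub (i2 1 s hs)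
    rw [ex, integral_sub j2 ((i2 2 s hs).const_mul _), integral_sub j1 (i2 1 s hs),
      integral_sub (i1 s hs) (i2 0 s hs), integral_const_mul, lap 0 (by simp [hs]), lap 0 (by simp [hs]), lap 1 (by simp [hs]), lap 2 (by simp [hs])]
    have h1 : s ≠ 0 := fun h => by simp [h] at hs
    have h2 : s - 1 ≠ 0 := fun h => by rw [sub_eq_zero] at h; norm_num [h] at hs
    simp [Nat.factorial]; field_simp; ring

variable {K : Type} [Field K] [NumberField K]

instance : Countable (PP K) := by
  refine Function.Injective.countable (f := fun P : PP K => (⟨P.1, P.2.2⟩ : II K)) fun P Q h => ?_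
  exact Subtype.ext (congrArg (fun I : II K => I.1) h)

lemma term_eq (q : QQ K) (T y : ℝ) : ((log (np q.1) : ℝ) : ℂ) * (nq' q : ℂ) ^ (-ln 2 y) * (Complex.exp (ln 2 y * T) / (ln 2 y) ^ 3) =
    ((log (np q.1) : ℝ) : ℂ) * (1 / (ln 2 y) ^ 3 * Complex.exp (ln 2 y * (T - log (nq' q) : ℝ))) := by
  have : (nq' q : ℂ) ≠ 0 := by have := nq_one q; exact_mod_cast (by omega : nq' q ≠ 0)
  rw [Complex.cpow_def_of_ne_zero this, ← Complex.natCast_log, mul_assoc, ← mul_div_assoc, ← Complex.exp_add]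
  rw [show (Real.log (nq' q) : ℂ) * -ln 2 y + ln 2 y * T = ln 2 y * (T - log (nq' q) : ℝ) by push_cast; ring]
  ring

lemma exp_ln_int (T : ℝ) : Integrable (fun y : ℝ => 1 / (ln 2 y) ^ 3 * Complex.exp (ln 2 y * T)) := by
  refine Integrable.mono' (cube_int.norm.const_mul (rexp (2 * T))) ?_ (Eventually.of_forall fun y => ?_)
  · exact cube_int.aestronglyMeasurable.mul (Continuous.aestronglyMeasurable (by have := ln_cont 2; fun_prop))
  · rw [norm_mul, Complex.norm_exp, Complex.re_mul_ofReal, ln_re, mul_comm]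

lemma R_hasSum (T : ℝ) : HasSum (fun q : QQ K => ((log (np q.1) * Kf (T - log (nq' q)) : ℝ) : ℂ))
    (∫ y : ℝ, LL K (ln 2 y) * (Complex.exp (ln 2 y * T) / (ln 2 y) ^ 3)) := by
  have h := hasSum_integral_of_summable_integral_norm (μ := volume)
    (F := fun (q : QQ K) (y : ℝ) => ((log (np q.1) : ℝ) : ℂ) * (nq' q : ℂ) ^ (-ln 2 y) * (Complex.exp (ln 2 y * T) / (ln 2 y) ^ 3)) ?_ ?_
  · convert! h using 1
    · funext q
      simp_rw [term_eq]
      rw [integral_const_mul, kern2]; push_cast; rfl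
    · congr 1; funext y
      rw [tsum_mul_right]; rfl
  · intro q
    simp_rw [term_eq]
    exact (exp_ln_int _).const_mul _
  · have : ∀ (q : QQ K) (y : ℝ), ‖((log (np q.1) : ℝ) : ℂ) * (nq' q : ℂ) ^ (-ln 2 y) * (Complex.exp (ln 2 y * T) / (ln 2 y) ^ 3)‖ =
        (log (np q.1) * (nq' q : ℝ) ^ (-2:ℝ)) * ‖Complex.exp (ln 2 y * T) / (ln 2 y) ^ 3‖ := by
      intro q y
      rw [norm_mul, DS_norm_term (c := fun q : QQ K => log (np q.1)) nq_one LL_c q, ln_re]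
    simp_rw [this, integral_const_mul]
    exact (LL_h 2 (by norm_num)).mul_right _

lemma r_eq {F : ℂ → ℂ} (hF : ∀ s : ℂ, 1 < s.re → F s = LL K s - 1 / (s - 1)) (T : ℝ)
    (hi : Integrable (fun y : ℝ => F (ln 2 y) * (Complex.exp (ln 2 y * T) / (ln 2 y) ^ 3))) :
    HasSum (fun q : QQ K => log (np q.1) * Kf (T - log (nq' q))) (Ef T + (∫ y : ℝ, F (ln 2 y) * (Complex.exp (ln 2 y * T) / (ln 2 y) ^ 3)).re) := by
  have h1 := Complex.hasSum_re (R_hasSum (K := K) T)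
  simp only [Complex.ofReal_re] at h1
  convert! h1 using 1
  have h2 : Integrable (fun y : ℝ => 1 / ((ln 2 y - 1) * (ln 2 y) ^ 3) * Complex.exp (ln 2 y * T)) := by
    refine Integrable.mono' (cubeE_int.norm.const_mul (rexp (2 * T))) ?_ (Eventually.of_forall fun y => ?_)
    · exact cubeE_int.aestronglyMeasurable.mul (Continuous.aestronglyMeasurable (by have := ln_cont 2; fun_prop))
    · rw [norm_mul, Complex.norm_exp, Complex.re_mul_ofReal, ln_re, mul_comm]
  have h3 : ∫ y : ℝ, LL K (ln 2 y) * (Complex.exp (ln 2 y * T) / (ln 2 y) ^ 3) = (Ef T : ℂ) + ∫ y : ℝ, F (ln 2 y) * (Complex.exp (ln 2 y * T) / (ln 2 y) ^ 3) := by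
    rw [← kernE, ← integral_add h2 hi]
    congr 1; funext y
    rw [hF _ (by rw [ln_re]; norm_num)]
    have e1 := ln2_ne y
    have e2 : ln 2 y - 1 ≠ 0 := fun h => by have := ln2_sub y; rw [h] at this; norm_num at this
    field_simp; ring
  rw [h3, Complex.add_re, Complex.ofReal_re]

set_option maxHeartbeats 1000000 in
lemma r_bound {M : ℝ} (hM : 0 ≤ M) {F : ℂ → ℂ} (hF : FGood K M F) {T : ℝ} (hT : 0 ≤ T) :
    ∃ S, HasSum (fun q : QQ K => log (np q.1) * Kf (T - log (nq' q))) S ∧ |S - Ef T| ≤ 4 * π * M * rexp (3 / 4 * T) := by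
  obtain ⟨hd, he, hb⟩ := hF
  set f : ℂ → ℂ := fun z => F ((2 * π : ℝ) * z) * (Complex.exp ((2 * π : ℝ) * z * T) / ((2 * π : ℝ) * z) ^ 3) with hf
  have hpi := pi_pos
  have hre : ∀ z : ℂ, ((2 * π : ℝ) * z).re = 2 * π * z.re := fun z => Complex.re_ofReal_mul _ _
  have him : ∀ z : ℂ, ((2 * π : ℝ) * z).im = 2 * π * z.im := fun z => Complex.im_ofReal_mul _ _
  have hdom : ∀ z : ℂ, 3 / (8 * π) ≤ z.re → z.re ≤ 1 / π → 3 / 4 ≤ ((2 * π : ℝ) * z).re ∧ ((2 * π : ℝ) * z).re ≤ 2 := by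
    intro z h1 h2
    rw [hre]
    rw [div_le_iff₀ (by positivity)] at h1
    rw [le_div_iff₀ (by positivity)] at h2
    constructor <;> nlinarith
  have hbound : ∀ z : ℂ, 3 / (8 * π) ≤ z.re → z.re ≤ 1 / π → ‖f z‖ ≤ 4 * M * rexp (2 * π * z.re * T) * (1 + z.im ^ 2)⁻¹ := by
    intro z h1 h2
    obtain ⟨h3, h4⟩ := hdom z h1 h2
    have h5 := hb _ h3 h4
    have h6 := cube_bound h3
    rw [him] at h5 h6
    rw [hf]
    beta_reduce
    rw [norm_mul, norm_div, norm_pow, Complex.norm_exp, Complex.re_mul_ofReal, hre]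
    have h7 := im_mono z.im
    have h8 := Real.exp_pos (2 * π * z.re * T)
    generalize rexp (2 * π * z.re * T) = E at *
    calc _ ≤ M * (1 + |2 * π * z.im|) * (E / ‖((2 * π : ℝ) : ℂ) * z‖ ^ 3) := mul_le_mul_of_nonneg_right h5 (by positivity)
      _ = M * E * ((1 + |2 * π * z.im|) / ‖((2 * π : ℝ) : ℂ) * z‖ ^ 3) := by ring
      _ ≤ M * E * (4 * (1 + z.im ^ 2)⁻¹) := mul_le_mul_of_nonneg_left (by linarith) (by positivity)
      _ = _ := by ring
  have hab : 3 / (8 * π) ≤ 1 / π := by rw [div_le_div_iff₀ (by positivity) (by positivity)]; nlinarith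
  have hA : DifferentiableOn ℂ f {z | 3 / (8 * π) ≤ z.re ∧ z.re ≤ 1 / π} := by
    intro z hz
    obtain ⟨h3, h4⟩ := hdom z hz.1 hz.2
    have hU : IsOpen {s : ℂ | 1 / 2 < s.re} := isOpen_lt continuous_const Complex.continuous_re
    have h10 : (1:ℝ) / 2 < (((2 * π : ℝ) : ℂ) * z).re := by linarith
    have h5 : DifferentiableAt ℂ F ((2 * π : ℝ) * z) := hd.differentiableAt (hU.mem_nhds h10)
    have h6 : DifferentiableAt ℂ (fun z : ℂ => F ((2 * π : ℝ) * z)) z := DifferentiableAt.comp z h5 (by fun_prop)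
    have h7 : ((2 * π : ℝ) * z) ^ 3 ≠ 0 := pow_ne_zero _ fun h => by rw [h] at h3; norm_num at h3
    have h8 : DifferentiableAt ℂ (fun z : ℂ => Complex.exp ((2 * π : ℝ) * z * T)) z := by fun_prop
    have h9 : DifferentiableAt ℂ (fun z : ℂ => ((2 * π : ℝ) * z) ^ 3) z := by fun_prop
    exact (h6.mul (h8.fun_div h9 h7)).differentiableWithinAt
  have hB : ∀ z : ℂ, 3 / (8 * π) ≤ z.re → z.re ≤ 1 / π → ‖f z‖ ≤ (4 * M * rexp (2 * T)) * (1 + z.im ^ 2)⁻¹ := by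
    intro z h1 h2
    refine (hbound z h1 h2).trans ?_
    have := (hdom z h1 h2).2
    rw [hre] at this
    gcongr
  obtain ⟨i1, i2, i3⟩ := shift hab hA hB
  have e2 : ∀ y : ℝ, f ((1 / π : ℝ) + y * Complex.I) = F (ln 2 y) * (Complex.exp (ln 2 y * T) / (ln 2 y) ^ 3) := by
    intro y
    have : ((2 * π : ℝ) : ℂ) * ((1 / π : ℝ) + y * Complex.I) = ln 2 y := by
      have h0 : (π:ℂ) ≠ 0 := by exact_mod_cast hpi.ne'
      rw [ln]; push_cast; field_simp
    rw [hf]; beta_reduce; rw [this]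
  simp_rw [e2] at i2 i3
  refine ⟨_, r_eq he T i2, ?_⟩
  rw [add_sub_cancel_left, i3]
  refine (Complex.abs_re_le_norm _).trans ?_
  refine (norm_integral_le_of_norm_le (integrable_inv_one_add_sq.const_mul (4 * M * rexp (3 / 4 * T))) (Eventually.of_forall fun y => ?_)).trans ?_
  · have r1 : ((3 / (8 * π) : ℝ) + y * Complex.I : ℂ).re = 3 / (8 * π) := by
      rw [Complex.add_re, Complex.ofReal_re]; simp
    have r2 : ((3 / (8 * π) : ℝ) + y * Complex.I : ℂ).im = y := by
      rw [Complex.add_im, Complex.ofReal_im]; simp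
    have := hbound ((3 / (8 * π) : ℝ) + y * Complex.I) (by rw [r1]) (by rw [r1]; exact hab)
    rw [r1, r2, show 2 * π * (3 / (8 * π)) * T = 3 / 4 * T by field_simp; ring] at this
    exact this
  · rw [integral_const_mul, integral_univ_inv_one_add_sq]
    apply le_of_eq; ring
end MRH

namespace MRH
open MeasureTheory Real NumberField Module Set Filter Topology Asymptotics

lemma Kf_diff (u : ℝ) {h : ℝ} (hh : 0 < h) : Kf u - 2 * Kf (u - h) + Kf (u - 2 * h) ≤ if 0 ≤ u then h ^ 2 else 0 := by
  unfold Kf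
  split_ifs with h0
  · rcases le_total u h with h1 | h1
    · rw [max_eq_left h0, max_eq_right (by linarith : u - h ≤ 0), max_eq_right (by linarith : u - 2 * h ≤ 0)]; nlinarith
    rcases le_total u (2 * h) with h2 | h2
    · rw [max_eq_left h0, max_eq_left (by linarith : 0 ≤ u - h), max_eq_right (by linarith : u - 2 * h ≤ 0)]; nlinarith [sq_nonneg (u - 2 * h)]
    · rw [max_eq_left h0, max_eq_left (by linarith : 0 ≤ u - h), max_eq_left (by linarith : 0 ≤ u - 2 * h)]; nlinarith
  · rw [max_eq_right (by linarith : u ≤ 0), max_eq_right (by linarith : u - h ≤ 0), max_eq_right (by linarith : u - 2 * h ≤ 0)]; norm_num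

variable {K : Type} [Field K] [NumberField K]

lemma psi_summable (T : ℝ) : Summable (fun q : QQ K => if log (nq' q) ≤ T then log (np q.1) else 0) := by
  refine Summable.of_nonneg_of_le (fun q => ?_) (fun q => ?_) ((LL_h (K := K) 2 (by norm_num)).mul_left (rexp (2 * T)))
  · split_ifs; exacts [LL_c q, le_rfl]
  · have h1 : (0:ℝ) < nq' q := by exact_mod_cast nq_one q
    have h2 := LL_c q
    split_ifs with h
    · rw [mul_left_comm]
      refine le_mul_of_one_le_right h2 ?_
      rw [Real.rpow_def_of_pos h1, ← Real.exp_add]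
      exact Real.one_le_exp (by linarith)
    · positivity

def psi (K : Type) [Field K] [NumberField K] (T : ℝ) : ℝ := ∑' q : QQ K, if log (nq' q) ≤ T then log (np q.1) else 0

lemma exp_quad {h : ℝ} (h0 : 0 ≤ h) (h1 : h ≤ 1) : h ^ 2 - h ^ 3 ≤ (1 - rexp (-h)) ^ 2 := by
  have h2 : rexp (-h) ≤ 1 - h + h ^ 2 / 2 := by
    have := Real.quadratic_le_exp_of_nonneg h0
    rw [Real.exp_neg]
    refine inv_le_of_inv_le₀ (by nlinarith) ?_
    refine le_trans ?_ this
    rw [inv_le_iff_one_le_mul₀ (by nlinarith)]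
    nlinarith [sq_nonneg (h ^ 2)]
  have h3 : h - h ^ 2 / 2 ≤ 1 - rexp (-h) := by linarith
  have h4 : 0 ≤ h - h ^ 2 / 2 := by nlinarith
  have := pow_le_pow_left₀ h4 h3 2
  nlinarith [sq_nonneg (h ^ 2)]

theorem psi_lower {M : ℝ} (hM : 0 ≤ M) {F : ℂ → ℂ} (hF : FGood K M F) {T : ℝ} (hT : 2 ≤ T) :
    rexp T - (2 + 16 * π * M) * rexp (15 / 16 * T) ≤ psi K T := by
  set h := rexp (-(T / 16)) with hh
  have h0 : 0 < h := Real.exp_pos _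
  have h1 : h ≤ 1 := Real.exp_le_one_iff.mpr (by linarith)
  obtain ⟨S0, a0, b0⟩ := r_bound hM hF (T := T) (by linarith)
  obtain ⟨S1, a1, b1⟩ := r_bound hM hF (T := T - h) (by linarith)
  obtain ⟨S2, a2, b2⟩ := r_bound hM hF (T := T - 2 * h) (by linarith)
  have c1 : S0 - 2 * S1 + S2 ≤ h ^ 2 * psi K T := by
    refine hasSum_le (fun q => ?_) ((a0.sub (a1.mul_left 2)).add a2) ((psi_summable T).hasSum.mul_left (h ^ 2))
    have e1 := Kf_diff (T - log (nq' q)) h0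
    have e2 := mul_le_mul_of_nonneg_left e1 (LL_c q)
    rw [show T - h - log (nq' q) = T - log (nq' q) - h by ring, show T - 2 * h - log (nq' q) = T - log (nq' q) - 2 * h by ring]
    split_ifs at e2 ⊢ with g1 g2 g2
    · nlinarith
    · exact absurd (by linarith) g2
    · exact absurd (by linarith) g1
    · nlinarith
  have m : ∀ u, u ≤ T → 4 * π * M * rexp (3 / 4 * u) ≤ 4 * π * M * rexp (3 / 4 * T) := fun u hu => by
    have := Real.exp_le_exp.mpr (by linarith : 3 / 4 * u ≤ 3 / 4 * T)
    gcongr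
  have b1' := b1.trans (m _ (by linarith))
  have b2' := b2.trans (m _ (by linarith))
  rw [abs_le] at b0 b1' b2'
  have c2 : Ef T - 2 * Ef (T - h) + Ef (T - 2 * h) = rexp T * (1 - rexp (-h)) ^ 2 - h ^ 2 := by
    unfold Ef
    rw [max_eq_left (by linarith : 0 ≤ T), max_eq_left (by linarith : 0 ≤ T - h), max_eq_left (by linarith : 0 ≤ T - 2 * h),
      show T - h = T + -h by ring, show T - 2 * h = T + -h + -h by ring, Real.exp_add, Real.exp_add, Real.exp_add]
    ring
  have c3 := mul_le_mul_of_nonneg_left (exp_quad h0.le h1) (Real.exp_pos T).le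
  have e1 : rexp (3 / 4 * T) = h ^ 2 * rexp (7 / 8 * T) := by
    rw [hh, ← Real.exp_nat_mul, ← Real.exp_add]; congr 1; push_cast; ring
  have e2 : rexp T * h = rexp (15 / 16 * T) := by rw [hh, ← Real.exp_add]; congr 1; ring
  have e3 : rexp (7 / 8 * T) ≤ rexp (15 / 16 * T) := Real.exp_le_exp.mpr (by linarith)
  have e4 : 1 ≤ rexp (15 / 16 * T) := Real.one_le_exp (by linarith)
  have c4 : h ^ 2 * (rexp T - rexp (15 / 16 * T) - 1 - 16 * π * M * rexp (7 / 8 * T)) ≤ h ^ 2 * psi K T := by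
    rw [← e2]; rw [e1] at b0 b1' b2'; nlinarith
  have c5 := le_of_mul_le_mul_left c4 (by positivity)
  have c6 : 16 * π * M * rexp (7 / 8 * T) ≤ 16 * π * M * rexp (15 / 16 * T) := by gcongr
  linarith

end MRH

namespace MRH
open MeasureTheory Real NumberField Module Set Filter Topology Asymptotics

variable {K : Type} [Field K] [NumberField K]

def gd (K : Type) [Field K] [NumberField K] (T : ℝ) : Finset ℕ :=
  (Finset.range (⌊rexp T⌋₊ + 1)).filter (fun p => p.Prime ∧ ∃ P : PP K, np P = p)

lemma good_count {T : ℝ} (s : Finset (QQ K)) (hs : ∀ q ∈ s, (nq' q : ℝ) ≤ rexp T ∧ fdeg q.1 = 1 ∧ q.2 = 0) :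
    s.card ≤ finrank ℚ K * (gd K T).card := by
  refine (Finset.card_le_mul_card_image (f := fun q : QQ K => pr q.1) s (finrank ℚ K) fun p _ => ?_).trans
    (Nat.mul_le_mul_left _ (Finset.card_le_card fun p hp => ?_))
  · rw [← Finset.card_image_of_injOn (f := Prod.fst)]
    · refine PP_count p _ fun P hP => ?_
      obtain ⟨q, hq, rfl⟩ := Finset.mem_image.mp hP
      exact (Finset.mem_filter.mp hq).2
    · intro a ha b hb hab
      have h1 := (hs a (Finset.mem_filter.mp ha).1).2.2
      have h2 := (hs b (Finset.mem_filter.mp hb).1).2.2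
      exact Prod.ext hab (h1.trans h2.symm)
  · obtain ⟨q, hq, rfl⟩ := Finset.mem_image.mp hp
    obtain ⟨h1, h2, h3⟩ := hs q hq
    have h4 : np q.1 = pr q.1 := by rw [np_eq, h2, pow_one]
    rw [nq', h3, zero_add, pow_one, h4] at h1
    exact Finset.mem_filter.mpr ⟨Finset.mem_range.mpr (Nat.lt_succ_of_le (Nat.le_floor h1)), pr_prime _, q.1, h4⟩

lemma bad_count {T : ℝ} (hT : 0 ≤ T) (s : Finset (QQ K)) (hs : ∀ q ∈ s, (nq' q : ℝ) ≤ rexp T ∧ ¬ (fdeg q.1 = 1 ∧ q.2 = 0)) :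
    (s.card : ℝ) ≤ finrank ℚ K * (2 * T * rexp (T / 2)) := by
  have h1 : s.card ≤ finrank ℚ K * (Finset.Icc 1 ⌊rexp (T / 2)⌋₊ ×ˢ Finset.range ⌊2 * T⌋₊).card := by
    refine (Finset.card_le_mul_card_image (f := fun q : QQ K => (pr q.1, q.2)) s (finrank ℚ K) fun p _ => ?_).trans
      (Nat.mul_le_mul_left _ (Finset.card_le_card fun p hp => ?_))
    · rw [← Finset.card_image_of_injOn (f := Prod.fst)]
      · refine PP_count p.1 _ fun P hP => ?_
        obtain ⟨q, hq, rfl⟩ := Finset.mem_image.mp hP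
        rw [← (Finset.mem_filter.mp hq).2]
      · intro a ha b hb hab
        have h1 := (Finset.mem_filter.mp ha).2
        have h2 := (Finset.mem_filter.mp hb).2
        exact Prod.ext hab ((Prod.ext_iff.mp (h1.trans h2.symm)).2)
    · obtain ⟨q, hq, rfl⟩ := Finset.mem_image.mp hp
      obtain ⟨h1, h2⟩ := hs q hq
      have hp := pr_prime q.1
      have hf := fdeg_pos q.1
      have h3 : 2 ≤ fdeg q.1 * (q.2 + 1) := by
        by_contra h
        apply h2
        rcases Nat.eq_zero_or_pos q.2 with h0 | h0
        · rw [h0] at h; omega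
        · nlinarith
      have h4 : pr q.1 ^ 2 ≤ nq' q := by
        rw [nq', np_eq, ← pow_mul]; exact Nat.pow_le_pow_right hp.one_lt.le h3
      have h5 : 2 ^ (q.2 + 1) ≤ nq' q := Nat.pow_le_pow_left (np_two q.1) _
      have h6 : ((pr q.1 : ℕ) : ℝ) ^ 2 ≤ rexp (T / 2) ^ 2 := by
        rw [← Real.exp_nat_mul]; push_cast
        rw [show 2 * (T / 2) = T by ring]
        refine le_trans ?_ h1
        exact_mod_cast h4
      have h7 : ((pr q.1 : ℕ) : ℝ) ≤ rexp (T / 2) := (sq_le_sq₀ (by positivity) (by positivity)).mp h6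
      have h8 : (2:ℝ) ^ (q.2 + 1) ≤ rexp T := le_trans (by exact_mod_cast h5) h1
      have h9 := Real.log_le_log (by positivity) h8
      rw [Real.log_pow, Real.log_exp] at h9
      have h10 := Real.log_two_gt_d9
      have h11 : ((q.2 + 1 : ℕ) : ℝ) ≤ 2 * T := by nlinarith [(Nat.cast_nonneg (q.2 + 1) : (0:ℝ) ≤ _)]
      rw [Finset.mem_product, Finset.mem_Icc, Finset.mem_range]
      exact ⟨⟨hp.one_lt.le, Nat.le_floor h7⟩, Nat.lt_of_succ_le (Nat.le_floor h11)⟩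
  rw [Finset.card_product, Nat.card_Icc, Finset.card_range, Nat.add_sub_cancel] at h1
  have h2 : (s.card : ℝ) ≤ finrank ℚ K * ((⌊rexp (T / 2)⌋₊ : ℝ) * ⌊2 * T⌋₊) := by exact_mod_cast h1
  refine h2.trans (mul_le_mul_of_nonneg_left ?_ (by positivity))
  rw [mul_comm]
  exact mul_le_mul (Nat.floor_le (by positivity)) (Nat.floor_le (by positivity)) (by positivity) (by positivity)

theorem psi_upper {T : ℝ} (hT : 0 ≤ T) : psi K T ≤ finrank ℚ K * T * ((gd K T).card + 2 * T * rexp (T / 2)) := by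
  refine (psi_summable T).tsum_le_of_sum_le fun s => ?_
  rw [← Finset.sum_filter]
  set t := s.filter (fun q : QQ K => log (nq' q) ≤ T)
  have ht : ∀ q ∈ t, (nq' q : ℝ) ≤ rexp T := fun q hq => by
    rw [← Real.log_le_iff_le_exp (by exact_mod_cast nq_one q)]; exact (Finset.mem_filter.mp hq).2
  have h1 : ∑ q ∈ t, log (np q.1) ≤ t.card • T := by
    refine Finset.sum_le_card_nsmul _ _ _ fun q hq => ?_
    refine le_trans ?_ (Finset.mem_filter.mp hq).2
    refine Real.log_le_log (by exact_mod_cast lt_of_lt_of_le two_pos (np_two q.1)) ?_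
    exact_mod_cast Nat.le_self_pow (by omega) _
  have h2 := Finset.card_filter_add_card_filter_not (s := t) (fun q : QQ K => fdeg q.1 = 1 ∧ q.2 = 0)
  have h3 := good_count (T := T) (t.filter (fun q : QQ K => fdeg q.1 = 1 ∧ q.2 = 0))
    fun q hq => ⟨ht q (Finset.mem_filter.mp hq).1, (Finset.mem_filter.mp hq).2⟩
  have h4 := bad_count hT (t.filter (fun q : QQ K => ¬ (fdeg q.1 = 1 ∧ q.2 = 0)))
    fun q hq => ⟨ht q (Finset.mem_filter.mp hq).1, (Finset.mem_filter.mp hq).2⟩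
  have h3' : ((t.filter (fun q : QQ K => fdeg q.1 = 1 ∧ q.2 = 0)).card : ℝ) ≤ finrank ℚ K * (gd K T).card := by exact_mod_cast h3
  have h5 : (t.card : ℝ) ≤ finrank ℚ K * (gd K T).card + finrank ℚ K * (2 * T * rexp (T / 2)) := by
    rw [← h2]; push_cast; linarith
  refine h1.trans ?_
  rw [nsmul_eq_mul]
  nlinarith

end MRH

namespace MRH
open MeasureTheory Real NumberField Module Set Filter Topology Asymptotics

variable {K : Type} [Field K] [NumberField K]

lemma root_mod {f : Polynomial ℤ} {α : K} (hα : Polynomial.aeval α f = 0) (P : PP K) {p : ℕ} (hp : p.Prime) (hP : np P = p)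
    (hl : ¬ (p:ℤ) ∣ f.leadingCoeff) : ∃ a : ZMod p, Polynomial.aeval a f = 0 := by
  have := P.2.1
  have : P.1.IsMaximal := P.2.1.isMaximal P.2.2
  letI : Field (𝓞 K ⧸ P.1) := Ideal.Quotient.field P.1
  have hc : Nat.card (𝓞 K ⧸ P.1) = p := by rw [← hP, np, Ideal.absNorm_apply, Submodule.cardQuot_apply]
  have : Finite (𝓞 K ⧸ P.1) := Nat.finite_of_card_ne_zero (hc ▸ hp.ne_zero)
  letI := Fintype.ofFinite (𝓞 K ⧸ P.1)
  have hc' : Fintype.card (𝓞 K ⧸ P.1) = p := by rw [← Nat.card_eq_fintype_card, hc]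
  let e := ZMod.ringEquivOfPrime (𝓞 K ⧸ P.1) hp hc'
  have hi := isIntegral_leadingCoeff_smul f α hα
  let β : 𝓞 K := ⟨_, hi⟩
  have hβ : Polynomial.aeval β (f.scaleRoots f.leadingCoeff) = 0 := by
    apply RingOfIntegers.coe_injective
    have := Polynomial.scaleRoots_aeval_eq_zero (r := f.leadingCoeff) hα
    rw [map_zero, ← this, ← Polynomial.aeval_algebraMap_apply]
    congr 2
    simp [β, RingOfIntegers.map_mk]
  have ha : ((f.leadingCoeff : ℤ) : 𝓞 K ⧸ P.1) ≠ 0 := by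
    intro h
    have h2 := congrArg e.symm h
    rw [map_intCast, map_zero] at h2
    exact hl ((ZMod.intCast_zmod_eq_zero_iff_dvd _ _).mp h2)
  set b : 𝓞 K ⧸ P.1 := Ideal.Quotient.mk P.1 β
  set r : 𝓞 K ⧸ P.1 := b / f.leadingCoeff
  have h3 := Polynomial.scaleRoots_eval₂_mul (p := f) (Int.castRingHom (𝓞 K ⧸ P.1)) r f.leadingCoeff
  have h4 : (Int.castRingHom (𝓞 K ⧸ P.1)) f.leadingCoeff * r = b := by
    rw [eq_intCast]; exact mul_div_cancel₀ _ ha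
  have h5 : Polynomial.eval₂ (Int.castRingHom (𝓞 K ⧸ P.1)) b (f.scaleRoots f.leadingCoeff) = 0 := by
    have := congrArg (Ideal.Quotient.mk P.1) hβ
    rw [map_zero, Polynomial.aeval_def, Polynomial.hom_eval₂] at this
    rw [← this]
    congr 1
  rw [h4, h5, eq_comm, mul_eq_zero] at h3
  have h6 := h3.resolve_left (pow_ne_zero _ (by rwa [eq_intCast]))
  refine ⟨e.symm r, ?_⟩
  have h7 := congrArg e.symm.toRingHom h6
  rw [Polynomial.hom_eval₂, map_zero] at h7
  rw [Polynomial.aeval_def, ← h7]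
  congr 1
  exact RingHom.ext_int _ _

lemma pf_card {a σ : ℕ} (h0 : a ≠ 0) (h : a ≤ 2 ^ σ) : a.primeFactors.card ≤ σ := by
  have h1 : 2 ^ a.primeFactors.card ≤ ∏ p ∈ a.primeFactors, p :=
    Finset.pow_card_le_prod _ _ _ fun p hp => (Nat.prime_of_mem_primeFactors hp).two_le
  have h2 := Nat.le_of_dvd (Nat.pos_of_ne_zero h0) (Nat.prod_primeFactors_dvd a)
  exact (Nat.pow_le_pow_iff_right (by norm_num)).mp (h1.trans (h2.trans h))

lemma gd_le {f : Polynomial ℤ} {α : K} (hα : Polynomial.aeval α f = 0) (hf : f ≠ 0) {σ : ℕ} (hσ : |f.leadingCoeff| ≤ 2 ^ σ) (T : ℝ) :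
    (gd K T).card ≤ ((Finset.range (⌊rexp T⌋₊ + 1)).filter
    (fun p => p.Prime ∧ ∃ a : ZMod p, Polynomial.aeval a f = 0)).card + σ := by
  have h0 : f.leadingCoeff.natAbs ≠ 0 := by rw [Int.natAbs_ne_zero]; exact Polynomial.leadingCoeff_ne_zero.mpr hf
  have h1 := pf_card (σ := σ) h0 (by zify; exact hσ)
  refine le_trans (Finset.card_le_card (t := _ ∪ f.leadingCoeff.natAbs.primeFactors) fun p hp => ?_) ((Finset.card_union_le _ _).trans (Nat.add_le_add_left h1 _))
  obtain ⟨g1, g2, P, hP⟩ := Finset.mem_filter.mp hp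
  rw [Finset.mem_union]
  by_cases h : (p:ℤ) ∣ f.leadingCoeff
  · exact Or.inr (Nat.mem_primeFactors.mpr ⟨g2, Int.natCast_dvd.mp h, h0⟩)
  · exact Or.inl (Finset.mem_filter.mpr ⟨g1, g2, root_mod hα P g2 hP h⟩)

end MRH

namespace MRH
open MeasureTheory Real NumberField Module Set Filter Topology Asymptotics

lemma cauchy_root {f : Polynomial ℤ} {d : ℕ} (hd : f.natDegree = d) (hd1 : 1 ≤ d) {H : ℝ} (hf : ∀ i, ‖((f.coeff i : ℤ) : ℂ)‖ ≤ H)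
    {z : ℂ} (hz : Polynomial.aeval z f = 0) : ‖((f.leadingCoeff : ℤ) : ℂ) * z‖ ≤ d * H := by
  have hH : 0 ≤ H := (norm_nonneg _).trans (hf 0)
  have hd1' : (1:ℝ) ≤ d := by exact_mod_cast hd1
  rw [Polynomial.leadingCoeff, hd]
  rw [Polynomial.aeval_eq_sum_range, hd, Finset.sum_range_succ] at hz
  rcases le_total ‖z‖ 1 with h | h
  · rw [norm_mul]
    calc _ ≤ H * 1 := mul_le_mul (hf _) h (norm_nonneg _) hH
      _ ≤ _ := by nlinarith
  · have h1 : ‖∑ i ∈ Finset.range d, f.coeff i • z ^ i‖ ≤ d * (H * ‖z‖ ^ (d - 1)) := by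
      refine (norm_sum_le _ _).trans ?_
      have := Finset.sum_le_card_nsmul (Finset.range d) (fun i => ‖f.coeff i • z ^ i‖) (H * ‖z‖ ^ (d - 1)) fun i hi => by
        rw [zsmul_eq_mul, norm_mul, norm_pow]
        exact mul_le_mul (hf i) (pow_le_pow_right₀ h (by have := Finset.mem_range.mp hi; omega)) (by positivity) hH
      rwa [Finset.card_range, nsmul_eq_mul] at this
    have h2 : ((f.coeff d : ℤ) : ℂ) * z * z ^ (d - 1) = - ∑ i ∈ Finset.range d, f.coeff i • z ^ i := by
      rw [mul_assoc, ← pow_succ', show d - 1 + 1 = d by omega, eq_neg_iff_add_eq_zero, ← hz, zsmul_eq_mul, add_comm]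
    have h3 := congrArg norm h2
    rw [norm_mul, norm_neg, norm_pow] at h3
    rw [← h3, ← mul_assoc] at h1
    exact le_of_mul_le_mul_right h1 (by positivity)

variable {K : Type} [Field K] [NumberField K]

lemma disc_le {β : K} (hβ : IsIntegral ℤ β) {d : ℕ} (hd : finrank ℚ K = d) (hli : LinearIndependent ℚ (fun i : Fin d => β ^ (i:ℕ)))
    {B : ℝ} (hB1 : 1 ≤ B) (hB : ∀ φ : K →ₐ[ℚ] ℂ, ‖φ β‖ ≤ B) : DD K ≤ (d.factorial * (B ^ d) ^ d) ^ 2 := by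
  have hcard : Fintype.card (Free.ChooseBasisIndex ℤ (𝓞 K)) = d := by
    rw [← hd, ← finrank_eq_card_basis (integralBasis K)]
  let e0 : Free.ChooseBasisIndex ℤ (𝓞 K) ≃ Fin d := Fintype.equivFinOfCardEq hcard
  let v : Free.ChooseBasisIndex ℤ (𝓞 K) → K := fun i => β ^ (e0 i : ℕ)
  let v' : Free.ChooseBasisIndex ℤ (𝓞 K) → 𝓞 K := fun i => (⟨β, hβ⟩ : 𝓞 K) ^ (e0 i : ℕ)
  have hv : LinearIndependent ℚ v := hli.comp e0 e0.injective
  have : Nonempty (Free.ChooseBasisIndex ℤ (𝓞 K)) := Fintype.card_pos_iff.mp (by rw [hcard, ← hd]; exact finrank_pos)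
  have h1 : Algebra.discr ℚ v ≠ 0 := by
    have := Algebra.discr_not_zero_of_basis ℚ (basisOfLinearIndependentOfCardEqFinrank hv (by rw [hcard, hd]))
    rwa [coe_basisOfLinearIndependentOfCardEqFinrank] at this
  have h2 := Algebra.discr_of_matrix_vecMul (integralBasis K) ((integralBasis K).toMatrix v)
  rw [Module.Basis.toMatrix_map_vecMul, ← coe_discr] at h2
  have h3 : (integralBasis K).toMatrix v = (Matrix.of fun i j => (RingOfIntegers.basis K).repr (v' j) i).map (algebraMap ℤ ℚ) := by
    ext i j
    rw [Module.Basis.toMatrix_apply, Matrix.map_apply, Matrix.of_apply, ← integralBasis_repr_apply]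
    congr 2
  set Z := (Matrix.of fun i j => (RingOfIntegers.basis K).repr (v' j) i).det
  have h4 : ((integralBasis K).toMatrix v).det = (Z : ℚ) := by
    rw [h3]; exact (RingHom.map_det (algebraMap ℤ ℚ) _).symm
  rw [h4] at h2
  have hZ : Z ≠ 0 := by rintro h; rw [h] at h2; apply h1; rw [h2]; norm_num
  have hZ1 : (1:ℝ) ≤ (Z:ℝ) ^ 2 := by
    have : (1:ℤ) ≤ Z ^ 2 := by have := sq_pos_of_ne_zero hZ; omega
    exact_mod_cast this
  have hc2 : Fintype.card (Free.ChooseBasisIndex ℤ (𝓞 K)) = Fintype.card (K →ₐ[ℚ] ℂ) := by rw [AlgHom.card, hcard, hd]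
  have h5 := Algebra.discr_eq_det_embeddingsMatrixReindex_pow_two ℚ ℂ v (Fintype.equivOfCardEq hc2)
  have h6 : ‖(Algebra.embeddingsMatrixReindex ℚ ℂ v (Fintype.equivOfCardEq hc2)).det‖ ≤ d.factorial * (B ^ d) ^ d := by
    have := Matrix.det_le (A := Algebra.embeddingsMatrixReindex ℚ ℂ v (Fintype.equivOfCardEq hc2)) (abv := NormedField.toAbsoluteValue ℂ) (x := B ^ d) fun i j => by
      change ‖Algebra.embeddingsMatrixReindex ℚ ℂ v (Fintype.equivOfCardEq hc2) i j‖ ≤ B ^ d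
      rw [Algebra.embeddingsMatrixReindex, Matrix.reindex_apply, Matrix.submatrix_apply, Algebra.embeddingsMatrix_apply, map_pow, norm_pow]
      exact (pow_le_pow_left₀ (norm_nonneg _) (hB _) _).trans (pow_le_pow_right₀ hB1 (e0 _).2.le)
    rw [hcard, nsmul_eq_mul] at this
    exact this
  have h7 : ‖algebraMap ℚ ℂ (Algebra.discr ℚ v)‖ ≤ (d.factorial * (B ^ d) ^ d) ^ 2 := by
    rw [h5, norm_pow]; exact pow_le_pow_left₀ (norm_nonneg _) h6 2
  have h8 : ‖algebraMap ℚ ℂ (Algebra.discr ℚ v)‖ = (Z:ℝ) ^ 2 * DD K := by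
    rw [h2, DD]; simp [Complex.norm_intCast]
  rw [h8] at h7
  have := DD_pos (K := K)
  nlinarith

lemma log_disc {f : Polynomial ℤ} {α : K} (hα : Polynomial.aeval α f = 0) {d σ : ℕ} (hd : f.natDegree = d) (hd2 : 1 ≤ d) (hK : finrank ℚ K = d)
    (hli : LinearIndependent ℚ (fun i : Fin d => α ^ (i:ℕ))) (hf : ∀ i, |f.coeff i| ≤ 2 ^ σ) :
    log (DD K) ≤ 4 * ((d:ℝ) ^ 2 * σ + (d:ℝ) ^ 3) := by
  have hd1 : (1:ℝ) ≤ d := by exact_mod_cast hd2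
  have hf0 : f.leadingCoeff ≠ 0 := Polynomial.leadingCoeff_ne_zero.mpr (by rintro rfl; simp at hd; omega)
  have hf' : ∀ i, ‖((f.coeff i : ℤ) : ℂ)‖ ≤ 2 ^ σ := fun i => by rw [Complex.norm_intCast]; exact_mod_cast hf i
  have hi := isIntegral_leadingCoeff_smul f α hα
  have hq : (f.leadingCoeff : ℚ) ≠ 0 := by exact_mod_cast hf0
  have hli2 : LinearIndependent ℚ (fun i : Fin d => (f.leadingCoeff • α) ^ (i:ℕ)) := by
    have := hli.units_smul (fun i => Units.mk0 (f.leadingCoeff : ℚ) hq ^ (i:ℕ))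
    convert this using 2 with i
    simp [Units.smul_def, mul_pow, Algebra.smul_def]
  have hB1 : (1:ℝ) ≤ d * 2 ^ σ := by nlinarith [one_le_pow₀ (by norm_num : (1:ℝ) ≤ 2) (n := σ)]
  have h1 := disc_le hi hK hli2 hB1 fun φ => by
    rw [zsmul_eq_mul, map_mul, map_intCast]
    refine cauchy_root hd hd2 hf' ?_
    have := Polynomial.aeval_algHom_apply (φ.restrictScalars ℤ) α f
    rw [hα, map_zero] at this
    exact this
  have h2 := Real.log_le_log DD_pos h1
  have hfac : (0:ℝ) < d.factorial := by exact_mod_cast d.factorial_pos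
  rw [Real.log_pow, Real.log_mul hfac.ne' (by positivity), Real.log_pow, Real.log_pow, Real.log_mul (by positivity) (by positivity), Real.log_pow] at h2
  have h3 : log d.factorial ≤ d * log d := by
    rw [← Real.log_pow]; exact Real.log_le_log hfac (by exact_mod_cast Nat.factorial_le_pow d)
  have h4 : log d ≤ d := (Real.log_le_sub_one_of_pos (by linarith)).trans (by linarith)
  have h5 : log 2 ≤ 1 := by linarith [Real.log_two_lt_d9]
  have h6 : (σ:ℝ) * log 2 ≤ σ := mul_le_of_le_one_right (by positivity) h5
  have h7 : (d:ℝ) * log d ≤ d * d := by gcongr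
  have h8 : (d:ℝ) * (d * (log d + σ * log 2)) ≤ d * (d * (d + σ)) := by gcongr
  push_cast at h2
  have h9 : (d:ℝ) * d ≤ d * d * d := le_mul_of_one_le_right (by positivity) hd1
  have h10 : 0 ≤ (d:ℝ) ^ 2 * σ := by positivity
  nlinarith

end MRH

namespace MRH
open MeasureTheory Real NumberField Module Set Filter Topology Asymptotics

lemma field_exists {f : Polynomial ℤ} (hf : Irreducible f) {d : ℕ} (hd : f.natDegree = d) (h2 : 2 ≤ d) :
    ∃ (K : Type) (_ : Field K) (_ : NumberField K) (α : K), Polynomial.aeval α f = 0 ∧ finrank ℚ K = d ∧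
      LinearIndependent ℚ (fun i : Fin d => α ^ (i:ℕ)) := by
  set g := f.map (Int.castRingHom ℚ)
  have hp := hf.isPrimitive (by omega)
  have hg : Irreducible g := (Polynomial.IsPrimitive.Int.irreducible_iff_irreducible_map_cast hp).mp hf
  have : Fact (Irreducible g) := ⟨hg⟩
  have hgd : g.natDegree = d := by rw [Polynomial.natDegree_map_eq_of_injective Int.cast_injective, hd]
  let pb := AdjoinRoot.powerBasis hg.ne_zero
  have : FiniteDimensional ℚ (AdjoinRoot g) := pb.finite
  have : CharZero (AdjoinRoot g) := charZero_of_injective_algebraMap (algebraMap ℚ (AdjoinRoot g)).injective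
  have hdim : pb.dim = d := by rw [← hgd]; exact AdjoinRoot.powerBasis_dim hg.ne_zero
  refine ⟨AdjoinRoot g, inferInstance, ⟨⟩, AdjoinRoot.root g, ?_, ?_, ?_⟩
  · have := AdjoinRoot.eval₂_root g
    rw [Polynomial.eval₂_map] at this
    rw [Polynomial.aeval_def, ← this]
    congr 1
  · rw [pb.finrank, hdim]
  · have h := pb.basis.linearIndependent
    rw [pb.coe_basis] at h
    have hgen : pb.gen = AdjoinRoot.root g := AdjoinRoot.powerBasis_gen hg.ne_zero
    rw [hgen] at h
    subst hdim
    exact h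

lemma final_est {A C : ℝ} (hA : 0 < A) (hC : 4 < C) : ∃ c : ℝ, 0 < c ∧ ∀ (d σ : ℕ), 2 ≤ d → 0 < σ → ∀ T : ℝ,
    c * log ((d : ℝ) ^ 2 * σ + (d : ℝ) ^ 3) ^ (2 + C ^ 2) ≤ T → 2 ≤ T ∧
    (2 + 16 * π * (A * (d + 4 * ((d : ℝ) ^ 2 * σ + (d : ℝ) ^ 3)))) * rexp (15 / 16 * T) + 2 * T * rexp (T / 2) + σ ≤
      rexp T * rexp (-T ^ (1 / C) / log ((d : ℝ) ^ 2 * σ + (d : ℝ) ^ 3) ^ C) := by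
  set B := 11 + 80 * π * A
  have hpi := Real.pi_pos
  have hB : 1 ≤ B := by have : 0 < 80 * π * A := by positivity
                        linarith
  have hlB := Real.log_nonneg hB
  refine ⟨64 * log B + 1000, by positivity, fun d σ hd hσ T hT => ?_⟩
  have hd2 : (2:ℝ) ≤ d := by exact_mod_cast hd
  have hs : (1:ℝ) ≤ σ := by exact_mod_cast hσ
  have hY0 : (4:ℝ) * σ + 8 ≤ (d : ℝ) ^ 2 * σ + (d : ℝ) ^ 3 := by
    have h1 : (4:ℝ) ≤ (d:ℝ) ^ 2 := by nlinarith
    have h2 : (8:ℝ) ≤ (d:ℝ) ^ 3 := by nlinarith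
    nlinarith
  have hY1 : (d:ℝ) ≤ (d : ℝ) ^ 2 * σ + (d : ℝ) ^ 3 := by nlinarith [sq_nonneg (d:ℝ)]
  set Y := (d : ℝ) ^ 2 * σ + (d : ℝ) ^ 3
  set L := log Y
  have hYp : 0 < Y := by linarith
  have hL : 1 ≤ L := by
    rw [Real.le_log_iff_exp_le hYp]; linarith [Real.exp_one_lt_d9]
  have hLL : L ≤ L ^ (2 + C ^ 2) := by
    conv_lhs => rw [← Real.rpow_one L]
    exact Real.rpow_le_rpow_of_exponent_le hL (by nlinarith)
  have h1 : (64 * log B + 1000) * L ≤ T := le_trans (by gcongr) hT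
  have h2 : 64 * log B + 1000 ≤ T := by nlinarith
  have hT1 : 1000 ≤ T := by linarith
  refine ⟨by linarith, ?_⟩
  have e1 : T ^ (1 / C) ≤ T / 32 := by
    have g1 : T ^ (1 / C) ≤ T ^ (1 / 4 : ℝ) := Real.rpow_le_rpow_of_exponent_le (by linarith)
      (one_div_le_one_div_of_le (by norm_num) hC.le)
    refine g1.trans ?_
    set u := T ^ (1 / 4 : ℝ)
    have g2 : u ^ 4 = T := by rw [← Real.rpow_natCast, ← Real.rpow_mul (by linarith)]; norm_num
    have g0 : 0 ≤ u := Real.rpow_nonneg (by linarith) _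
    have g3 : 4 ≤ u := by
      by_contra h
      have := pow_le_pow_left₀ g0 (not_le.mp h).le 4
      rw [g2] at this; norm_num at this; linarith
    have g4 : (4:ℝ) ^ 3 ≤ u ^ 3 := pow_le_pow_left₀ (by norm_num) g3 3
    rw [← g2]; nlinarith
  have e2 : T ^ (1 / C) / L ^ C ≤ T / 32 := by
    refine le_trans (div_le_self (Real.rpow_nonneg (by linarith) _) ?_) e1
    exact Real.one_le_rpow hL (by linarith)
  have e3 : B * Y * rexp (15 / 16 * T) ≤ rexp T * rexp (-T ^ (1 / C) / L ^ C) := by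
    have hBY : B * Y = rexp (log B + L) := by rw [Real.exp_add, Real.exp_log (by linarith), Real.exp_log hYp]
    rw [hBY, ← Real.exp_add, ← Real.exp_add, neg_div]
    refine Real.exp_le_exp.mpr ?_
    nlinarith
  refine le_trans ?_ e3
  have e4 : 2 * T * rexp (T / 2) ≤ 8 * rexp (15 / 16 * T) := by
    have g1 := Real.add_one_le_exp (T / 4)
    calc _ ≤ 2 * (4 * rexp (T / 4)) * rexp (T / 2) := by gcongr; linarith
      _ = 8 * rexp (T / 4 + T / 2) := by rw [Real.exp_add]; ring
      _ ≤ _ := by gcongr; linarith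
  have e5 : 1 ≤ rexp (15 / 16 * T) := Real.one_le_exp (by linarith)
  generalize rexp (15 / 16 * T) = E at *
  have e6 : (σ:ℝ) ≤ Y * E := by nlinarith
  have e7 : π * A * (d * E) ≤ π * A * (Y * E) := by gcongr
  have e8 : E ≤ Y * E := le_mul_of_one_le_left (by linarith) (by linarith)
  simp only [B]
  nlinarith

lemma main_ineq (hG : DedekindGRH) : ∃ A > 0, ∀ (f : Polynomial ℤ) (d σ : ℕ), Irreducible f → f.natDegree = d → 2 ≤ d →
    (∀ i, |f.coeff i| ≤ 2 ^ σ) → ∀ T : ℝ, 2 ≤ T →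
    rexp T - (2 + 16 * π * (A * (d + 4 * ((d : ℝ) ^ 2 * σ + (d : ℝ) ^ 3)))) * rexp (15 / 16 * T) ≤ d * T * (((Finset.range (⌊rexp T⌋₊ + 1)).filter
    (fun p => p.Prime ∧ ∃ a : ZMod p, Polynomial.aeval a f = 0)).card + σ + 2 * T * rexp (T / 2)) := by
  obtain ⟨A, hA, h⟩ := F_exists hG
  refine ⟨A, hA, fun f d σ hf hd h2 hc T hT => ?_⟩
  obtain ⟨K, i1, i2, α, hα, hK, hli⟩ := field_exists hf hd h2
  obtain ⟨F, hF⟩ := h K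
  rw [hK] at hF
  have hD := log_disc hα hd (by omega) hK hli hc
  have hD0 : 0 ≤ log (DD K) := Real.log_nonneg DD_one
  have h3 := psi_lower (by positivity) hF hT
  have h4 := psi_upper (K := K) (T := T) (by linarith)
  have h5 : ((gd K T).card : ℝ) ≤ ((Finset.range (⌊rexp T⌋₊ + 1)).filter
    (fun p => p.Prime ∧ ∃ a : ZMod p, Polynomial.aeval a f = 0)).card + σ := by exact_mod_cast gd_le hα hf.ne_zero (hc _) T
  rw [hK] at h4
  have h6 : (2 + 16 * π * (A * (d + log (DD K)))) * rexp (15 / 16 * T) ≤ (2 + 16 * π * (A * (d + 4 * ((d : ℝ) ^ 2 * σ + (d : ℝ) ^ 3)))) * rexp (15 / 16 * T) := by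
    have := Real.pi_pos
    gcongr
  have h7 := mul_le_mul_of_nonneg_left h5 (by positivity : 0 ≤ (d:ℝ) * T)
  linarith

end MRH

/-- GRH for Dedekind zeta functions implies MRH with any constant `C > 4`. -/
theorem grh_implies_mrh (h : DedekindGRH) :
    ∀ C : ℝ, 4 < C →
      ∃ c : ℝ, 0 < c ∧
        ∀ (f : Polynomial ℤ) (d σ : ℕ), Irreducible f → f.natDegree = d → 2 ≤ d → 0 < σ →
          (∀ i, |f.coeff i| ≤ 2 ^ σ) →
          ∀ x : ℝ,
            Real.exp (c * Real.log ((d : ℝ) ^ 2 * σ + (d : ℝ) ^ 3) ^ (2 + C ^ 2)) ≤ x →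
            (piPoly f x : ℝ) ≥
              x * (1 / (d * Real.log x) -
                Real.exp (-(Real.log x) ^ (1 / C) /
                  Real.log ((d : ℝ) ^ 2 * σ + (d : ℝ) ^ 3) ^ C)) := by
  intro C hC
  obtain ⟨A, hA, hm⟩ := MRH.main_ineq h
  obtain ⟨c, hc, hfin⟩ := MRH.final_est hA hC
  refine ⟨c, hc, fun f d σ hf hd h2 hσ hco x hx => ?_⟩
  have hx0 : 0 < x := lt_of_lt_of_le (Real.exp_pos _) hx
  obtain ⟨T, rfl⟩ : ∃ T, x = Real.exp T := ⟨Real.log x, (Real.exp_log hx0).symm⟩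
  rw [Real.exp_le_exp] at hx
  rw [Real.log_exp]
  obtain ⟨hT, h3⟩ := hfin d σ h2 hσ T hx
  have h4 := hm f d σ hf hd h2 hco T hT
  change _ ≤ (d:ℝ) * T * ((piPoly f (Real.exp T) : ℝ) + σ + 2 * T * Real.exp (T / 2)) at h4
  have hd2 : (2:ℝ) ≤ d := by exact_mod_cast h2
  have hdT : 1 ≤ (d:ℝ) * T := by nlinarith
  set Q := (2 + 16 * Real.pi * (A * (d + 4 * ((d : ℝ) ^ 2 * σ + (d : ℝ) ^ 3)))) * Real.exp (15 / 16 * T)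
  have hQ : 0 ≤ Q := by have := Real.pi_pos; positivity
  have h5 : Q ≤ d * T * Q := le_mul_of_one_le_left hQ hdT
  set E := Real.exp T * Real.exp (-T ^ (1 / C) / Real.log ((d : ℝ) ^ 2 * σ + (d : ℝ) ^ 3) ^ C)
  have h6 := mul_le_mul_of_nonneg_left h3 (by linarith : 0 ≤ (d:ℝ) * T)
  have h7 : Real.exp T ≤ d * T * (piPoly f (Real.exp T) + E) := by nlinarith
  rw [mul_sub, mul_one_div]
  have h8 : Real.exp T / (d * T) ≤ piPoly f (Real.exp T) + E := by
    rw [div_le_iff₀' (by linarith)]; exact h7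
  change Real.exp T / (d * T) - E ≤ _
  linarith

end
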